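/- Let n be an integer with 3 ≤ n ≤ 28 and let F_n denote the n-th Fibonacci number. Then the only integer solutions (x, y) of x·(x − F_n·y)·(x − 2^n·y) − y³ = ±1 are (1,0), (−1,0), (0,1), (0,−1), (F_n,1), (−F_n,−1), (2^n,1), (−2^n,−1). -/

import Mathlib

section
open Finset in
lemma weight_sum_ge {ι : Type*} [Fintype ι] (N : ℕ) (hN : Fintype.card ι = N) (φ : ι → ℕ)
    (hφ : ∀ i, φ i ≤ N) (hinj : ∀ i j, φ i < N → φ i = φ j → i = j) :
    ∑ m ∈ range N, m ≤ ∑ i, φ i := by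
  classical
  have h1 : ∑ i, φ i = ∑ m ∈ range N, (univ.filter (fun i => m < φ i)).card := by
    simp_rw [card_filter]
    rw [sum_comm]
    refine sum_congr rfl fun i _ => ?_
    rw [← card_filter]
    have : (range N).filter (fun m => m < φ i) = range (φ i) := by
      ext m; simp; intro h; exact lt_of_lt_of_le h (hφ i)
    rw [this, card_range]
  rw [h1, ← sum_range_reflect]
  refine sum_le_sum fun m hm => ?_
  rw [mem_range] at hm
  have h2 : (univ.filter (fun i => m < φ i)).card + (univ.filter (fun i => ¬ m < φ i)).card = N := by
    rw [card_filter_add_card_filter_not, card_univ, hN]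
  have h3 : (univ.filter (fun i => ¬ m < φ i)).card ≤ (range (m+1)).card := by
    refine card_le_card_of_injOn φ ?_ ?_
    · intro i hi
      simp at hi ⊢
      omega
    · intro i hi j hj h
      simp at hi hj
      exact hinj i j (by omega) h
  rw [card_range] at h3
  omega

open Finset in
lemma det_bound {ι : Type*} [Fintype ι] [DecidableEq ι] (N : ℕ) (hN : Fintype.card ι = N)
    (M : ι → ℝ) (R : ℝ) (hR : 0 ≤ R) (x : ι → ℂ) (hx : ∀ j, ‖x j‖ ≤ R)
    (c : ι → ℕ → ℂ) (hc : ∀ i m, ‖c i m‖ * R ^ m ≤ M i * Real.exp (-(m:ℝ)))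
    (f : ι → ι → ℂ)
    (hf : ∀ i j, ‖f i j - ∑ m ∈ range N, c i m * x j ^ m‖ ≤ M i * Real.exp (-(N:ℝ))) :
    ‖(Matrix.of f).det‖ ≤ (N.factorial : ℝ) * ((N:ℝ) + 1) ^ N *
      Real.exp (-(∑ m ∈ range N, (m:ℝ))) * ∏ i, M i := by
  classical
  have hM : ∀ i, 0 ≤ M i := by
    intro i
    have := hc i 0
    simp at this
    exact (norm_nonneg _).trans this
  -- vectors
  let u : ι → Fin (N+1) → ι → ℂ := fun i m j =>
    if (m:ℕ) < N then c i m * x j ^ (m:ℕ) else f i j - ∑ m ∈ range N, c i m * x j ^ m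
  have hu : ∀ i m j, ‖u i m j‖ ≤ M i * Real.exp (-((m:ℕ):ℝ)) := by
    intro i m j
    simp only [u]
    split_ifs with h
    · rw [norm_mul, norm_pow]
      refine le_trans ?_ (hc i m)
      gcongr
      exact hx j
    · have : (m:ℕ) = N := by omega
      rw [this]; exact hf i j
  have hsum : (f : ι → ι → ℂ) = fun i => ∑ m : Fin (N+1), u i m := by
    funext i j
    rw [Finset.sum_apply, Fin.sum_univ_castSucc]
    simp only [u, Fin.val_castSucc, Fin.is_lt, if_true, Fin.val_last, lt_irrefl, if_false]
    rw [Fin.sum_univ_eq_sum_range (fun m => c i m * x j ^ m) N]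
    ring
  have hdet : (Matrix.of f).det = ∑ φ : ι → Fin (N+1), (Matrix.of fun i => u i (φ i)).det := by
    have := (Matrix.detRowAlternating (R := ℂ) (n := ι)).toMultilinearMap.map_sum u
    rw [← hsum] at this
    exact this
  rw [hdet]
  refine (norm_sum_le _ _).trans ?_
  have hterm : ∀ φ : ι → Fin (N+1), ‖(Matrix.of fun i => u i (φ i)).det‖ ≤
      (N.factorial : ℝ) * Real.exp (-(∑ m ∈ range N, (m:ℝ))) * ∏ i, M i := by
    intro φ
    have hpos : 0 ≤ (N.factorial : ℝ) * Real.exp (-(∑ m ∈ range N, (m:ℝ))) * ∏ i, M i := by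
      have := prod_nonneg (s := univ) (fun i _ => hM i)
      positivity
    by_cases hinj : ∀ i j, (φ i : ℕ) < N → (φ i : ℕ) = φ j → i = j
    · have hw := weight_sum_ge N hN (fun i => (φ i : ℕ)) (fun i => by have := (φ i).2; omega) hinj
      rw [Matrix.det_apply]
      refine (norm_sum_le _ _).trans ?_
      have : ∀ σ ∈ (univ : Finset (Equiv.Perm ι)), ‖Equiv.Perm.sign σ • ∏ i, (Matrix.of fun i => u i (φ i)) (σ i) i‖
          ≤ Real.exp (-(∑ m ∈ range N, (m:ℝ))) * ∏ i, M i := by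
        intro σ _
        have e1 : ‖Equiv.Perm.sign σ • ∏ i, (Matrix.of fun i => u i (φ i)) (σ i) i‖
            = ∏ i, ‖u (σ i) (φ (σ i)) i‖ := by
          rcases Int.units_eq_one_or (Equiv.Perm.sign σ) with h | h <;> rw [h] <;> simp
        rw [e1]
        calc ∏ i, ‖u (σ i) (φ (σ i)) i‖ ≤ ∏ i, (M (σ i) * Real.exp (-((φ (σ i):ℕ):ℝ))) :=
              prod_le_prod (fun i _ => norm_nonneg _) (fun i _ => hu _ _ _)
          _ = ∏ i, (M i * Real.exp (-((φ i:ℕ):ℝ))) :=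
              Equiv.prod_comp σ (fun i => M i * Real.exp (-((φ i:ℕ):ℝ)))
          _ = Real.exp (-(∑ i, ((φ i:ℕ):ℝ))) * ∏ i, M i := by
              rw [prod_mul_distrib, ← Real.exp_sum, sum_neg_distrib, mul_comm]
          _ ≤ _ := by
              have := prod_nonneg (s := univ) (fun i _ => hM i)
              gcongr
              have hw' : ((∑ m ∈ range N, m : ℕ):ℝ) ≤ ((∑ i, (φ i:ℕ) : ℕ):ℝ) := Nat.cast_le.mpr hw
              push_cast at hw'
              exact hw'
      refine (sum_le_sum this).trans ?_
      rw [sum_const, card_univ, Fintype.card_perm, hN, nsmul_eq_mul, mul_assoc]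
    · push Not at hinj
      obtain ⟨i, j, h1, h2, h3⟩ := hinj
      have hij : φ i = φ j := Fin.ext h2
      have h1' : (φ j : ℕ) < N := by omega
      have : (Matrix.of fun i => u i (φ i)).det = 0 := by
        have hrow : (Matrix.of fun i => u i (φ i)) =
          Matrix.of fun a => (if a = i then c i (φ i) else if a = j then c j (φ i) else 1) •
            (if a = i ∨ a = j then (fun b => x b ^ (φ i : ℕ)) else u a (φ a)) := by
          ext a b
          by_cases ha : a = i
          · subst ha; simp [u, h1]
          · by_cases hb : a = j
            · subst hb; simp [u, h1', ha, hij]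
            · simp [ha, hb]
        rw [hrow]
        have := Matrix.det_mul_column (fun a => (if a = i then c i (φ i) else if a = j then c j (φ i) else 1))
          (Matrix.of fun a => (if a = i ∨ a = j then (fun b => x b ^ (φ i : ℕ)) else u a (φ a)))
        have e : (Matrix.of fun a => (if a = i then c i (φ i) else if a = j then c j (φ i) else 1) •
            (if a = i ∨ a = j then (fun b => x b ^ (φ i : ℕ)) else u a (φ a))) =
            Matrix.of fun a b => (if a = i then c i (φ i) else if a = j then c j (φ i) else 1) *
            (Matrix.of fun a => (if a = i ∨ a = j then (fun b => x b ^ (φ i : ℕ)) else u a (φ a))) a b := by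
          ext a b; rfl
        rw [e, this, Matrix.det_zero_of_row_eq h3, mul_zero]
        funext b; simp
      rw [this, norm_zero]; exact hpos
  refine (sum_le_sum fun φ _ => hterm φ).trans ?_
  rw [sum_const, card_univ, Fintype.card_fun, hN, Fintype.card_fin, nsmul_eq_mul]
  push_cast
  apply le_of_eq
  ring

end

section
open Polynomial Finset in
lemma zero_estimate (K L S2 T r : ℕ) (hK : 1 ≤ K) (P : Fin L → ℝ[X]) (hdeg : ∀ l, (P l).natDegree ≤ K - 1)
    (hP : ∃ l, P l ≠ 0) (ξ θ : ℝ) (hξ : 0 < ξ) (hξ1 : ξ ≠ 1) (hθ : θ ≠ 0)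
    (hS : S2 ≤ r) (hcount : (K - 1) * L < S2 * T)
    (hz : ∀ s t : ℕ, s < S2 + L → t < T →
      ∑ l : Fin L, (P l).eval ((s:ℝ) + r * t) * (ξ ^ s * θ ^ t) ^ (l:ℕ) = 0) : False := by
  classical
  let A := {l : Fin L // P l ≠ 0}
  have : Nonempty A := let ⟨l, h⟩ := hP; ⟨⟨l, h⟩⟩
  let a := Fintype.card A
  have haL : a ≤ L := by
    have := Fintype.card_subtype_le (fun l : Fin L => P l ≠ 0)
    simpa [a, A] using this
  let e : A ≃ Fin a := Fintype.equivFin A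
  -- matrix
  let W : Matrix (Fin a) (Fin a) ℝ[X] := fun i j =>
    (P (e.symm i).1).comp (X + C ((j:ℕ):ℝ)) * C ((ξ ^ ((e.symm i).1 : ℕ)) ^ (j:ℕ))
  have hcompdeg : ∀ (i j : Fin a), ((P (e.symm i).1).comp (X + C ((j:ℕ):ℝ))).natDegree = (P (e.symm i).1).natDegree := by
    intro i j; rw [natDegree_comp, natDegree_X_add_C, mul_one]
  let d : ℕ := ∑ i, (P (e.symm i).1).natDegree
  have hWdeg : ∀ i j, (W i j).natDegree ≤ (P (e.symm i).1).natDegree := by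
    intro i j
    refine (natDegree_mul_C_le _ _).trans (hcompdeg i j).le
  have hdetdeg : W.det.natDegree ≤ d := by
    rw [Matrix.det_apply]
    refine natDegree_sum_le_of_forall_le _ _ fun σ _ => ?_
    have : (Equiv.Perm.sign σ • ∏ i, W (σ i) i).natDegree ≤ (∏ i, W (σ i) i).natDegree := by
      rcases Int.units_eq_one_or (Equiv.Perm.sign σ) with h | h <;> rw [h] <;> simp
    refine this.trans ((natDegree_prod_le _ _).trans ?_)
    refine (sum_le_sum fun i _ => hWdeg (σ i) i).trans ?_
    exact (Equiv.sum_comp σ (fun i => (P (e.symm i).1).natDegree)).le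
  have hcoeff : W.det.coeff d = (∏ i, (P (e.symm i).1).leadingCoeff) *
      (Matrix.vandermonde fun i : Fin a => ξ ^ ((e.symm i).1 : ℕ)).det := by
    rw [← Matrix.det_mul_column, Matrix.det_apply, Matrix.det_apply, finsetSum_coeff]
    refine sum_congr rfl fun σ _ => ?_
    have key : (∏ i, W (σ i) i).coeff d = ∏ i, ((P (e.symm (σ i)).1).leadingCoeff *
        (ξ ^ ((e.symm (σ i)).1 : ℕ)) ^ (i:ℕ)) := by
      have hprod : ∏ i, W (σ i) i = (∏ i, (P (e.symm (σ i)).1).comp (X + C ((i:ℕ):ℝ))) *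
          C (∏ i : Fin a, (ξ ^ ((e.symm (σ i)).1 : ℕ)) ^ (i:ℕ)) := by
        simp only [W]
        rw [prod_mul_distrib, map_prod]
      have hd : d = (∏ i, (P (e.symm (σ i)).1).comp (X + C ((i:ℕ):ℝ))).natDegree := by
        rw [natDegree_prod]
        · rw [show d = ∑ i, (P (e.symm (σ i)).1).natDegree from (Equiv.sum_comp σ (fun i => (P (e.symm i).1).natDegree)).symm]
          exact sum_congr rfl fun i _ => (hcompdeg (σ i) i).symm
        · intro i _
          intro h0
          have hne := (e.symm (σ i)).2
          have := leadingCoeff_comp (p := P (e.symm (σ i)).1) (q := X + C ((i:ℕ):ℝ)) (by rw [natDegree_X_add_C]; norm_num)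
          rw [h0, leadingCoeff_X_add_C, one_pow, mul_one, leadingCoeff_zero] at this
          exact hne (leadingCoeff_eq_zero.mp this.symm)
      rw [hprod, coeff_mul_C, prod_mul_distrib]
      congr 1
      rw [hd, coeff_natDegree, leadingCoeff_prod]
      refine prod_congr rfl fun i _ => ?_
      rw [leadingCoeff_comp (by rw [natDegree_X_add_C]; norm_num), leadingCoeff_X_add_C, one_pow, mul_one]
    rcases Int.units_eq_one_or (Equiv.Perm.sign σ) with h | h <;> rw [h] <;>
      simp [key, Matrix.vandermonde]
  have hne : W.det ≠ 0 := by
    intro h0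
    rw [h0, coeff_zero] at hcoeff
    have h1 : (∏ i, (P (e.symm i).1).leadingCoeff) ≠ 0 :=
      prod_ne_zero_iff.mpr fun i _ => leadingCoeff_ne_zero.mpr (e.symm i).2
    have h2 : (Matrix.vandermonde fun i : Fin a => ξ ^ ((e.symm i).1 : ℕ)).det ≠ 0 := by
      rw [Matrix.det_vandermonde_ne_zero_iff]
      intro i j hij
      have := pow_right_injective₀ hξ hξ1 hij
      exact e.symm.injective (Subtype.ext (Fin.ext this))
    exact mul_ne_zero h1 h2 hcoeff.symm
  -- roots
  let Z : Finset ℝ := (range S2 ×ˢ range T).image (fun p => (p.1:ℝ) + r * p.2)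
  have hZcard : Z.card = S2 * T := by
    rw [card_image_of_injOn, card_product, card_range, card_range]
    rintro ⟨s, t⟩ hst ⟨s', t'⟩ hst' h
    simp at hst hst' h
    have h' : s + r * t = s' + r * t' := by exact_mod_cast h
    have ht : t = t' := by
      rcases lt_trichotomy t t' with hlt | heq | hlt
      · exfalso
        have : r * t + r ≤ r * t' := by nlinarith
        omega
      · exact heq
      · exfalso
        have : r * t' + r ≤ r * t := by nlinarith
        omega
    subst ht
    simp at h'
    simp [h']
  have hroots : ∀ z ∈ Z, W.det.eval z = 0 := by
    intro z hzZ
    simp only [Z, mem_image, mem_product, mem_range] at hzZ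
    obtain ⟨⟨s, t⟩, ⟨hs, ht⟩, rfl⟩ := hzZ
    simp only at hs ht ⊢
    rw [← coe_evalRingHom, RingHom.map_det]
    apply Matrix.exists_vecMul_eq_zero_iff.mp
    refine ⟨fun i => (ξ ^ s * θ ^ t) ^ ((e.symm i).1 : ℕ), ?_, ?_⟩
    · obtain ⟨i⟩ : Nonempty (Fin a) := e.nonempty_congr.mp inferInstance
      intro h
      have := congrFun h i
      simp at this
      rcases this.1 with h | h
      · exact hξ.ne' h.1
      · exact hθ h.1
    · funext j
      have hj := hz (s + j) t (by have := j.2; omega) ht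
      rw [Pi.zero_apply, ← hj]
      have hW : ∀ i, (evalRingHom ((s:ℝ) + r * t)).mapMatrix W i j =
          eval ((s:ℝ) + r * t + (j:ℕ)) (P (e.symm i).1) * (ξ ^ ((e.symm i).1:ℕ)) ^ (j:ℕ) := by
        intro i
        rw [RingHom.mapMatrix_apply, Matrix.map_apply]
        simp only [W, coe_evalRingHom, eval_mul, eval_comp, eval_add, eval_X, eval_C]
      simp only [Matrix.vecMul, dotProduct, hW]
      rw [Equiv.sum_comp e.symm (fun l : A => (ξ ^ s * θ ^ t) ^ (l.1 : ℕ) *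
        (eval ((s:ℝ) + r * t + (j:ℕ)) (P l.1) * (ξ ^ (l.1:ℕ)) ^ (j:ℕ)))]
      rw [← Finset.sum_subtype (univ.filter fun l : Fin L => P l ≠ 0) (by simp)
        (fun l : Fin L => (ξ ^ s * θ ^ t) ^ (l : ℕ) *
        (eval ((s:ℝ) + r * t + (j:ℕ)) (P l) * (ξ ^ (l:ℕ)) ^ (j:ℕ)))]
      rw [sum_filter]
      refine sum_congr rfl fun l _ => ?_
      split_ifs with h
      · push_cast
        rw [pow_add, ← pow_mul, mul_comm (l:ℕ) (j:ℕ), pow_mul]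
        have : (s:ℝ) + r * t + (j:ℕ) = s + (j:ℕ) + r * t := by ring
        rw [this]
        ring
      · simp at h; simp [h]
  have h1 := card_le_degree_of_subset_roots (p := W.det) (Z := Z) (by
    intro z hz'
    rw [mem_roots hne]
    exact hroots z hz')
  have h2 : d ≤ a * (K - 1) := by
    refine (sum_le_card_nsmul _ _ (K-1) fun i _ => hdeg _).trans ?_
    simp
  have h3 : a * (K-1) ≤ (K-1) * L := by rw [mul_comm]; exact Nat.mul_le_mul_left _ haL
  omega

end

section
open Finset in
lemma taylor_bound (f : ℂ → ℂ) (hf : Differentiable ℂ f) (r' : ℝ) (hr : 0 < r') (M : ℝ)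
    (hM : ∀ z, ‖z‖ ≤ r' → ‖f z‖ ≤ M) :
    ∃ c : ℕ → ℂ, (∀ m, ‖c m‖ * r' ^ m ≤ M) ∧
      ∀ z, ‖z‖ ≤ r' * Real.exp (-1) → ∀ N : ℕ,
        ‖f z - ∑ m ∈ range N, c m * z ^ m‖ ≤ 2 * M * Real.exp (-(N:ℝ)) := by
  have hM0 : 0 ≤ M := (norm_nonneg _).trans (hM 0 (by simp [hr.le]))
  refine ⟨fun m => (m.factorial : ℂ)⁻¹ * iteratedDeriv m f 0, ?_, ?_⟩
  · intro m
    have h := Complex.norm_iteratedDeriv_le_of_forall_mem_sphere_norm_le (c := 0) (f := f) m hr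
      hf.diffContOnCl (fun z hz => hM z (by simpa using hz.le))
    rw [norm_mul, norm_inv, Complex.norm_natCast]
    have hfac : (0:ℝ) < m.factorial := by positivity
    have hrm : 0 < r' ^ m := by positivity
    calc (m.factorial:ℝ)⁻¹ * ‖iteratedDeriv m f 0‖ * r' ^ m
        ≤ (m.factorial:ℝ)⁻¹ * (m.factorial * M / r' ^ m) * r' ^ m := by gcongr
      _ = M := by field_simp
  · intro z hz N
    set c : ℕ → ℂ := fun m => (m.factorial : ℂ)⁻¹ * iteratedDeriv m f 0 with hc
    have hcb : ∀ m, ‖c m‖ * r' ^ m ≤ M := by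
      intro m
      have h := Complex.norm_iteratedDeriv_le_of_forall_mem_sphere_norm_le (c := 0) (f := f) m hr
        hf.diffContOnCl (fun z hz => hM z (by simpa using hz.le))
      rw [hc]
      simp only
      rw [norm_mul, norm_inv, Complex.norm_natCast]
      have hfac : (0:ℝ) < m.factorial := by positivity
      have hrm : 0 < r' ^ m := by positivity
      calc (m.factorial:ℝ)⁻¹ * ‖iteratedDeriv m f 0‖ * r' ^ m
          ≤ (m.factorial:ℝ)⁻¹ * (m.factorial * M / r' ^ m) * r' ^ m := by gcongr
        _ = M := by field_simp
    have hs : HasSum (fun m => c m * z ^ m) (f z) := by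
      have := Complex.hasSum_taylorSeries_of_entire hf 0 z
      simp only [sub_zero, smul_eq_mul] at this
      convert! this using 2
      rw [hc]; ring
    have he : Real.exp (-1) ≤ 1/2 := by
      rw [Real.exp_neg, ← one_div]
      have := Real.add_one_le_exp (1:ℝ)
      apply one_div_le_one_div_of_le <;> linarith
    have hterm : ∀ m, ‖c m * z ^ m‖ ≤ M * Real.exp (-1) ^ m := by
      intro m
      rw [norm_mul, norm_pow]
      calc ‖c m‖ * ‖z‖ ^ m ≤ ‖c m‖ * (r' * Real.exp (-1)) ^ m := by gcongr
        _ = ‖c m‖ * r' ^ m * Real.exp (-1) ^ m := by rw [mul_pow]; ring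
        _ ≤ _ := by gcongr; exact hcb m
    have htail : HasSum (fun m => c (m + N) * z ^ (m + N)) (f z - ∑ m ∈ range N, c m * z ^ m) :=
      (hasSum_nat_add_iff' N).mpr hs
    have hgeo : HasSum (fun m : ℕ => M * Real.exp (-1) ^ N * (1/2:ℝ) ^ m) (M * Real.exp (-1) ^ N * 2) := by
      have := (hasSum_geometric_of_lt_one (r := (1/2:ℝ)) (by norm_num) (by norm_num)).mul_left (M * Real.exp (-1) ^ N)
      convert! this using 2
      norm_num
    have := htail.norm_le_of_bounded hgeo (fun m => by
      refine (hterm _).trans ?_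
      rw [pow_add, mul_comm (Real.exp (-1) ^ m), ← mul_assoc]
      gcongr)
    refine this.trans (le_of_eq ?_)
    rw [← Real.exp_nat_mul]
    rw [show (N:ℝ) * -1 = -(N:ℝ) by ring]
    ring

lemma exists_minor {ι κ : Type*} [Fintype ι] [DecidableEq ι] [Fintype κ]
    (M : ι → κ → ℝ) (h : ∀ v : ι → ℝ, (∀ j, ∑ i, v i * M i j = 0) → v = 0) :
    ∃ f : ι → κ, (Matrix.of fun i j => M i (f j)).det ≠ 0 := by
  classical
  -- columns span
  let col : κ → (ι → ℝ) := fun j i => M i j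
  have hspan : Submodule.span ℝ (Set.range col) = ⊤ := by
    by_contra hne
    obtain ⟨φ, hφ0, hφ⟩ := Submodule.exists_le_ker_of_lt_top _ (lt_top_iff_ne_top.mpr hne)
    apply hφ0
    have hv := h (fun i => φ (Pi.single i 1)) (fun j => by
      have : φ (col j) = 0 := hφ (Submodule.subset_span ⟨j, rfl⟩)
      rw [← this]
      conv_rhs => rw [LinearMap.pi_apply_eq_sum_univ φ (col j)]
      refine Finset.sum_congr rfl fun i _ => ?_
      rw [smul_eq_mul, mul_comm]
      have e : (Pi.single i 1 : ι → ℝ) = fun j => if i = j then 1 else 0 := by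
        funext j'
        simp [Pi.single_apply, eq_comm]
      rw [e])
    refine LinearMap.pi_ext' fun i => ?_
    ext
    simpa using congrFun hv i
  obtain ⟨s, hs1, hs2, hs3⟩ := exists_linearIndependent ℝ (Set.range col)
  rw [hspan] at hs2
  let b : Module.Basis s ℝ (ι → ℝ) := Module.Basis.mk hs3 (by simp [hs2])
  haveI : Fintype s := FiniteDimensional.fintypeBasisIndex b
  have hcard : Fintype.card s = Fintype.card ι := by
    rw [← Module.finrank_eq_card_basis b, Module.finrank_fintype_fun_eq_card]
  let e : ι ≃ s := (Fintype.equivOfCardEq hcard).symm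
  choose g hg using fun x : s => hs1 x.2
  refine ⟨fun j => g (e j), ?_⟩
  have hli : LinearIndependent ℝ (fun j : ι => ((e j : s) : ι → ℝ)) := hs3.comp e e.injective
  have hmat : (Matrix.of fun i j => M i (g (e j))) = (Matrix.of fun j : ι => ((e j : s) : ι → ℝ)).transpose := by
    ext i j
    have := congrFun (hg (e j)) i
    simpa [col] using this
  rw [hmat, Matrix.det_transpose]
  have := Matrix.linearIndependent_rows_iff_isUnit (A := (Matrix.of fun j : ι => ((e j : s) : ι → ℝ)))
  have hu := this.mp hli
  exact ((Matrix.isUnit_iff_isUnit_det _).mp hu).ne_zero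

end

section
open Polynomial in
lemma minor_exists (K L S T r : ℕ) (hK : 1 ≤ K) (hLS : L ≤ S) (hS : S - L ≤ r)
    (hcount : (K - 1) * L < (S - L) * T) (ξ θ : ℝ) (hξ : 0 < ξ) (hξ1 : ξ ≠ 1) (hθ : θ ≠ 0) :
    ∃ f : Fin K × Fin L → Fin S × Fin T,
      (Matrix.of fun (i j : Fin K × Fin L) =>
        ((((f j).1 : ℕ) + r * ((f j).2 : ℕ)).choose (i.1 : ℕ) : ℝ) *
          (ξ ^ ((f j).1 : ℕ) * θ ^ ((f j).2 : ℕ)) ^ (i.2 : ℕ)).det ≠ 0 := by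
  refine exists_minor (fun (i : Fin K × Fin L) (p : Fin S × Fin T) =>
    ((((p.1 : ℕ) + r * (p.2 : ℕ)).choose (i.1 : ℕ) : ℕ) : ℝ) *
          (ξ ^ (p.1 : ℕ) * θ ^ (p.2 : ℕ)) ^ (i.2 : ℕ)) ?_
  intro v hv
  by_contra hne
  let P : Fin L → ℝ[X] := fun l => ∑ k : Fin K, C (v (k, l) / ((k : ℕ).factorial : ℝ)) * descPochhammer ℝ (k : ℕ)
  have heval : ∀ l (n : ℕ), (P l).eval (n : ℝ) = ∑ k : Fin K, v (k, l) * (n.choose (k : ℕ) : ℝ) := by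
    intro l n
    simp only [P, eval_finset_sum, eval_mul, eval_C]
    refine Finset.sum_congr rfl fun k _ => ?_
    rw [descPochhammer_eval_eq_descFactorial, Nat.descFactorial_eq_factorial_mul_choose]
    push_cast
    have : ((k : ℕ).factorial : ℝ) ≠ 0 := by positivity
    field_simp
  refine zero_estimate K L (S - L) T r hK P ?_ ?_ ξ θ hξ hξ1 hθ hS hcount ?_
  · intro l
    refine natDegree_sum_le_of_forall_le _ _ fun k _ => ?_
    refine (natDegree_C_mul_le _ _).trans ?_
    have h1 : (descPochhammer ℝ (k : ℕ)).natDegree = k := descPochhammer_natDegree _ _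
    have := k.2
    omega
  · by_contra hall
    push Not at hall
    apply hne
    have : ∀ (m : ℕ) (hm : m < K) (l : Fin L), v (⟨m, hm⟩, l) = 0 := by
      intro m
      induction m using Nat.strong_induction_on with
      | _ m ih =>
        intro hm l
        have h0 := heval l m
        rw [hall l, eval_zero] at h0
        rw [Finset.sum_eq_single (⟨m, hm⟩ : Fin K)] at h0
        · simpa using h0.symm
        · intro k _ hk
          rcases lt_trichotomy (k : ℕ) m with h | h | h
          · rw [show k = ⟨(k : ℕ), k.2⟩ from rfl, ih _ h]; simp
          · exact absurd (Fin.ext h) hk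
          · rw [Nat.choose_eq_zero_of_lt h]; simp
        · simp
    funext ⟨k, l⟩
    exact this k k.2 l
  · intro s t hs ht
    have hs' : s < S := by omega
    have := hv (⟨s, hs'⟩, ⟨t, ht⟩)
    rw [Fintype.sum_prod_type_right] at this
    simp only at this
    rw [← this]
    refine Finset.sum_congr rfl fun l _ => ?_
    have h2 := heval l (s + r * t)
    push_cast at h2
    rw [h2, Finset.sum_mul]
    refine Finset.sum_congr rfl fun k _ => ?_
    ring

/-- Complex binomial polynomial. -/
noncomputable def cbin (k : ℕ) (z : ℂ) : ℂ := (∏ i ∈ Finset.range k, (z - i)) / (k.factorial : ℂ)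

lemma cbin_nat (k n : ℕ) : cbin k (n : ℂ) = (n.choose k : ℂ) := by
  unfold cbin
  have h1 : (∏ i ∈ Finset.range k, ((n : ℂ) - i)) = (n.descFactorial k : ℂ) := by
    rw [← descPochhammer_eval_eq_descFactorial, descPochhammer_eval_eq_prod_range]
  rw [h1, Nat.descFactorial_eq_factorial_mul_choose]
  push_cast
  have : ((k : ℕ).factorial : ℂ) ≠ 0 := by exact_mod_cast k.factorial_ne_zero
  field_simp

lemma cbin_bound (k K : ℕ) (hk : k < K) (lam R : ℝ) (hlam : 1 ≤ lam) (hR : R + K ≤ lam * K) (z : ℂ)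
    (hz : ‖z‖ ≤ R) : ‖cbin k z‖ ≤ (lam * Real.exp 1) ^ K := by
  unfold cbin
  rw [norm_div, Complex.norm_natCast, norm_prod]
  have hR0 : 0 ≤ R := (norm_nonneg z).trans hz
  have h1 : ∏ i ∈ Finset.range k, ‖z - i‖ ≤ ∏ i ∈ Finset.range k, (lam * K) := by
    refine Finset.prod_le_prod (fun _ _ => norm_nonneg _) fun i hi => ?_
    rw [Finset.mem_range] at hi
    refine (norm_sub_le _ _).trans ?_
    rw [Complex.norm_natCast]
    have : (i : ℝ) ≤ K := by exact_mod_cast (by omega)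
    linarith
  rw [Finset.prod_const, Finset.card_range] at h1
  have hf : (0 : ℝ) < k.factorial := by positivity
  calc _ ≤ (lam * K) ^ k / (k.factorial : ℝ) := by gcongr
    _ = lam ^ k * ((K : ℝ) ^ k / k.factorial) := by rw [mul_pow]; ring
    _ ≤ lam ^ K * Real.exp (K : ℝ) := by
      gcongr
      exact Real.pow_div_factorial_le_exp _ (by positivity) _
    _ = _ := by rw [mul_pow, ← Real.exp_nat_mul, mul_one]

lemma cbin_diff (k : ℕ) : Differentiable ℂ (cbin k) := by
  unfold cbin
  fun_prop

lemma choose_bound (k K n : ℕ) (hk : k < K) (lam R : ℝ) (hlam : 1 ≤ lam) (hR : R + K ≤ lam * K)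
    (hn : (n : ℝ) ≤ R) : (n.choose k : ℝ) ≤ (lam * Real.exp 1) ^ K := by
  have := cbin_bound k K hk lam R hlam hR (n : ℂ) (by rwa [Complex.norm_natCast])
  rwa [cbin_nat, Complex.norm_natCast] at this

end

lemma minor_upper (K L S T r N : ℕ) (hN : N = K * L) (ℓ Λ X lam Eb : ℝ) (hlam : 1 ≤ lam)
    (hSr : 0 < (S : ℝ) + r * T)
    (hR : Real.exp 1 * (S + r * T) + K ≤ lam * K)
    (hE : L * (|ℓ| * (Real.exp 1 * (S + r * T))) ≤ Eb)
    (hΛ : |Λ| ≤ Real.exp (-X)) (hNX : (N : ℝ) ≤ X / 2) (hLT : 2 * ((L : ℝ) * T) ≤ Real.exp (X / 2)) (hX : 0 ≤ X)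
    (f : Fin K × Fin L → Fin S × Fin T) (w : Fin K × Fin L → ℝ)
    (hw : ∀ j, w j = Real.exp (ℓ * ((((f j).1 : ℕ) : ℝ) + r * ((f j).2 : ℕ)) - ((f j).2 : ℕ) * Λ)) :
    |(Matrix.of fun (i j : Fin K × Fin L) =>
        ((((f j).1 : ℕ) + r * ((f j).2 : ℕ)).choose (i.1 : ℕ) : ℝ) * (w j) ^ (i.2 : ℕ)).det| ≤
      N.factorial * ((N:ℝ)+1)^N * Real.exp (-(∑ m ∈ Finset.range N,(m:ℝ))) *
        (3 * ((lam * Real.exp 1) ^ K * Real.exp Eb)) ^ N := by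
  set R : ℝ := S + r * T with hRdef
  set M0 : ℝ := (lam * Real.exp 1) ^ K * Real.exp Eb with hM0
  have hM0pos : 0 < M0 := by positivity
  have hcard : Fintype.card (Fin K × Fin L) = N := by simp [hN]
  have he : (1:ℝ) ≤ Real.exp 1 := by simp
  have hReR : R ≤ Real.exp 1 * R := by nlinarith
  -- Taylor coefficients
  have hT : ∀ i : Fin K × Fin L, ∃ c : ℕ → ℂ, (∀ m, ‖c m‖*(Real.exp 1 * R)^m ≤ M0) ∧
      ∀ z, ‖z‖≤(Real.exp 1 * R)*Real.exp (-1) → ∀ N, ‖(cbin i.1 z * Complex.exp ((i.2 : ℕ) * (ℓ * z))) - ∑ m∈Finset.range N, c m*z^m‖ ≤ 2*M0*Real.exp (-(N:ℝ)) := by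
    intro i
    refine taylor_bound (fun z => cbin i.1 z * Complex.exp ((i.2 : ℕ) * (ℓ * z))) ?_ _ (by positivity) M0 ?_
    · exact (cbin_diff _).mul (by fun_prop)
    · intro z hz
      rw [norm_mul]
      refine mul_le_mul (cbin_bound _ K i.1.2 lam _ hlam hR z hz) ?_ (norm_nonneg _) (by positivity)
      refine (Complex.norm_exp_le_exp_norm _).trans ?_
      rw [Real.exp_le_exp, norm_mul, norm_mul, Complex.norm_natCast, Complex.norm_real, Real.norm_eq_abs]
      refine le_trans ?_ hE
      have : ((i.2 : ℕ) : ℝ) ≤ L := by exact_mod_cast i.2.2.le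
      gcongr
  choose c hc1 hc2 using hT
  have hz : ∀ j, ‖(((((f j).1 : ℕ) + r * ((f j).2 : ℕ) : ℕ)) : ℂ)‖ ≤ R := by
    intro j
    rw [Complex.norm_natCast]
    have h1 : (((f j).1 : ℕ) : ℝ) ≤ S := by exact_mod_cast (f j).1.2.le
    have h2 : (((f j).2 : ℕ) : ℝ) ≤ T := by exact_mod_cast (f j).2.2.le
    push_cast
    rw [hRdef]
    gcongr
  have key := det_bound N hcard (fun _ => 3 * M0) R hSr.le
    (fun j => (((((f j).1 : ℕ) + r * ((f j).2 : ℕ) : ℕ)) : ℂ)) hz c ?_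
    (fun i j => (((((f j).1 : ℕ) + r * ((f j).2 : ℕ)).choose (i.1 : ℕ) : ℕ) : ℂ) * ((w j : ℝ) : ℂ) ^ (i.2 : ℕ)) ?_
  · rw [Finset.prod_const, Finset.card_univ, hcard] at key
    refine le_trans (le_of_eq ?_) key
    rw [← Real.norm_eq_abs, ← Complex.norm_real]
    congr 1
    have := RingHom.map_det Complex.ofRealHom (Matrix.of fun (i j : Fin K × Fin L) =>
        ((((f j).1 : ℕ) + r * ((f j).2 : ℕ)).choose (i.1 : ℕ) : ℝ) * (w j) ^ (i.2 : ℕ))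
    simp only [Complex.ofRealHom_eq_coe] at this
    rw [this]
    congr 1
    ext i j
    simp
  · intro i m
    have h := hc1 i m
    rw [mul_pow, ← Real.exp_nat_mul, mul_one] at h
    rw [Real.exp_neg]
    have hp := Real.exp_pos (m:ℝ)
    rw [← div_eq_mul_inv, le_div_iff₀ hp]
    calc _ = ‖c i m‖ * (Real.exp m * R ^ m) := by ring
      _ ≤ M0 := h
      _ ≤ _ := by linarith
  · intro i j
    set s := ((f j).1 : ℕ) with hs
    set t := ((f j).2 : ℕ) with ht
    set zz : ℂ := ((s + r * t : ℕ) : ℂ) with hzz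
    have h2 := hc2 i zz (by
      have := hz j
      rw [mul_right_comm, ← Real.exp_add, add_neg_cancel, Real.exp_zero, one_mul]
      exact this) N
    set l := (i.2 : ℕ) with hl
    set g : ℂ := cbin i.1 zz * Complex.exp ((l : ℕ) * (ℓ * zz)) with hg
    have hgM : ‖g‖ ≤ M0 := by
      rw [hg, norm_mul]
      have hzj := (hz j).trans hReR
      refine mul_le_mul (cbin_bound _ K i.1.2 lam _ hlam hR zz hzj) ?_ (norm_nonneg _) (by positivity)
      refine (Complex.norm_exp_le_exp_norm _).trans ?_
      rw [Real.exp_le_exp, norm_mul, norm_mul, Complex.norm_natCast, Complex.norm_real, Real.norm_eq_abs]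
      refine le_trans ?_ hE
      have : ((i.2 : ℕ) : ℝ) ≤ L := by exact_mod_cast i.2.2.le
      gcongr
    have hent : (((s + r * t).choose (i.1 : ℕ) : ℕ) : ℂ) * ((w j : ℝ) : ℂ) ^ l
        = g * Complex.exp ((-(l * t * Λ) : ℝ) : ℂ) := by
      rw [hg, ← cbin_nat, hw j, mul_assoc, ← Complex.exp_add, Complex.ofReal_exp, ← Complex.exp_nat_mul]
      congr 2
      rw [hzz, ← hs, ← ht]
      push_cast
      ring
    have hpert : ‖Complex.exp ((-(l * t * Λ) : ℝ) : ℂ) - 1‖ ≤ Real.exp (-(N:ℝ)) := by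
      have hlt : |l * t * Λ| ≤ (L * T) * Real.exp (-X) := by
        rw [abs_mul, abs_of_nonneg (by positivity : (0:ℝ) ≤ (l:ℝ) * t)]
        have h1 : (l : ℝ) ≤ L := by exact_mod_cast i.2.2.le
        have h2 : (t : ℝ) ≤ T := by exact_mod_cast (f j).2.2.le
        gcongr
      have hb : 2 * ((L * T) * Real.exp (-X)) ≤ Real.exp (-(N:ℝ)) := by
        calc 2 * ((L * T) * Real.exp (-X)) = (2 * (L * T)) * Real.exp (-X) := by ring
          _ ≤ Real.exp (X/2) * Real.exp (-X) := by gcongr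
          _ = Real.exp (-(X/2)) := by rw [← Real.exp_add]; congr 1; ring
          _ ≤ _ := by rw [Real.exp_le_exp]; linarith
      have hle1 : Real.exp (-(N:ℝ)) ≤ 1 := by simp
      have hn : ‖((-(l * t * Λ) : ℝ) : ℂ)‖ = |l * t * Λ| := by
        rw [Complex.norm_real, Real.norm_eq_abs, abs_neg]
      have := Complex.norm_exp_sub_one_le (x := ((-(l * t * Λ) : ℝ) : ℂ)) (by rw [hn]; linarith [abs_nonneg (l * t * Λ)])
      rw [hn] at this
      linarith
    rw [hent]
    have : g * Complex.exp ((-(l * t * Λ) : ℝ) : ℂ) - ∑ m ∈ Finset.range N, c i m * zz ^ m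
       = (g - ∑ m ∈ Finset.range N, c i m * zz ^ m) + g * (Complex.exp ((-(l * t * Λ) : ℝ) : ℂ) - 1) := by ring
    rw [this]
    refine (norm_add_le _ _).trans ?_
    rw [norm_mul]
    have h3 : ‖g‖ * ‖Complex.exp ((-(l * t * Λ) : ℝ) : ℂ) - 1‖ ≤ M0 * Real.exp (-(N:ℝ)) := by gcongr
    linarith

/-- Liouville-type property of a subring of a finite power of the reals. -/
def Liou {I : Type*} (i0 : I) (𝒜 : Subring (I → ℝ)) : Prop :=
  ∀ z ∈ 𝒜, z i0 ≠ 0 → ∀ M : ℝ, 1 ≤ M → (∀ i, |z i| ≤ M) → 1 ≤ |z i0| * M ^ 5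

lemma det_mem {I ι : Type*} [Fintype ι] [DecidableEq ι] (𝒜 : Subring (I → ℝ))
    (E : Matrix ι ι (I → ℝ)) (h : ∀ i j, E i j ∈ 𝒜) : E.det ∈ 𝒜 := by
  rw [Matrix.det_apply]
  refine sum_mem fun σ _ => ?_
  rw [Units.smul_def]
  exact zsmul_mem (prod_mem fun i _ => h _ _) _

lemma det_eval {I ι : Type*} [Fintype ι] [DecidableEq ι]
    (E : Matrix ι ι (I → ℝ)) (i : I) : E.det i = (Matrix.of fun a b => E a b i).det := by
  have := RingHom.map_det (Pi.evalRingHom (fun _ : I => ℝ) i) E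
  exact this

lemma final_contra (K L S T N : ℕ) (hN1 : 1 ≤ N) (Hx Ht lam Eb Δ D : ℝ) (hlam : 1 ≤ lam)
    (hfin : 6 * K * (1 + Real.log lam) + Eb + 5 * (L * S * Hx) + 6 * (L * T * Ht) +
      7 * Real.log (N + 1) + 2 < ((N : ℝ) - 1) / 2)
    (hΔ : |Δ| ≤ N.factorial * ((N:ℝ)+1)^N * Real.exp (-(∑ m ∈ Finset.range N,(m:ℝ))) *
        (3 * ((lam * Real.exp 1) ^ K * Real.exp Eb)) ^ N)
    (hD : |D| ≤ |Δ| * (Real.exp (L * T * Ht)) ^ N)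
    (h1 : 1 ≤ |D| * (N.factorial * ((lam * Real.exp 1) ^ K * Real.exp (L * S * Hx + L * T * Ht)) ^ N) ^ 5) : False := by
  have hlam0 : 0 < lam := by linarith
  have hfac : (N.factorial : ℝ) ≤ ((N:ℝ) + 1) ^ N := by
    have h : (N.factorial : ℝ) ≤ (N:ℝ) ^ N := by exact_mod_cast N.factorial_le_pow
    refine h.trans ?_
    gcongr
    linarith
  have hgauss : (∑ m ∈ Finset.range N,(m:ℝ)) = N * (((N:ℝ) - 1) / 2) := by
    have h := Finset.sum_range_id_mul_two N
    have h2 : ((∑ m ∈ Finset.range N, m : ℕ) : ℝ) * 2 = N * ((N - 1 : ℕ) : ℝ) := by exact_mod_cast h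
    rw [Nat.cast_sub hN1] at h2
    push_cast at h2
    linarith
  have hle : lam * Real.exp 1 = Real.exp (1 + Real.log lam) := by
    rw [Real.exp_add, Real.exp_log hlam0]; ring
  have hB : (lam * Real.exp 1) ^ K = Real.exp (K * (1 + Real.log lam)) := by
    rw [hle, ← Real.exp_nat_mul]
  have hNp : ((N:ℝ) + 1) = Real.exp (Real.log (N + 1)) := by
    rw [Real.exp_log (by positivity)]
  have h3 : (3:ℝ) ≤ Real.exp 2 := by
    have := Real.add_one_le_exp (2:ℝ); linarith
  rw [hB] at hΔ h1
  have e1 : Real.exp (-(∑ m ∈ Finset.range N,(m:ℝ))) = Real.exp (-(((N:ℝ) - 1) / 2)) ^ N := by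
    rw [hgauss, ← Real.exp_nat_mul]; congr 1; ring
  rw [e1] at hΔ
  have hb1 : |D| * (N.factorial * (Real.exp (K * (1 + Real.log lam)) * Real.exp (L * S * Hx + L * T * Ht)) ^ N) ^ 5
     ≤ ((((N:ℝ)+1)^N * ((N:ℝ)+1)^N * Real.exp (-(((N:ℝ) - 1) / 2)) ^ N *
        (Real.exp 2 * (Real.exp (K * (1 + Real.log lam)) * Real.exp Eb)) ^ N) * (Real.exp (L * T * Ht)) ^ N) *
        (((N:ℝ)+1)^N * (Real.exp (K * (1 + Real.log lam)) * Real.exp (L * S * Hx + L * T * Ht)) ^ N) ^ 5 := by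
    gcongr
    refine hD.trans ?_
    gcongr
    refine hΔ.trans ?_
    gcongr
  have hb2 : ((((N:ℝ)+1)^N * ((N:ℝ)+1)^N * Real.exp (-(((N:ℝ) - 1) / 2)) ^ N *
        (Real.exp 2 * (Real.exp (K * (1 + Real.log lam)) * Real.exp Eb)) ^ N) * (Real.exp (L * T * Ht)) ^ N) *
        (((N:ℝ)+1)^N * (Real.exp (K * (1 + Real.log lam)) * Real.exp (L * S * Hx + L * T * Ht)) ^ N) ^ 5
      = (Real.exp (6 * K * (1 + Real.log lam) + Eb + 5 * (L * S * Hx) + 6 * (L * T * Ht) +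
      7 * Real.log (N + 1) + 2 - ((N : ℝ) - 1) / 2)) ^ N := by
    have e2 : ∀ x y : ℝ, (x ^ N * y ^ N) ^ 5 = ((x * y) ^ 5) ^ N := by
      intro x y
      rw [← mul_pow, ← pow_mul, ← pow_mul, mul_comm N 5]
    rw [e2]
    simp only [← mul_pow]
    congr 1
    rw [hNp]
    simp only [← Real.exp_add, ← Real.exp_nat_mul]
    congr 1
    rw [← hNp]
    push_cast
    ring
  rw [hb2] at hb1
  have hlt : (Real.exp (6 * K * (1 + Real.log lam) + Eb + 5 * (L * S * Hx) + 6 * (L * T * Ht) +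
      7 * Real.log (N + 1) + 2 - ((N : ℝ) - 1) / 2)) ^ N < 1 := by
    refine pow_lt_one₀ (by positivity) ?_ (by omega)
    rw [Real.exp_lt_one_iff]
    linarith
  linarith

lemma core {I : Type*} (i0 : I) (𝒜 : Subring (I → ℝ)) (hL : Liou i0 𝒜)
    (ξ c w : I → ℝ) (hξ : ξ ∈ 𝒜) (hc : c ∈ 𝒜) (hw : w ∈ 𝒜) (Hx Ht : ℝ) (hHx : 0 ≤ Hx) (hHt : 0 ≤ Ht)
    (bξ : ∀ i, |ξ i| ≤ Real.exp Hx) (bc : ∀ i, |c i| ≤ Real.exp Ht) (bw : ∀ i, |w i| ≤ Real.exp Ht)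
    (pξ : 0 < ξ i0) (pc : 0 < c i0) (pw : 0 < w i0) (hξ1 : ξ i0 ≠ 1)
    (K L S T r N : ℕ) (hN : N = K * L) (hN1 : 1 ≤ N) (Λ X lam Eb : ℝ) (hlam : 1 ≤ lam)
    (hK : 1 ≤ K) (hLS : L ≤ S) (hS0 : 1 ≤ S) (hS : S - L ≤ r)
    (hcount : (K - 1) * L < (S - L) * T)
    (hR : Real.exp 1 * (S + r * T) + K ≤ lam * K)
    (hE : L * (|Real.log (ξ i0)| * (Real.exp 1 * (S + r * T))) ≤ Eb)
    (hΛe : r * Real.log (ξ i0) = Real.log (w i0) - Real.log (c i0) + Λ)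
    (hΛ : |Λ| ≤ Real.exp (-X)) (hNX : (N : ℝ) ≤ X / 2) (hLT : 2 * ((L : ℝ) * T) ≤ Real.exp (X / 2)) (hX : 0 ≤ X)
    (hfin : 6 * K * (1 + Real.log lam) + Eb + 5 * (L * S * Hx) + 6 * (L * T * Ht) +
      7 * Real.log (N + 1) + 2 < ((N : ℝ) - 1) / 2) : False := by
  classical
  obtain ⟨f, hf⟩ := minor_exists K L S T r hK hLS hS hcount (ξ i0) (w i0 / c i0) pξ hξ1 (by positivity)
  have hSr : 0 < (S : ℝ) + r * T := by
    have : (1:ℝ) ≤ S := by exact_mod_cast hS0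
    positivity
  have hup := minor_upper K L S T r N hN (Real.log (ξ i0)) Λ X lam Eb hlam hSr hR hE hΛ hNX hLT hX f
    (fun j => (ξ i0) ^ ((f j).1 : ℕ) * (w i0 / c i0) ^ ((f j).2 : ℕ)) (by
      intro j
      rw [← Real.exp_log pξ, ← Real.exp_log (by positivity : 0 < w i0 / c i0), ← Real.exp_nat_mul,
        ← Real.exp_nat_mul, ← Real.exp_add, Real.log_exp, Real.log_div pw.ne' pc.ne']
      congr 1
      have : Real.log (w i0) - Real.log (c i0) = r * Real.log (ξ i0) - Λ := by linarith
      rw [this]; ring)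
  set Δ := (Matrix.of fun (i j : Fin K × Fin L) =>
        ((((f j).1 : ℕ) + r * ((f j).2 : ℕ)).choose (i.1 : ℕ) : ℝ) *
          ((ξ i0) ^ ((f j).1 : ℕ) * (w i0 / c i0) ^ ((f j).2 : ℕ)) ^ (i.2 : ℕ)).det with hΔ
  -- the scaled matrix
  let E : Matrix (Fin K × Fin L) (Fin K × Fin L) (I → ℝ) := Matrix.of fun i j =>
    ((((f j).1 : ℕ) + r * ((f j).2 : ℕ)).choose (i.1 : ℕ) : I → ℝ) *
      (ξ ^ (((f j).1 : ℕ) * (i.2 : ℕ)) * (w ^ (((f j).2 : ℕ) * (i.2 : ℕ)) *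
        c ^ (((f j).2 : ℕ) * (L - 1 - (i.2 : ℕ)))))
  have hmem : E.det ∈ 𝒜 := det_mem 𝒜 E fun i j =>
    mul_mem (natCast_mem _ _) (mul_mem (pow_mem hξ _) (mul_mem (pow_mem hw _) (pow_mem hc _)))
  have hdet0 : E.det i0 = (∏ j, (c i0) ^ (((f j).2 : ℕ) * (L - 1))) * Δ := by
    rw [det_eval, hΔ, ← Matrix.det_mul_row]
    congr 1
    ext i j
    simp only [E, Matrix.of_apply, Pi.mul_apply, Pi.pow_apply, Pi.natCast_apply]
    have hl := i.2.2
    have hsplit : ((f j).2 : ℕ) * (L - 1) = ((f j).2 : ℕ) * (L - 1 - (i.2 : ℕ)) + ((f j).2 : ℕ) * (i.2 : ℕ) := by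
      rw [← mul_add]; congr 1; omega
    rw [hsplit, pow_add, mul_pow, div_pow, div_pow, ← pow_mul, ← pow_mul, ← pow_mul]
    have : c i0 ^ (((f j).2 : ℕ) * (i.2 : ℕ)) ≠ 0 := by positivity
    field_simp
  have hne : E.det i0 ≠ 0 := by
    rw [hdet0]
    refine mul_ne_zero (Finset.prod_ne_zero_iff.mpr fun j _ => by positivity) hf
  have hcard : Fintype.card (Fin K × Fin L) = N := by simp [hN]
  have hbd : ∀ i, |E.det i| ≤ N.factorial * ((lam * Real.exp 1) ^ K * Real.exp (L * S * Hx + L * T * Ht)) ^ N := by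
    intro i
    rw [det_eval]
    have := Matrix.det_le (A := (Matrix.of fun a b => E a b i)) (abv := AbsoluteValue.abs)
      (x := (lam * Real.exp 1) ^ K * Real.exp (L * S * Hx + L * T * Ht)) ?_
    · rw [hcard, nsmul_eq_mul] at this
      exact this
    · intro a b
      simp only [E, Matrix.of_apply, Pi.mul_apply, Pi.pow_apply, Pi.natCast_apply, AbsoluteValue.abs_apply]
      have h1 : (((f b).1 : ℕ) : ℝ) ≤ S := by exact_mod_cast (f b).1.2.le
      have h2 : (((f b).2 : ℕ) : ℝ) ≤ T := by exact_mod_cast (f b).2.2.le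
      have h3 : ((a.2 : ℕ) : ℝ) ≤ L := by exact_mod_cast a.2.2.le
      have hl := a.2.2
      have h4 : ((a.2 : ℕ) : ℝ) + ((L - 1 - (a.2 : ℕ) : ℕ) : ℝ) ≤ L := by
        exact_mod_cast (by omega)
      have he : (1:ℝ) ≤ Real.exp 1 := by simp
      rw [abs_mul, abs_mul, abs_mul, abs_pow, abs_pow, abs_pow, Nat.abs_cast]
      refine mul_le_mul (choose_bound _ K _ a.1.2 lam _ hlam hR ?_) ?_ (by positivity) (by positivity)
      · push_cast
        calc (((f b).1 : ℕ) : ℝ) + r * ((f b).2 : ℕ) ≤ S + r * T := by gcongr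
          _ ≤ _ := by nlinarith
      · calc _ ≤ (Real.exp Hx) ^ (((f b).1 : ℕ) * (a.2 : ℕ)) * ((Real.exp Ht) ^ (((f b).2 : ℕ) * (a.2 : ℕ)) *
              (Real.exp Ht) ^ (((f b).2 : ℕ) * (L - 1 - (a.2 : ℕ)))) := by
                gcongr
                · exact bξ i
                · exact bw i
                · exact bc i
          _ = Real.exp ((((f b).1 : ℕ) * (a.2 : ℕ) : ℝ) * Hx + ((((f b).2 : ℕ) : ℝ) * (((a.2 : ℕ) : ℝ) + ((L - 1 - (a.2 : ℕ) : ℕ) : ℝ))) * Ht) := by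
                rw [← Real.exp_nat_mul, ← Real.exp_nat_mul, ← Real.exp_nat_mul, ← Real.exp_add, ← Real.exp_add]
                congr 1
                push_cast
                ring
          _ ≤ _ := by
                rw [Real.exp_le_exp, mul_comm (L:ℝ) S, mul_comm (L:ℝ) T]
                gcongr
  have hM1 : (1:ℝ) ≤ N.factorial * ((lam * Real.exp 1) ^ K * Real.exp (L * S * Hx + L * T * Ht)) ^ N := by
    have h1 : (1:ℝ) ≤ N.factorial := by exact_mod_cast N.factorial_pos
    have he : (1:ℝ) ≤ Real.exp 1 := by simp
    have h2 : (1:ℝ) ≤ (lam * Real.exp 1) ^ K := one_le_pow₀ (one_le_mul_of_one_le_of_one_le hlam he)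
    have h3 : (1:ℝ) ≤ Real.exp (L * S * Hx + L * T * Ht) := Real.one_le_exp (by positivity)
    exact one_le_mul_of_one_le_of_one_le h1 (one_le_pow₀ (one_le_mul_of_one_le_of_one_le h2 h3))
  have h1 := hL _ hmem hne _ hM1 hbd
  refine final_contra K L S T N hN1 Hx Ht lam Eb Δ (E.det i0) hlam hfin hup ?_ h1
  rw [hdet0, abs_mul, mul_comm, Finset.abs_prod]
  gcongr
  rw [← hcard, ← Finset.card_univ, ← Finset.prod_const]
  refine Finset.prod_le_prod (fun _ _ => abs_nonneg _) fun j _ => ?_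
  rw [abs_pow]
  calc _ ≤ (Real.exp Ht) ^ (((f j).2 : ℕ) * (L - 1)) := by gcongr; exact bc i0
    _ = Real.exp (((((f j).2 : ℕ) * (L - 1) : ℕ) : ℝ) * Ht) := by rw [← Real.exp_nat_mul]
    _ ≤ _ := by
      rw [Real.exp_le_exp, mul_comm (L:ℝ) T]
      have h2 : (((f j).2 : ℕ) : ℝ) ≤ T := by exact_mod_cast (f j).2.2.le
      have h3 : ((L - 1 : ℕ) : ℝ) ≤ L := by exact_mod_cast (by omega)
      push_cast
      gcongr

lemma zp_mem {I : Type*} (𝒜 : Subring (I → ℝ)) (g g' : I → ℝ) (hg : g ∈ 𝒜) (hg' : g' ∈ 𝒜)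
    (h : ∀ i, g i * g' i = 1) (p : ℤ) : (fun i => g i ^ p) ∈ 𝒜 := by
  cases p with
  | ofNat n =>
    have : (fun i => g i ^ (Int.ofNat n)) = g ^ n := by
      funext i; simp
    rw [this]; exact pow_mem hg _
  | negSucc n =>
    have : (fun i => g i ^ (Int.negSucc n)) = g' ^ (n + 1) := by
      funext i
      rw [zpow_negSucc, Pi.pow_apply, ← inv_pow, inv_eq_of_mul_eq_one_right (h i)]
    rw [this]; exact pow_mem hg' _

lemma abs_log_le (x H : ℝ) (hx : x ≠ 0) (h : |x| ≤ Real.exp H) (h' : |x⁻¹| ≤ Real.exp H) :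
    |Real.log x| ≤ H := by
  rw [← Real.log_abs, abs_le]
  have hp := abs_pos.mpr hx
  constructor
  · have := Real.log_le_log (by positivity) h'
    rw [Real.log_exp, abs_inv, Real.log_inv] at this
    linarith
  · have := Real.log_le_log hp h
    rwa [Real.log_exp] at this

lemma zp_bound (x H : ℝ) (hx : x ≠ 0) (h : |x| ≤ Real.exp H) (h' : |x⁻¹| ≤ Real.exp H) (p : ℤ) (P : ℝ)
    (hP : |(p:ℝ)| ≤ P) : |x ^ p| ≤ Real.exp (P * H) := by
  have hp := abs_pos.mpr hx
  have hl := abs_log_le x H hx h h'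
  rw [abs_zpow, ← Real.exp_log (zpow_pos hp p), Real.log_zpow, Real.log_abs, Real.exp_le_exp]
  calc (p:ℝ) * Real.log x ≤ |(p:ℝ) * Real.log x| := le_abs_self _
    _ = |(p:ℝ)| * |Real.log x| := abs_mul _ _
    _ ≤ _ := by gcongr; exact (abs_nonneg _).trans hP

lemma params (q b : ℕ) (hq1 : 1 ≤ q) (hqQ : q ≤ 2 ^ 55) (hb : 2 ^ 170 ≤ b) :
    ∃ K S T r : ℕ, 1 ≤ K ∧ 1536 ≤ S ∧ 1 ≤ T ∧ S ≤ r ∧ r = b / q ∧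
      (2:ℝ) ^ 150 ≤ K ∧ (K:ℝ) * 1536 ≤ b / 2 ∧ (S:ℝ) * (12800 * q) ≤ K ∧
      (T:ℝ) * (33280 * b) ≤ K * (q * 2 ^ 55) ∧ (S:ℝ) ≤ r * T ∧ (r * T : ℝ) ≤ K * 2 ^ 55 / 33280 ∧
      2 * (1536 * (T:ℝ)) ≤ b / 2 ∧ (K - 1) * 1536 < (S - 1536) * T := by
  have hqR1 : (1:ℝ) ≤ q := by exact_mod_cast hq1
  have hqRQ : (q:ℝ) ≤ 2 ^ 55 := by exact_mod_cast hqQ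
  have hbR : (2:ℝ) ^ 170 ≤ b := by exact_mod_cast hb
  obtain ⟨K, hK⟩ : ∃ K, K = b / 3072 := ⟨_, rfl⟩
  obtain ⟨S, hS⟩ : ∃ S, S = K / (12800 * q) := ⟨_, rfl⟩
  obtain ⟨T, hT⟩ : ∃ T, T = (K * (q * 2 ^ 55)) / (33280 * b) := ⟨_, rfl⟩
  obtain ⟨r, hr⟩ : ∃ r, r = b / q := ⟨_, rfl⟩
  have dv : ∀ (m n d : ℕ), 0 < d → m = n / d → (m:ℝ) * d ≤ n ∧ (n:ℝ) < (m + 1) * d := by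
    intro m n d hd h
    have h1 := Nat.div_mul_le_self n d
    have h2 := Nat.lt_mul_div_succ n hd
    rw [← h] at h1 h2
    rw [mul_comm] at h2
    exact ⟨by exact_mod_cast h1, by exact_mod_cast h2⟩
  obtain ⟨k1, k2⟩ := dv _ _ _ (by norm_num) hK
  obtain ⟨s1, s2⟩ := dv _ _ _ (by positivity) hS
  obtain ⟨t1, t2⟩ := dv _ _ _ (by positivity) hT
  obtain ⟨r1, r2⟩ := dv _ _ _ (by positivity) hr
  push_cast at k1 k2 s1 s2 t1 t2
  have t1' : (T:ℝ) * (33280 * b) ≤ K * (q * 2 ^ 55) := by linarith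
  have hKbig : (2:ℝ) ^ 158 ≤ K := by linarith
  have hbK : (b:ℝ) ≤ 3073 * K := by linarith
  have hSbig : (2:ℝ) ^ 80 ≤ S := by
    by_contra h
    push Not at h
    have : ((S:ℝ) + 1) * (12800 * q) ≤ (2 ^ 80 + 1) * (12800 * 2 ^ 55) := by gcongr
    linarith
  have hTbig : (1000000:ℝ) ≤ T := by
    by_contra h
    push Not at h
    have h1 : ((T:ℝ) + 1) * (33280 * b) ≤ (1000000 + 1) * (33280 * (3073 * K)) := by gcongr
    have h2 : (K:ℝ) * (1 * 2 ^ 55) ≤ K * (q * 2 ^ 55) := by gcongr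
    linarith
  have hSr : (S:ℝ) ≤ r := by
    by_contra h
    push Not at h
    have : ((r:ℝ) + 1) * q ≤ 2 * S * q := by gcongr; linarith
    nlinarith
  refine ⟨K, S, T, r, ?_, ?_, ?_, ?_, hr, by linarith, by linarith, s1, t1', ?_, ?_, ?_, ?_⟩
  · exact_mod_cast (by linarith : (1:ℝ) ≤ K)
  · exact_mod_cast (by linarith : (1536:ℝ) ≤ S)
  · exact_mod_cast (by linarith : (1:ℝ) ≤ T)
  · exact_mod_cast hSr
  · nlinarith
  · have hbpos : (0:ℝ) < b := by linarith
    have hqpos : (0:ℝ) < q := by linarith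
    have h1 : ((r:ℝ) * q) * (T * (33280 * b)) ≤ b * (K * (q * 2 ^ 55)) :=
      mul_le_mul r1 t1' (by positivity) (by positivity)
    rw [le_div_iff₀ (by norm_num)]
    have h2 : (b * q : ℝ) * (r * T * 33280) ≤ (b * q) * (K * 2 ^ 55) := by linarith
    exact le_of_mul_le_mul_left h2 (by positivity)
  · have h1 : (K:ℝ) * (q * 2 ^ 55) ≤ b * (2 ^ 55 * 2 ^ 55) := by
      have hKb : K ≤ b := by omega
      gcongr
    have h2 : (T:ℝ) * (33280 * b) ≤ (2 ^ 110 : ℝ) / 33280 * (33280 * b) := by linarith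
    have h3 := le_of_mul_le_mul_right h2 (by linarith)
    linarith
  · have hS3 : 1536 ≤ S := by exact_mod_cast (by linarith : (1536:ℝ) ≤ S)
    have hK3 : 1 ≤ K := by exact_mod_cast (by linarith : (1:ℝ) ≤ K)
    suffices h : ((K:ℝ) - 1) * 1536 < (S - 1536) * T by
      have : (((K - 1) * 1536 : ℕ) : ℝ) < (((S - 1536) * T : ℕ) : ℝ) := by
        push_cast [Nat.cast_sub hS3, Nat.cast_sub hK3]
        exact h
      exact_mod_cast this
    have e1 : (K:ℝ) ≤ (S - 1536) * (12900 * q) := by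
      have : (0:ℝ) ≤ (100 * S - 12900 * 1536 - 12800) * q := by
        apply mul_nonneg <;> linarith
      nlinarith
    have e2 : (K:ℝ) * (q * 2 ^ 55) ≤ T * (34000 * b) := by
      have : (0:ℝ) ≤ (720 * T - 33280) * b := by
        apply mul_nonneg <;> linarith
      nlinarith
    have hqpos : (0:ℝ) < q := by linarith
    have hS4 : (0:ℝ) ≤ S - 1536 := by linarith
    have e3 : (K:ℝ) * (K * (q * 2 ^ 55)) ≤ ((S - 1536) * (12900 * q)) * (T * (34000 * b)) := by gcongr
    have e4 : ((S - 1536) * (12900 * q)) * (T * (34000 * b)) ≤ ((S - 1536) * (12900 * q)) * (T * (34000 * (3073 * K) : ℝ)) := by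
      gcongr
    have e5 : (K * q : ℝ) * (K * 2 ^ 55) ≤ (K * q) * ((S - 1536) * T * (12900 * 34000 * 3073)) := by linarith
    have e6 := le_of_mul_le_mul_left e5 (by positivity)
    linarith

set_option maxHeartbeats 400000 in
lemma transc_aux {I : Type*} (i0 : I) (𝒜 : Subring (I → ℝ)) (hL : Liou i0 𝒜)
    (g1 g1' g2 g2' c1 c2 : I → ℝ) (mg1 : g1 ∈ 𝒜) (mg1' : g1' ∈ 𝒜) (mg2 : g2 ∈ 𝒜) (mg2' : g2' ∈ 𝒜)
    (mc1 : c1 ∈ 𝒜) (mc2 : c2 ∈ 𝒜) (h1 : ∀ i, g1 i * g1' i = 1) (h2 : ∀ i, g2 i * g2' i = 1)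
    (b1 : ∀ i, |g1 i| ≤ Real.exp 160) (b1' : ∀ i, |g1' i| ≤ Real.exp 160)
    (b2 : ∀ i, |g2 i| ≤ Real.exp 160) (b2' : ∀ i, |g2' i| ≤ Real.exp 160)
    (bc1 : ∀ i, |c1 i| ≤ Real.exp 160) (bc2 : ∀ i, |c2 i| ≤ Real.exp 160)
    (p1 : 0 < g1 i0) (p2 : 0 < g2 i0) (pc1 : 0 < c1 i0) (pc2 : 0 < c2 i0)
    (lc1 : |Real.log (c1 i0)| ≤ 160) (lc2 : |Real.log (c2 i0)| ≤ 160)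
    (hind : ∀ p q : ℤ, p * Real.log (g1 i0) + q * Real.log (g2 i0) = 0 → p = 0 ∧ q = 0)
    (a : ℤ) (b : ℕ) (hab : |a| ≤ b) (hb : 2 ^ 170 ≤ b)
    (hΛ : |Real.log (c1 i0) - Real.log (c2 i0) + a * Real.log (g1 i0) + b * Real.log (g2 i0)| ≤ Real.exp (-(b:ℝ))) :
    False := by
  have hbR : (2:ℝ) ^ 170 ≤ b := by exact_mod_cast hb
  have hbpos : (0:ℝ) < b := by linarith
  have habR : |(a:ℝ)| ≤ b := by exact_mod_cast hab
  obtain ⟨p, q', hq0, hqn, hpq⟩ := Real.exists_int_int_abs_mul_sub_le ((a:ℝ) / b) (n := 2 ^ 55) (by positivity)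
  obtain ⟨q, rfl⟩ : ∃ q : ℕ, q' = q := ⟨q'.toNat, by omega⟩
  have hq1 : 1 ≤ q := by omega
  have hqQ : q ≤ 2 ^ 55 := by exact_mod_cast hqn
  have hqR1 : (1:ℝ) ≤ q := by exact_mod_cast hq1
  have hqRQ : (q:ℝ) ≤ 2 ^ 55 := by exact_mod_cast hqQ
  have hqpos : (0:ℝ) < q := by linarith
  obtain ⟨K, S, T, r, hK1, hS1, hT1, hSr, hr, hKbig, hKb, hSK, hTK, hSrT, hrT, hLT, hcount⟩ := params q b hq1 hqQ hb
  -- bound for p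
  have hpq2 : |(q:ℝ) * a - p * b| ≤ b / 2 ^ 55 := by
    have e : (q:ℝ) * a - p * b = ((q:ℤ) * ((a:ℝ) / b) - p) * b := by
      push_cast
      field_simp
    rw [e, abs_mul, abs_of_pos hbpos]
    calc _ ≤ 1 / (((2 ^ 55 : ℕ) : ℝ) + 1) * b := by gcongr
      _ ≤ 1 / (2 ^ 55) * b := by
        gcongr
        push_cast
        linarith
      _ = _ := by ring
  have hp : |(p:ℝ)| ≤ q := by
    have e : |(p:ℝ)| * b ≤ q * b + b / 2 ^ 55 := by
      calc |(p:ℝ)| * b = |(p:ℝ) * b| := by rw [abs_mul, abs_of_pos hbpos]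
        _ = |(q:ℝ) * a - (q * a - p * b)| := by congr 1; ring
        _ ≤ |(q:ℝ) * a| + |(q:ℝ) * a - p * b| := abs_sub _ _
        _ ≤ _ := by
          rw [abs_mul, abs_of_pos hqpos]
          gcongr
    have h3 : |(p:ℝ)| * b < (q + 1) * b := by linarith
    have h4 := lt_of_mul_lt_mul_right h3 hbpos.le
    have h5 : |p| < q + 1 := by exact_mod_cast h4
    have h6 : |p| ≤ q := by omega
    exact_mod_cast h6
  -- remainders
  obtain ⟨b0, hb0⟩ : ∃ b0 : ℕ, b0 = b % q := ⟨_, rfl⟩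
  have hb0q : (b0:ℝ) ≤ q := by
    have : b0 < q := by rw [hb0]; exact Nat.mod_lt _ (by omega)
    exact_mod_cast this.le
  have hbdec : (b:ℝ) = b0 + r * q := by
    have := Nat.mod_add_div b q
    rw [← hb0, ← hr] at this
    have : ((b0 + q * r : ℕ) : ℝ) = b := by rw [this]
    push_cast at this
    linarith
  set a0 : ℤ := a - r * p with ha0
  set W : ℝ := b / (q * 2 ^ 55) with hW
  have ha0b : |(a0:ℝ)| ≤ W + q := by
    have e : (a0:ℝ) = ((q * a - p * b) + p * b0) / q := by
      rw [ha0, hbdec]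
      push_cast
      field_simp
      ring
    rw [e, abs_div, abs_of_pos hqpos, div_le_iff₀ hqpos]
    refine (abs_add_le _ _).trans ?_
    have : |(p:ℝ) * b0| ≤ q * q := by
      rw [abs_mul, Nat.abs_cast]
      gcongr
    have e2 : (W + q) * q = b / 2 ^ 55 + q * q := by
      rw [hW]; field_simp
    rw [e2]
    linarith
  have hWq : 2 * (q:ℝ) + 4 ≤ W := by
    rw [hW, le_div_iff₀ (by positivity)]
    calc (2 * (q:ℝ) + 4) * (q * 2 ^ 55) ≤ (2 * 2 ^ 55 + 4) * (2 ^ 55 * 2 ^ 55) := by gcongr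
      _ ≤ _ := by linarith
  -- nonvanishing, inverse bounds
  have inv1 : ∀ i, (g1 i)⁻¹ = g1' i := fun i => inv_eq_of_mul_eq_one_right (h1 i)
  have inv2 : ∀ i, (g2 i)⁻¹ = g2' i := fun i => inv_eq_of_mul_eq_one_right (h2 i)
  have ne1 : ∀ i, g1 i ≠ 0 := fun i h => by have := h1 i; rw [h] at this; simp at this
  have ne2 : ∀ i, g2 i ≠ 0 := fun i h => by have := h2 i; rw [h] at this; simp at this
  have z1 : ∀ i (m : ℤ) (P : ℝ), |(m:ℝ)| ≤ P → |g1 i ^ m| ≤ Real.exp (P * 160) := fun i m P hm =>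
    zp_bound _ _ (ne1 i) (b1 i) (by rw [inv1]; exact b1' i) m P hm
  have z2 : ∀ i (m : ℤ) (P : ℝ), |(m:ℝ)| ≤ P → |g2 i ^ m| ≤ Real.exp (P * 160) := fun i m P hm =>
    zp_bound _ _ (ne2 i) (b2 i) (by rw [inv2]; exact b2' i) m P hm
  have l1 : |Real.log (g1 i0)| ≤ 160 := abs_log_le _ _ (ne1 i0) (b1 i0) (by rw [inv1]; exact b1' i0)
  have l2 : |Real.log (g2 i0)| ≤ 160 := abs_log_le _ _ (ne2 i0) (b2 i0) (by rw [inv2]; exact b2' i0)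
  set ξ : I → ℝ := (fun i => g1 i ^ p) * (fun i => g2 i ^ (q:ℤ)) with hξ
  set w : I → ℝ := c2 * ((fun i => g1 i ^ (-a0)) * (fun i => g2 i ^ (-(b0:ℤ)))) with hw
  have mξ : ξ ∈ 𝒜 := mul_mem (zp_mem 𝒜 _ _ mg1 mg1' h1 p) (zp_mem 𝒜 _ _ mg2 mg2' h2 _)
  have mw : w ∈ 𝒜 := mul_mem mc2 (mul_mem (zp_mem 𝒜 _ _ mg1 mg1' h1 _) (zp_mem 𝒜 _ _ mg2 mg2' h2 _))
  have lξ : Real.log (ξ i0) = p * Real.log (g1 i0) + q * Real.log (g2 i0) := by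
    simp only [hξ, Pi.mul_apply]
    rw [Real.log_mul (zpow_pos p1 _).ne' (zpow_pos p2 _).ne', Real.log_zpow, Real.log_zpow]
    push_cast; ring
  have lw : Real.log (w i0) = Real.log (c2 i0) - a0 * Real.log (g1 i0) - b0 * Real.log (g2 i0) := by
    simp only [hw, Pi.mul_apply]
    rw [Real.log_mul pc2.ne' (mul_pos (zpow_pos p1 _) (zpow_pos p2 _)).ne',
      Real.log_mul (zpow_pos p1 _).ne' (zpow_pos p2 _).ne', Real.log_zpow, Real.log_zpow]
    push_cast; ring
  set Λ := Real.log (c1 i0) - Real.log (c2 i0) + a * Real.log (g1 i0) + b * Real.log (g2 i0) with hΛdef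
  have hΛe : r * Real.log (ξ i0) = Real.log (w i0) - Real.log (c1 i0) + Λ := by
    rw [lξ, lw, hΛdef, hbdec, ha0]
    push_cast; ring
  have hΛ1 : |Λ| ≤ 1 := hΛ.trans (by rw [Real.exp_le_one_iff]; linarith)
  set Ht : ℝ := 320 * W with hHt
  have hWpos : 0 < W := by linarith
  have hrl : r * |Real.log (ξ i0)| ≤ Ht := by
    have e : r * |Real.log (ξ i0)| = |r * Real.log (ξ i0)| := by rw [abs_mul, Nat.abs_cast]
    have e1 : |(a0:ℝ) * Real.log (g1 i0)| ≤ (W + q) * 160 := by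
      rw [abs_mul]; gcongr
    have e2 : |(b0:ℝ) * Real.log (g2 i0)| ≤ q * 160 := by
      rw [abs_mul, Nat.abs_cast]; gcongr
    rw [e, hΛe, lw, hHt]
    rw [abs_le] at e1 e2 lc1 lc2 hΛ1 ⊢
    constructor <;> linarith [e1.1, e1.2, e2.1, e2.2, lc1.1, lc1.2, lc2.1, lc2.2, hΛ1.1, hΛ1.2]
  have bξ : ∀ i, |ξ i| ≤ Real.exp (320 * q) := by
    intro i
    simp only [hξ, Pi.mul_apply, abs_mul]
    calc _ ≤ Real.exp (q * 160) * Real.exp (q * 160) := by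
          gcongr
          · exact z1 i p q hp
          · exact z2 i q q (by simp)
      _ = _ := by rw [← Real.exp_add]; congr 1; ring
  have bw : ∀ i, |w i| ≤ Real.exp Ht := by
    intro i
    simp only [hw, Pi.mul_apply, abs_mul]
    calc _ ≤ Real.exp 160 * (Real.exp ((W + q) * 160) * Real.exp (q * 160)) := by
          gcongr
          · exact bc2 i
          · exact z1 i _ _ (by push_cast; rwa [abs_neg])
          · exact z2 i _ _ (by push_cast; rw [abs_neg, Nat.abs_cast]; exact hb0q)
      _ = Real.exp (160 + ((W + q) * 160 + q * 160)) := by rw [← Real.exp_add, ← Real.exp_add]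
      _ ≤ _ := by rw [Real.exp_le_exp]; linarith
  have bc : ∀ i, |c1 i| ≤ Real.exp Ht := fun i => (bc1 i).trans (by rw [Real.exp_le_exp]; linarith)
  have pξ : 0 < ξ i0 := mul_pos (zpow_pos p1 _) (zpow_pos p2 _)
  have pw : 0 < w i0 := mul_pos pc2 (mul_pos (zpow_pos p1 _) (zpow_pos p2 _))
  have hξ1 : ξ i0 ≠ 1 := by
    intro h
    rw [h, Real.log_one] at lξ
    have := (hind p q (by push_cast; exact lξ.symm)).2
    omega
  have hTHt : (T:ℝ) * Ht ≤ K / 104 := by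
    rw [hHt, hW]
    have : (T:ℝ) * (320 * (b / (q * 2 ^ 55))) = (T * (33280 * b)) / (q * 2 ^ 55) / 104 := by
      field_simp; ring
    rw [this]
    gcongr
    rw [div_le_iff₀ (by positivity)]
    exact hTK
  have he := Real.exp_one_lt_d9
  have he0 := Real.exp_one_gt_d9
  have hKpos : (0:ℝ) < K := by linarith
  have hSK2 : (S:ℝ) ≤ K / 12800 := by
    rw [le_div_iff₀ (by norm_num)]
    calc (S:ℝ) * 12800 ≤ S * (12800 * q) := by
          gcongr
          linarith
      _ ≤ K := hSK
  have hlam : Real.log ((2:ℝ) ^ 55 / 5000) ≤ 30 := by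
    rw [Real.log_le_iff_le_exp (by positivity)]
    calc (2:ℝ) ^ 55 / 5000 ≤ 2.71 ^ 30 := by norm_num
      _ ≤ (Real.exp 1) ^ 30 := by gcongr; linarith
      _ = _ := by rw [← Real.exp_nat_mul]; norm_num
  refine core i0 𝒜 hL ξ c1 w mξ mc1 mw (320 * q) Ht (by positivity) (by positivity) bξ bc bw pξ pc1 pw hξ1
    K 1536 S T r (K * 1536) rfl (by omega) Λ b ((2:ℝ) ^ 55 / 5000) (5.5 * (1536 * (T * Ht))) (by norm_num) hK1
    hS1 (by omega) (by omega) hcount ?_ ?_ hΛe hΛ ?_ ?_ hbpos.le ?_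
  · calc Real.exp 1 * (S + r * T) + K ≤ 2.72 * (K / 12800 + K * 2 ^ 55 / 33280) + K := by
          gcongr
          linarith
      _ ≤ _ := by linarith
  · have e1 : |Real.log (ξ i0)| * (Real.exp 1 * (S + r * T)) ≤ |Real.log (ξ i0)| * (2.75 * (r * T + r * T)) := by
      gcongr
      linarith
    have e2 : |Real.log (ξ i0)| * (2.75 * (r * T + r * T)) = 5.5 * (T * (r * |Real.log (ξ i0)|)) := by ring
    have e3 : (T:ℝ) * (r * |Real.log (ξ i0)|) ≤ T * Ht := by gcongr
    push_cast
    linarith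
  · push_cast; exact hKb
  · push_cast
    refine hLT.trans ?_
    linarith [Real.add_one_le_exp ((b:ℝ) / 2)]
  · have hN : (((K * 1536 : ℕ)) : ℝ) = K * 1536 := by push_cast; ring
    have hlog : Real.log ((K:ℝ) * 1536 + 1) ≤ K + 1536 := by
      have : (K:ℝ) * 1536 + 1 ≤ (K + 1) * 1536 := by linarith
      refine (Real.log_le_log (by positivity) this).trans ?_
      rw [Real.log_mul (by positivity) (by norm_num)]
      have e1 := Real.log_le_sub_one_of_pos (show (0:ℝ) < K + 1 by positivity)
      have e2 := Real.log_le_sub_one_of_pos (show (0:ℝ) < 1536 by norm_num)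
      linarith
    rw [hN]
    have e1 : 6 * (K:ℝ) * (1 + Real.log ((2:ℝ) ^ 55 / 5000)) ≤ 6 * K * (1 + 30) := by gcongr
    push_cast
    linarith

/-- Data for the transcendence result. -/
structure TData {I : Type*} (i0 : I) (𝒜 : Subring (I → ℝ)) (g g' : I → ℝ) : Prop where
  mg : g ∈ 𝒜
  mg' : g' ∈ 𝒜
  h : ∀ i, g i * g' i = 1
  b : ∀ i, |g i| ≤ Real.exp 160
  b' : ∀ i, |g' i| ≤ Real.exp 160
  p : 0 < g i0

lemma TData.log {I : Type*} {i0 : I} {𝒜 : Subring (I → ℝ)} {g g' : I → ℝ} (d : TData i0 𝒜 g g') :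
    Real.log (g' i0) = - Real.log (g i0) := by
  rw [← Real.log_inv, inv_eq_of_mul_eq_one_right (d.h i0)]

lemma TData.symm {I : Type*} {i0 : I} {𝒜 : Subring (I → ℝ)} {g g' : I → ℝ} (d : TData i0 𝒜 g g') :
    TData i0 𝒜 g' g :=
  ⟨d.mg', d.mg, fun i => by rw [mul_comm]; exact d.h i, d.b', d.b, by
    rw [← inv_eq_of_mul_eq_one_right (d.h i0)]; exact inv_pos.mpr d.p⟩

lemma transc_half {I : Type*} (i0 : I) (𝒜 : Subring (I → ℝ)) (hL : Liou i0 𝒜)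
    (g1 g1' g2 g2' c1 c2 : I → ℝ) (d1 : TData i0 𝒜 g1 g1') (d2 : TData i0 𝒜 g2 g2')
    (mc1 : c1 ∈ 𝒜) (mc2 : c2 ∈ 𝒜)
    (bc1 : ∀ i, |c1 i| ≤ Real.exp 160) (bc2 : ∀ i, |c2 i| ≤ Real.exp 160)
    (pc1 : 0 < c1 i0) (pc2 : 0 < c2 i0)
    (lc1 : |Real.log (c1 i0)| ≤ 160) (lc2 : |Real.log (c2 i0)| ≤ 160)
    (hind : ∀ p q : ℤ, p * Real.log (g1 i0) + q * Real.log (g2 i0) = 0 → p = 0 ∧ q = 0)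
    (a b : ℤ) (X : ℕ) (ha : |a| ≤ X) (hb : |b| = X)
    (hΛ : |Real.log (c1 i0) - Real.log (c2 i0) + a * Real.log (g1 i0) + b * Real.log (g2 i0)| ≤ Real.exp (-(X:ℝ))) :
    X < 2 ^ 170 := by
  by_contra hX
  push Not at hX
  rcases abs_choice b with h | h
  · have hbX : (b:ℝ) = X := by rw [h] at hb; rw [hb]; simp
    refine transc_aux i0 𝒜 hL g1 g1' g2 g2' c1 c2 d1.mg d1.mg' d2.mg d2.mg' mc1 mc2 d1.h d2.h d1.b d1.b' d2.b d2.b'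
      bc1 bc2 d1.p d2.p pc1 pc2 lc1 lc2 hind a X ha hX ?_
    rw [← hbX]
    rw [← hbX] at hΛ
    exact hΛ
  · have hbX : (b:ℝ) = -X := by
      have : b = -X := by omega
      rw [this]; simp
    refine transc_aux i0 𝒜 hL g1 g1' g2' g2 c1 c2 d1.mg d1.mg' d2.mg' d2.mg mc1 mc2 d1.h d2.symm.h d1.b d1.b' d2.b' d2.b
      bc1 bc2 d1.p d2.symm.p pc1 pc2 lc1 lc2 ?_ a X ha hX ?_
    · intro p q hpq
      rw [d2.log] at hpq
      have := hind p (-q) (by push_cast; linarith)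
      exact ⟨this.1, by simpa using this.2⟩
    · rw [d2.log]
      rw [hbX] at hΛ
      convert hΛ using 2
      ring

theorem transc {I : Type*} (i0 : I) (𝒜 : Subring (I → ℝ)) (hL : Liou i0 𝒜)
    (g1 g1' g2 g2' c1 c2 : I → ℝ) (d1 : TData i0 𝒜 g1 g1') (d2 : TData i0 𝒜 g2 g2')
    (mc1 : c1 ∈ 𝒜) (mc2 : c2 ∈ 𝒜)
    (bc1 : ∀ i, |c1 i| ≤ Real.exp 160) (bc2 : ∀ i, |c2 i| ≤ Real.exp 160)
    (pc1 : 0 < c1 i0) (pc2 : 0 < c2 i0)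
    (lc1 : |Real.log (c1 i0)| ≤ 160) (lc2 : |Real.log (c2 i0)| ≤ 160)
    (hind : ∀ p q : ℤ, p * Real.log (g1 i0) + q * Real.log (g2 i0) = 0 → p = 0 ∧ q = 0)
    (a b : ℤ) (X : ℕ) (hX : X = max a.natAbs b.natAbs)
    (hΛ : |Real.log (c1 i0) - Real.log (c2 i0) + a * Real.log (g1 i0) + b * Real.log (g2 i0)| ≤ Real.exp (-(X:ℝ))) :
    X < 2 ^ 170 := by
  rcases le_total a.natAbs b.natAbs with h | h
  · refine transc_half i0 𝒜 hL g1 g1' g2 g2' c1 c2 d1 d2 mc1 mc2 bc1 bc2 pc1 pc2 lc1 lc2 hind a b X ?_ ?_ hΛ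
    · rw [Int.abs_eq_natAbs]; omega
    · rw [Int.abs_eq_natAbs]; omega
  · refine transc_half i0 𝒜 hL g2 g2' g1 g1' c1 c2 d2 d1 mc1 mc2 bc1 bc2 pc1 pc2 lc1 lc2 ?_ b a X ?_ ?_ ?_
    · intro p q hpq
      have := hind q p (by linarith)
      exact ⟨this.2, this.1⟩
    · rw [Int.abs_eq_natAbs]; omega
    · rw [Int.abs_eq_natAbs]; omega
    · convert hΛ using 2
      ring

section
open MvPolynomial

/-- The evaluation of integer polynomials at all permutations of a triple. -/
noncomputable def evHom (α : Fin 3 → ℝ) : MvPolynomial (Fin 3) ℤ →+* (Equiv.Perm (Fin 3) → ℝ) :=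
  Pi.ringHom fun σ => (aeval (R := ℤ) (fun i => α (σ i))).toRingHom

lemma evHom_apply (α : Fin 3 → ℝ) (P : MvPolynomial (Fin 3) ℤ) (σ : Equiv.Perm (Fin 3)) :
    evHom α P σ = aeval (fun i => α (σ i)) P := rfl

lemma sym_int (α : Fin 3 → ℝ) (E1 E2 E3 : ℤ) (h1 : α 0 + α 1 + α 2 = E1)
    (h2 : α 0 * α 1 + α 0 * α 2 + α 1 * α 2 = E2) (h3 : α 0 * α 1 * α 2 = E3)
    (c : MvPolynomial (Fin 3) ℤ) (hc : c.IsSymmetric) : ∃ k : ℤ, aeval α c = (k : ℝ) := by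
  obtain ⟨G, hG⟩ := esymmAlgHom_fin_surjective (R := ℤ) (n := 3) (m := 3) le_rfl ⟨c, hc⟩
  have hG' : aeval (fun i : Fin 3 => esymm (Fin 3) ℤ (i + 1)) G = c := by
    have := congrArg Subtype.val hG
    rwa [esymmAlgHom_apply] at this
  have he : ∀ i : Fin 3, ∃ k : ℤ, aeval α (esymm (Fin 3) ℤ ((i : ℕ) + 1)) = (k : ℝ) := by
    intro i
    rw [aeval_esymm_eq_multiset_esymm]
    have hu : (Finset.univ : Finset (Fin 3)).val.map α = α 0 ::ₘ α 1 ::ₘ α 2 ::ₘ 0 := rfl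
    rw [hu]
    fin_cases i
    · refine ⟨E1, ?_⟩
      rw [← h1]
      simp [Multiset.esymm, Multiset.powersetCard_one]
      try ring
    · refine ⟨E2, ?_⟩
      rw [← h2]
      simp [Multiset.esymm, Multiset.powersetCard_one, Multiset.powersetCard_cons]
      try ring
    · refine ⟨E3, ?_⟩
      rw [← h3]
      simp [Multiset.esymm, Multiset.powersetCard_one, Multiset.powersetCard_cons]
      try ring
  choose e he using he
  refine ⟨aeval e G, ?_⟩
  rw [← hG', ← AlgHom.comp_apply, comp_aeval]
  simp_rw [he]
  have := (aeval_algebraMap_apply (A := ℤ) ℝ e G)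
  simpa [Function.comp_def] using this

theorem evHom_liou (α : Fin 3 → ℝ) (E1 E2 E3 : ℤ) (h1 : α 0 + α 1 + α 2 = E1)
    (h2 : α 0 * α 1 + α 0 * α 2 + α 1 * α 2 = E2) (h3 : α 0 * α 1 * α 2 = E3) :
    Liou (1 : Equiv.Perm (Fin 3)) (evHom α).range := by
  classical
  rintro z ⟨P, rfl⟩ hz0 M hM hb
  set z := evHom α P with hz
  let t : Finset (Equiv.Perm (Fin 3)) := Finset.univ.filter fun σ => z σ ≠ 0
  let c : MvPolynomial (Fin 3) ℤ := aeval (fun σ : Equiv.Perm (Fin 3) => rename σ P) (esymm (Equiv.Perm (Fin 3)) ℤ t.card)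
  have hc : c.IsSymmetric := by
    intro τ
    have e1 : rename τ c = aeval (fun σ : Equiv.Perm (Fin 3) => rename (τ * σ : Equiv.Perm (Fin 3)) P) (esymm (Equiv.Perm (Fin 3)) ℤ t.card) := by
      simp only [c]
      rw [← AlgHom.comp_apply, comp_aeval]
      simp only [rename_rename]
      rfl
    rw [e1]
    have e2 := esymm_isSymmetric (Equiv.Perm (Fin 3)) ℤ t.card (Equiv.mulLeft τ)
    simp only [c]
    conv_rhs => rw [← e2]
    rw [aeval_rename]
    rfl
  obtain ⟨k, hk⟩ := sym_int α E1 E2 E3 h1 h2 h3 c hc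
  have hz' : aeval α c = ∑ s ∈ Finset.powersetCard t.card Finset.univ, ∏ σ ∈ s, z σ := by
    simp only [c]
    rw [← AlgHom.comp_apply, comp_aeval]
    simp only [aeval_rename]
    rw [esymm, map_sum]
    refine Finset.sum_congr rfl fun s _ => ?_
    rw [map_prod]
    refine Finset.prod_congr rfl fun σ _ => ?_
    rw [aeval_X]
    rfl
  rw [Finset.sum_eq_single t] at hz'
  · have hprod : ∏ σ ∈ t, z σ ≠ 0 := Finset.prod_ne_zero_iff.mpr fun σ hσ => (Finset.mem_filter.mp hσ).2
    rw [hk] at hz'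
    have hk0 : k ≠ 0 := by
      rintro rfl
      rw [← hz'] at hprod
      simp at hprod
    have hk1 : (1:ℝ) ≤ |∏ σ ∈ t, z σ| := by
      rw [← hz']
      exact_mod_cast Int.one_le_abs hk0
    refine hk1.trans ?_
    have hmem : (1 : Equiv.Perm (Fin 3)) ∈ t := by simp [t, hz0]
    rw [← Finset.mul_prod_erase t _ hmem, abs_mul, Finset.abs_prod]
    gcongr
    calc ∏ σ ∈ t.erase 1, |z σ| ≤ ∏ σ ∈ t.erase 1, M := Finset.prod_le_prod (fun _ _ => abs_nonneg _) fun σ _ => hb σ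
      _ = M ^ (t.erase 1).card := by rw [Finset.prod_const]
      _ ≤ M ^ 5 := by
        refine pow_le_pow_right₀ hM ?_
        · rw [Finset.card_erase_of_mem hmem]
          have : t.card ≤ Fintype.card (Equiv.Perm (Fin 3)) := Finset.card_le_univ _
          rw [Fintype.card_perm, Fintype.card_fin] at this
          have h6 : Nat.factorial 3 = 6 := rfl
          omega
  · intro s hs hne
    obtain ⟨σ, hσs, hσt⟩ : ∃ σ ∈ s, σ ∉ t := by
      by_contra h
      push Not at h
      exact hne (Finset.eq_of_subset_of_card_le h (by rw [(Finset.mem_powersetCard.mp hs).2]))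
    refine Finset.prod_eq_zero hσs ?_
    simpa [t] using hσt
  · intro h
    exact absurd (Finset.mem_powersetCard.mpr ⟨Finset.subset_univ _, rfl⟩) h

end

/-- The three real roots of `x (x - A) (x - B) - 1`. -/
structure RT (A B : ℤ) (α : Fin 3 → ℝ) : Prop where
  hA : 2 ≤ A
  hAB : 4 * A ≤ B
  hB28 : B ≤ 2 ^ 28
  r0 : 0 < α 0 ∧ α 0 < 1
  r1 : (A:ℝ) - 1 < α 1 ∧ α 1 < A
  r2 : (B:ℝ) < α 2 ∧ α 2 < B + 1
  s1 : α 0 + α 1 + α 2 = A + B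
  s2 : α 0 * α 1 + α 0 * α 2 + α 1 * α 2 = A * B
  s3 : α 0 * α 1 * α 2 = 1

lemma RT.exists (A B : ℤ) (hA : 2 ≤ A) (hAB : 4 * A ≤ B) (hB28 : B ≤ 2 ^ 28) : ∃ α, RT A B α := by
  have hAR : (2:ℝ) ≤ A := by exact_mod_cast hA
  have hABR : 4 * (A:ℝ) ≤ B := by exact_mod_cast hAB
  let f : ℝ → ℝ := fun x => x * (x - A) * (x - B) - 1
  have hf : Continuous f := by fun_prop
  have key : ∀ a b : ℝ, a < b → f a * f b < 0 → ∃ x, a < x ∧ x < b ∧ f x = 0 := by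
    intro a b hab h
    rcases mul_neg_iff.mp h with ⟨h1, h2⟩ | ⟨h1, h2⟩
    · obtain ⟨x, hx, hx0⟩ := intermediate_value_Ioo' hab.le hf.continuousOn ⟨h2, h1⟩
      exact ⟨x, hx.1, hx.2, hx0⟩
    · obtain ⟨x, hx, hx0⟩ := intermediate_value_Ioo hab.le hf.continuousOn ⟨h1, h2⟩
      exact ⟨x, hx.1, hx.2, hx0⟩
  obtain ⟨x, x1, x2, x3⟩ := key 0 1 (by norm_num) (by
    have e1 : f 0 = -1 := by simp [f]
    have e2 : 0 < f 1 := by simp only [f]; nlinarith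
    nlinarith)
  obtain ⟨y, y1, y2, y3⟩ := key (A - 1) A (by linarith) (by
    have e1 : f A = -1 := by simp [f]
    have e2 : 0 < f (A - 1) := by simp only [f]; nlinarith
    nlinarith)
  obtain ⟨z, z1, z2, z3⟩ := key B (B + 1) (by linarith) (by
    have e1 : f B = -1 := by simp [f]
    have e2 : 0 < f (B + 1) := by simp only [f]; nlinarith
    nlinarith)
  simp only [f] at x3 y3 z3
  have hxy : x < y := by linarith
  have hyz : y < z := by linarith
  have e1 : x ^ 2 + x * y + y ^ 2 - (A + B) * (x + y) + A * B = 0 := by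
    have : (x - y) * (x ^ 2 + x * y + y ^ 2 - (A + B) * (x + y) + A * B) = 0 := by
      linear_combination x3 - y3
    rcases mul_eq_zero.mp this with h | h
    · linarith
    · exact h
  have e2 : y ^ 2 + y * z + z ^ 2 - (A + B) * (y + z) + A * B = 0 := by
    have : (y - z) * (y ^ 2 + y * z + z ^ 2 - (A + B) * (y + z) + A * B) = 0 := by
      linear_combination y3 - z3
    rcases mul_eq_zero.mp this with h | h
    · linarith
    · exact h
  have e3 : x + y + z = A + B := by
    have : (x - z) * (x + y + z - (A + B)) = 0 := by linear_combination e1 - e2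
    rcases mul_eq_zero.mp this with h | h
    · linarith
    · linarith
  refine ⟨![x, y, z], hA, hAB, hB28, ⟨x1, x2⟩, ⟨y1, y2⟩, ⟨z1, z2⟩, e3, ?_, ?_⟩
  · change x * y + x * z + y * z = A * B
    linear_combination e1 * (-1) + (x + y) * e3
  · change x * y * z = 1
    have e4 : x * y + x * z + y * z = A * B := by linear_combination e1 * (-1) + (x + y) * e3
    linear_combination x3 - x ^ 2 * e3 + x * e4

namespace RT
variable {A B : ℤ} {α : Fin 3 → ℝ}

lemma hAR (h : RT A B α) : (2:ℝ) ≤ A := by exact_mod_cast h.hA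
lemma hABR (h : RT A B α) : 4 * (A:ℝ) ≤ B := by exact_mod_cast h.hAB

lemma root (h : RT A B α) (i : Fin 3) : α i * (α i - A) * (α i - B) = 1 := by
  have h1 := h.s1
  have h2 := h.s2
  have h3 := h.s3
  fin_cases i
  · change α 0 * (α 0 - A) * (α 0 - B) = 1
    linear_combination (α 0) ^ 2 * h1 - α 0 * h2 + h3
  · change α 1 * (α 1 - A) * (α 1 - B) = 1
    linear_combination (α 1) ^ 2 * h1 - α 1 * h2 + h3
  · change α 2 * (α 2 - A) * (α 2 - B) = 1
    linear_combination (α 2) ^ 2 * h1 - α 2 * h2 + h3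

lemma fact (h : RT A B α) (x : ℝ) : x * (x - A) * (x - B) - 1 = (x - α 0) * (x - α 1) * (x - α 2) := by
  linear_combination x ^ 2 * h.s1 - x * h.s2 + h.s3

lemma b0 (h : RT A B α) : α 0 ≤ 1 / 7 := by
  have h0 := h.root 0
  have := h.hAR; have := h.hABR; have := h.r0
  by_contra hc
  push Not at hc
  have h1 : 1 < α 0 * ((A - α 0) * (B - α 0)) := by
    have : (1 * 7 : ℝ) ≤ (A - α 0) * (B - α 0) := by gcongr <;> linarith
    nlinarith
  nlinarith

lemma b1 (h : RT A B α) : A - α 1 ≤ 1 / 6 := by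
  have h0 := h.root 1
  have := h.hAR; have := h.hABR; have := h.r1
  by_contra hc
  push Not at hc
  have h1 : 1 < (A - α 1) * (α 1 * (B - α 1)) := by
    have : (1 * 6 : ℝ) ≤ α 1 * (B - α 1) := by gcongr <;> linarith
    nlinarith
  nlinarith

/-- no rational root -/
lemma no_rat (h : RT A B α) (i : Fin 3) (t s : ℤ) (hs : (t:ℝ) = s * α i) : s = 0 := by
  by_contra hs0
  have hsR : (s:ℝ) ≠ 0 := by exact_mod_cast hs0
  have hα : α i = ((t / s : ℚ) : ℝ) := by
    push_cast
    rw [hs]; field_simp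
  have hr := h.root i
  rw [hα] at hr
  have hr' : ((t / s : ℚ)) * ((t / s : ℚ) - A) * ((t / s : ℚ) - B) = 1 := by exact_mod_cast hr
  set x : ℚ := t / s
  have hInt : IsIntegral ℤ x := by
    refine ⟨Polynomial.X * (Polynomial.X - Polynomial.C A) * (Polynomial.X - Polynomial.C B) - 1, ?_, ?_⟩
    · monicity!
    · simp only [Polynomial.eval₂_sub, Polynomial.eval₂_mul, Polynomial.eval₂_X, Polynomial.eval₂_C,
        Polynomial.eval₂_one]
      have eA : (algebraMap ℤ ℚ) A = (A:ℚ) := by simp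
      have eB : (algebraMap ℤ ℚ) B = (B:ℚ) := by simp
      rw [eA, eB, hr']; norm_num
  obtain ⟨m, hm⟩ := IsIntegrallyClosed.isIntegral_iff.mp hInt
  have hm' : x = m := by rw [← hm]; simp
  rw [hm'] at hα
  have hα' : α i = m := by rw [hα]; simp
  have h0 := h.r0; have h1 := h.r1; have h2 := h.r2
  fin_cases i
  · change α 0 = m at hα'
    rw [hα'] at h0
    have e1 : 0 < m := by exact_mod_cast h0.1
    have e2 : m < 1 := by exact_mod_cast h0.2
    omega
  · change α 1 = m at hα'
    rw [hα'] at h1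
    have e1 : A - 1 < m := by exact_mod_cast h1.1
    have e2 : m < A := by exact_mod_cast h1.2
    omega
  · change α 2 = m at hα'
    rw [hα'] at h2
    have e1 : B < m := by exact_mod_cast h2.1
    have e2 : m < B + 1 := by exact_mod_cast h2.2
    omega

/-- The order `ℤ[α]`. -/
def ord (h : RT A B α) : Subring (Fin 3 → ℝ) where
  carrier := {μ | ∃ p q s : ℤ, ∀ i, μ i = p + q * α i + s * (α i) ^ 2}
  mul_mem' := by
    rintro a b ⟨p, q, s, h1⟩ ⟨p', q', s', h2⟩
    refine ⟨p * p' + (q * s' + s * q') + s * s' * (A + B),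
      p * q' + q * p' - (q * s' + s * q') * (A * B) + s * s' * (1 - (A + B) * (A * B)),
      p * s' + q * q' + s * p' + (q * s' + s * q') * (A + B) + s * s' * ((A + B) ^ 2 - A * B), fun i => ?_⟩
    have hr := h.root i
    rw [Pi.mul_apply, h1, h2]
    push_cast
    linear_combination ((q * s' + s * q' : ℝ) + s * s' * (α i + (A + B))) * hr
  one_mem' := ⟨1, 0, 0, fun i => by simp⟩
  add_mem' := by
    rintro a b ⟨p, q, s, h1⟩ ⟨p', q', s', h2⟩
    exact ⟨p + p', q + q', s + s', fun i => by rw [Pi.add_apply, h1, h2]; push_cast; ring⟩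
  zero_mem' := ⟨0, 0, 0, fun i => by simp⟩
  neg_mem' := by
    rintro a ⟨p, q, s, h1⟩
    exact ⟨-p, -q, -s, fun i => by rw [Pi.neg_apply, h1]; push_cast; ring⟩

lemma mem_ord (h : RT A B α) (μ : Fin 3 → ℝ) :
    μ ∈ h.ord ↔ ∃ p q s : ℤ, ∀ i, μ i = p + q * α i + s * (α i) ^ 2 := Iff.rfl

lemma αpos (h : RT A B α) (i : Fin 3) : 0 < α i := by
  have := h.hAR; have := h.hABR; have h0 := h.r0; have h1 := h.r1; have h2 := h.r2
  fin_cases i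
  · exact h0.1
  · change 0 < α 1; linarith
  · change 0 < α 2; linarith

lemma ne1 (h : RT A B α) (i : Fin 3) : α i - A ≠ 0 := by
  intro hc
  have := h.root i
  rw [hc] at this; simp at this

lemma mem1 (h : RT A B α) (p : ℤ) : (fun i => α i ^ p) ∈ h.ord := by
  refine zp_mem h.ord α (fun i => (α i - A) * (α i - B)) ?_ ?_ ?_ p
  · exact ⟨0, 1, 0, fun i => by simp⟩
  · exact ⟨A * B, -(A + B), 1, fun i => by push_cast; ring⟩
  · intro i; have := h.root i; linarith

lemma mem2 (h : RT A B α) (p : ℤ) : (fun i => (α i - A) ^ p) ∈ h.ord := by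
  refine zp_mem h.ord (fun i => α i - A) (fun i => α i * (α i - B)) ?_ ?_ ?_ p
  · exact ⟨-A, 1, 0, fun i => by push_cast; ring⟩
  · exact ⟨0, -B, 1, fun i => by push_cast; ring⟩
  · intro i; have := h.root i; linarith

end RT

lemma disc_sorted (x y z R : ℝ) (hxy : |y| ≤ |x|) (hyz : |z| ≤ |y|) (hn : |x * y * z| = 1)
    (hR : 4 * x ^ 2 < R * z ^ 2) : ((x - y) * (x - z) * (y - z)) ^ 2 < R := by
  have hne : x * y * z ≠ 0 := by intro h; rw [h] at hn; simp at hn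
  have hx : x ≠ 0 := by rintro rfl; simp at hne
  have hy : y ≠ 0 := by rintro rfl; simp at hne
  have hz : z ≠ 0 := by rintro rfl; simp at hne
  have hu : |y / x| ≤ 1 := by rw [abs_div]; exact div_le_one_of_le₀ hxy (abs_nonneg _)
  have hv : |z / y| ≤ 1 := by rw [abs_div]; exact div_le_one_of_le₀ hyz (abs_nonneg _)
  set u := y / x with hu'
  set v := z / y with hv'
  have e1 : (x - y) * (x - z) * (y - z) = x ^ 2 * y * ((1 - u) * (1 - v) * (1 - u * v)) := by
    rw [hu', hv']; field_simp
  have hsq : (x * y * z) ^ 2 = 1 := by rw [← sq_abs, hn]; norm_num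
  have hu2 := abs_le.mp hu
  have hv2 := abs_le.mp hv
  have huv : |u * v| ≤ 1 := by rw [abs_mul]; exact mul_le_one₀ hu (abs_nonneg _) hv
  have huv2 := abs_le.mp huv
  set k := (1 - u) * (1 - v) * (1 - u * v) with hk
  have k0 : 0 ≤ k := by
    rw [hk]
    exact mul_nonneg (mul_nonneg (by linarith) (by linarith)) (by linarith)
  have k2 : k ≤ 2 := by
    have : (1 - u) * (1 - v) ≤ 2 * (1 + u * v) := by nlinarith [mul_nonneg (by linarith : 0 ≤ 1 + u) (by linarith : 0 ≤ 1 + v)]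
    have : k ≤ 2 * (1 + u * v) * (1 - u * v) := by
      rw [hk]; exact mul_le_mul_of_nonneg_right this (by linarith)
    nlinarith [sq_nonneg (u * v)]
  have kk : k ^ 2 ≤ 4 := by nlinarith
  rw [e1, mul_pow]
  have hz2 : 0 < z ^ 2 := by positivity
  have e3 : (x ^ 2 * y) ^ 2 * z ^ 2 = x ^ 2 := by
    have : (x ^ 2 * y) ^ 2 * z ^ 2 = x ^ 2 * (x * y * z) ^ 2 := by ring
    rw [this, hsq, mul_one]
  have : (x ^ 2 * y) ^ 2 * k ^ 2 * z ^ 2 < R * z ^ 2 := by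
    calc (x ^ 2 * y) ^ 2 * k ^ 2 * z ^ 2 = ((x ^ 2 * y) ^ 2 * z ^ 2) * k ^ 2 := by ring
      _ = x ^ 2 * k ^ 2 := by rw [e3]
      _ ≤ 4 * x ^ 2 := by nlinarith [sq_nonneg x]
      _ < _ := hR
  exact lt_of_mul_lt_mul_right this hz2.le

lemma disc_lt (x y z R : ℝ) (hn : |x * y * z| = 1)
    (h1 : 4 * x ^ 2 < R * y ^ 2) (h2 : 4 * x ^ 2 < R * z ^ 2) (h3 : 4 * y ^ 2 < R * x ^ 2)
    (h4 : 4 * y ^ 2 < R * z ^ 2) (h5 : 4 * z ^ 2 < R * x ^ 2) (h6 : 4 * z ^ 2 < R * y ^ 2) :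
    ((x - y) * (x - z) * (y - z)) ^ 2 < R := by
  rcases le_total |x| |y| with a | a <;> rcases le_total |y| |z| with b | b <;>
    rcases le_total |x| |z| with c | c
  · have := disc_sorted z y x R b a (by rw [← hn]; ring_nf) h5
    convert this using 1; ring
  · have := disc_sorted z y x R b a (by rw [← hn]; ring_nf) h5
    convert this using 1; ring
  · have := disc_sorted y z x R b c (by rw [← hn]; ring_nf) h3
    convert this using 1; ring
  · have := disc_sorted y x z R a c (by rw [← hn]; ring_nf) h4
    convert this using 1; ring
  · have := disc_sorted z x y R c a (by rw [← hn]; ring_nf) h6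
    convert this using 1; ring
  · have := disc_sorted x z y R c b (by rw [← hn]; ring_nf) h1
    convert this using 1; ring
  · have := disc_sorted x y z R a b (by rw [← hn]) h2
    convert this using 1
  · have := disc_sorted x y z R a b (by rw [← hn]) h2
    convert this using 1

namespace RT
variable {A B : ℤ} {α : Fin 3 → ℝ}

lemma prodA (h : RT A B α) : (α 0 - A) * (α 1 - A) * (α 2 - A) = 1 := by
  have := h.fact A
  linear_combination this

lemma vne (h : RT A B α) (i : Fin 3) : α i ≠ 0 := (h.αpos i).ne'

lemma sumV (h : RT A B α) : Real.log (α 0) + Real.log (α 1) + Real.log (α 2) = 0 := by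
  rw [← Real.log_mul (h.vne 0) (h.vne 1), ← Real.log_mul (mul_ne_zero (h.vne 0) (h.vne 1)) (h.vne 2), h.s3,
    Real.log_one]

lemma sumW (h : RT A B α) :
    Real.log (α 0 - A) + Real.log (α 1 - A) + Real.log (α 2 - A) = 0 := by
  rw [← Real.log_mul (h.ne1 0) (h.ne1 1), ← Real.log_mul (mul_ne_zero (h.ne1 0) (h.ne1 1)) (h.ne1 2), h.prodA,
    Real.log_one]

/-- Logarithms of the basic positive quantities. -/
lemma logs (h : RT A B α) : ∃ p p' s s' : ℝ, 0 < p ∧ 0 < p' ∧ 0 < s ∧ 0 < s' ∧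
    p = Real.log (A - α 0) ∧ p' = Real.log (B - α 0) ∧ s = Real.log (α 1) ∧ s' = Real.log (B - α 1) ∧
    Real.log (α 0) = -(p + p') ∧ Real.log (α 0 - A) = p ∧ Real.log (α 1 - A) = -(s + s') := by
  have hA := h.hAR; have hAB := h.hABR; have r0 := h.r0; have r1 := h.r1; have r2 := h.r2
  have b0 := h.b0; have b1 := h.b1
  refine ⟨_, _, _, _, Real.log_pos ?_, Real.log_pos ?_, Real.log_pos ?_, Real.log_pos ?_, rfl, rfl, rfl, rfl, ?_, ?_, ?_⟩
  · linarith
  · linarith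
  · linarith
  · linarith
  · have := h.root 0
    have h1 : α 0 = ((A - α 0) * (B - α 0))⁻¹ := by
      refine eq_inv_of_mul_eq_one_left ?_; linarith
    rw [← Real.log_mul (by linarith) (by linarith), ← Real.log_inv, ← h1]
  · rw [← Real.log_neg_eq_log, neg_sub]
  · have := h.root 1
    have h1 : A - α 1 = (α 1 * (B - α 1))⁻¹ := by
      refine eq_inv_of_mul_eq_one_left ?_; linarith
    rw [← Real.log_neg_eq_log, neg_sub, ← Real.log_mul (by linarith) (by linarith), ← Real.log_inv, ← h1]

/-- discriminant -/
noncomputable def D (_ : RT A B α) : ℝ := ((α 0 - α 1) * (α 0 - α 2) * (α 1 - α 2)) ^ 2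

lemma dpos (h : RT A B α) : 0 < h.D := by
  have hA := h.hAR; have hAB := h.hABR; have r0 := h.r0; have r1 := h.r1; have r2 := h.r2
  have h1 : α 0 - α 1 ≠ 0 := by linarith
  have h2 : α 0 - α 2 ≠ 0 := by linarith
  have h3 : α 1 - α 2 ≠ 0 := by linarith
  unfold D
  positivity

lemma ratio01 (h : RT A B α) : 4 * (α 1 ^ 2 * (A - α 0) ^ 2 * (B - α 0) * (B - α 1)) < h.D := by
  have hA := h.hAR; have hAB := h.hABR; have r0 := h.r0; have r1 := h.r1; have r2 := h.r2
  have b0 := h.b0; have b1 := h.b1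
  have e : h.D = (α 1 - α 0) ^ 2 * ((α 2 - α 0) ^ 2 * (α 2 - α 1) ^ 2) := by unfold D; ring
  have g1 : 0.8 * (A:ℝ) ≤ α 1 - α 0 := by linarith
  have g2 : α 1 ^ 2 * (A - α 0) ^ 2 ≤ (A:ℝ) ^ 2 * A ^ 2 := by gcongr <;> linarith
  have g3 : (0.8 * (A:ℝ)) ^ 2 ≤ (α 1 - α 0) ^ 2 := by gcongr
  have g4 : (3 * (A:ℝ)) * (3 * A) ≤ (α 2 - α 0) * (α 2 - α 1) := by gcongr <;> linarith
  have g5 : (B - α 0) * (B - α 1) ≤ (α 2 - α 0) * (α 2 - α 1) := by gcongr <;> linarith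
  set G := (α 2 - α 0) * (α 2 - α 1)
  have e' : h.D = (α 1 - α 0) ^ 2 * (G * G) := by rw [e]; ring
  have hA2 : 0 < (A:ℝ) ^ 2 := by positivity
  have G0 : 0 < G := by nlinarith
  have c1 : (0.8 * (A:ℝ)) ^ 2 * (3 * A * (3 * A) * G) ≤ h.D := by
    rw [e']; gcongr
  have c2 : 4 * (α 1 ^ 2 * (A - α 0) ^ 2 * (B - α 0) * (B - α 1)) ≤ 4 * ((A:ℝ) ^ 2 * A ^ 2 * G) := by
    have : α 1 ^ 2 * (A - α 0) ^ 2 * (B - α 0) * (B - α 1) = (α 1 ^ 2 * (A - α 0) ^ 2) * ((B - α 0) * (B - α 1)) := by ring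
    rw [this]
    have h0 : 0 ≤ (B - α 0) * (B - α 1) := mul_nonneg (by linarith) (by linarith)
    gcongr
  have : 0 < (A:ℝ) ^ 2 * A ^ 2 * G := by positivity
  nlinarith

lemma ratio02 (h : RT A B α) : 4 * (α 2 * (α 2 - A) * (B - α 0)) < h.D := by
  have hA := h.hAR; have hAB := h.hABR; have r0 := h.r0; have r1 := h.r1; have r2 := h.r2
  have b0 := h.b0; have b1 := h.b1
  have e : h.D = (α 1 - α 0) ^ 2 * ((α 2 - α 0) * (α 2 - α 1) * ((α 2 - α 1) * (α 2 - α 0))) := by unfold D; ring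
  have g1 : (1.6:ℝ) ^ 2 ≤ (α 1 - α 0) ^ 2 := by gcongr; linarith
  have g2 : α 2 * 3 < (α 2 - α 0) * (α 2 - α 1) := by nlinarith
  have g3 : (α 2 - A) * (B - α 0) ≤ (α 2 - α 1) * (α 2 - α 0) := by gcongr <;> first | exact mul_nonneg (by linarith) (by linarith) | linarith
  have g4 : 0 < (α 2 - A) * (B - α 0) := mul_pos (by linarith) (by linarith)
  have c : (1.6:ℝ) ^ 2 * (α 2 * 3 * ((α 2 - A) * (B - α 0))) ≤ h.D := by
    rw [e]; gcongr
    all_goals exact mul_nonneg (by linarith) (by linarith)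
  have : 0 < α 2 * ((α 2 - A) * (B - α 0)) := mul_pos (by linarith) g4
  nlinarith

lemma ratio12 (h : RT A B α) : 4 * (α 2 * (α 2 - A) * (B - α 1)) < h.D := by
  refine lt_of_le_of_lt ?_ h.ratio02
  have hA := h.hAR; have hAB := h.hABR; have r0 := h.r0; have r1 := h.r1; have r2 := h.r2
  have : 0 ≤ α 2 * (α 2 - A) := mul_nonneg (by linarith) (by linarith)
  gcongr; linarith

lemma ratio_log (h : RT A B α) (i j : Fin 3) : 4 * Real.exp (|Real.log (α i) - Real.log (α j)| +
    |Real.log (α i - A) - Real.log (α j - A)|) < h.D := by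
  have hA := h.hAR; have hAB := h.hABR; have r0 := h.r0; have r1 := h.r1; have r2 := h.r2
  have b0 := h.b0; have b1 := h.b1
  obtain ⟨p, p', s, s', hp, hp', hs, hs', ep, ep', es, es', v0, w0, w1⟩ := h.logs
  have sv := h.sumV
  have sw := h.sumW
  have ep1 : Real.exp p = A - α 0 := by rw [ep, Real.exp_log]; linarith
  have ep2 : Real.exp p' = B - α 0 := by rw [ep', Real.exp_log]; linarith
  have es1 : Real.exp s = α 1 := by rw [es, Real.exp_log]; linarith
  have es2 : Real.exp s' = B - α 1 := by rw [es', Real.exp_log]; linarith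
  have ev2 : Real.exp (Real.log (α 2)) = α 2 := Real.exp_log (h.αpos 2)
  have ew2 : Real.exp (Real.log (α 2 - A)) = α 2 - A := Real.exp_log (by linarith)
  have pp : s < p' + Real.log (α 2) := by
    rw [es]
    have : Real.log (α 1) < Real.log (α 2) := Real.log_lt_log (h.αpos 1) (by linarith)
    linarith
  have lt12 : Real.log (α 1) < Real.log (α 2) := Real.log_lt_log (h.αpos 1) (by linarith)
  have lt02 : Real.log (α 0 - A) < Real.log (α 2 - A) := by
    rw [w0, ep]; exact Real.log_lt_log (by linarith) (by linarith)
  have a01 : |Real.log (α 0) - Real.log (α 1)| + |Real.log (α 0 - A) - Real.log (α 1 - A)| = s + s + p + p + p' + s' := by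
    rw [v0, ← es, w0, w1, abs_of_neg (by linarith), abs_of_pos (by linarith)]; ring
  have a02 : |Real.log (α 0) - Real.log (α 2)| + |Real.log (α 0 - A) - Real.log (α 2 - A)| =
      Real.log (α 2) + Real.log (α 2 - A) + p' := by
    rw [abs_of_neg (by linarith), abs_of_neg (by linarith)]; linarith
  have a12 : |Real.log (α 1) - Real.log (α 2)| + |Real.log (α 1 - A) - Real.log (α 2 - A)| =
      Real.log (α 2) + Real.log (α 2 - A) + s' := by
    rw [abs_of_neg (by linarith), abs_of_neg (by linarith)]; linarith
  have c01 : 4 * Real.exp (|Real.log (α 0) - Real.log (α 1)| + |Real.log (α 0 - A) - Real.log (α 1 - A)|) < h.D := by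
    refine lt_of_eq_of_lt ?_ h.ratio01
    rw [a01]; simp only [Real.exp_add, ep1, ep2, es1, es2]; ring
  have c02 : 4 * Real.exp (|Real.log (α 0) - Real.log (α 2)| + |Real.log (α 0 - A) - Real.log (α 2 - A)|) < h.D := by
    refine lt_of_eq_of_lt ?_ h.ratio02
    rw [a02]; simp only [Real.exp_add, ep1, ep2, es1, es2, ev2, ew2]
  have c12 : 4 * Real.exp (|Real.log (α 1) - Real.log (α 2)| + |Real.log (α 1 - A) - Real.log (α 2 - A)|) < h.D := by
    refine lt_of_eq_of_lt ?_ h.ratio12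
    rw [a12]; simp only [Real.exp_add, ep1, ep2, es1, es2, ev2, ew2]
  have cc : ∀ k, 4 * Real.exp (|Real.log (α k) - Real.log (α k)| + |Real.log (α k - A) - Real.log (α k - A)|) < h.D := by
    intro k
    refine lt_of_le_of_lt ?_ c12
    simp
    positivity
  have sym : ∀ k l, 4 * Real.exp (|Real.log (α k) - Real.log (α l)| + |Real.log (α k - A) - Real.log (α l - A)|) < h.D →
      4 * Real.exp (|Real.log (α l) - Real.log (α k)| + |Real.log (α l - A) - Real.log (α k - A)|) < h.D := by
    intro k l hkl
    rwa [abs_sub_comm, abs_sub_comm (Real.log (α l - A))]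
  fin_cases i <;> fin_cases j
  · exact cc 0
  · exact c01
  · exact c02
  · exact sym _ _ c01
  · exact cc 1
  · exact c12
  · exact sym _ _ c02
  · exact sym _ _ c12
  · exact cc 2

/-- An element of the order, of norm one and with bounded ratios, is a rational sign. -/
lemma small_unit (h : RT A B α) (ν : Fin 3 → ℝ) (hν : ν ∈ h.ord) (hn : |ν 0 * ν 1 * ν 2| = 1)
    (hr : ∀ i j, 4 * ν i ^ 2 < h.D * ν j ^ 2) : (∀ i, ν i = 1) ∨ (∀ i, ν i = -1) := by
  obtain ⟨p, q, s, hν⟩ := hν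
  have hd := disc_lt (ν 0) (ν 1) (ν 2) h.D hn (hr 0 1) (hr 0 2) (hr 1 0) (hr 1 2) (hr 2 0) (hr 2 1)
  set t : ℤ := q + s * (A + B) with ht
  have tR : (t:ℝ) = q + s * (A + B) := by rw [ht]; push_cast; ring
  have e : (ν 0 - ν 1) * (ν 0 - ν 2) * (ν 1 - ν 2) =
      (α 0 - α 1) * (α 0 - α 2) * (α 1 - α 2) * ((t - s * α 2) * (t - s * α 1) * (t - s * α 0)) := by
    have s1 := h.s1
    have e1 : ν 0 - ν 1 = (α 0 - α 1) * (t - s * α 2) := by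
      rw [hν, hν, tR]; linear_combination (α 0 - α 1) * s * s1
    have e2 : ν 0 - ν 2 = (α 0 - α 2) * (t - s * α 1) := by
      rw [hν, hν, tR]; linear_combination (α 0 - α 2) * s * s1
    have e3 : ν 1 - ν 2 = (α 1 - α 2) * (t - s * α 0) := by
      rw [hν, hν, tR]; linear_combination (α 1 - α 2) * s * s1
    rw [e1, e2, e3]; ring
  set N : ℤ := t ^ 3 - (A + B) * t ^ 2 * s + A * B * t * s ^ 2 - s ^ 3 with hN
  have eN : (t - s * α 2) * (t - s * α 1) * (t - s * α 0) = (N:ℝ) := by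
    rw [hN]; push_cast
    linear_combination (-(t:ℝ) ^ 2 * s) * h.s1 + t * s ^ 2 * h.s2 - s ^ 3 * h.s3
  have hs0 : s = 0 ∧ t = 0 := by
    have key : ∀ i, (t:ℝ) - s * α i = 0 → s = 0 ∧ t = 0 := by
      intro i hi
      have := h.no_rat i t s (by linarith)
      refine ⟨this, ?_⟩
      rw [this] at hi
      simpa using hi
    by_cases hN0 : N = 0
    · rw [hN0] at eN
      simp only [Int.cast_zero, mul_eq_zero] at eN
      rcases eN with (h1 | h1) | h1
      · exact key 2 h1
      · exact key 1 h1
      · exact key 0 h1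
    · exfalso
      have : (1:ℝ) ≤ (N:ℝ) ^ 2 := by
        have : 1 ≤ N ^ 2 := by
          have : 0 < N ^ 2 := by positivity
          omega
        exact_mod_cast this
      rw [e, eN, mul_pow] at hd
      have hD := h.dpos
      change h.D * _ < h.D at hd
      nlinarith
  have q0 : q = 0 := by
    have h1 := hs0.2
    rw [ht, hs0.1] at h1; simpa using h1
  have hp : ∀ i, ν i = p := by intro i; rw [hν, hs0.1, q0]; simp
  rw [hp, hp, hp] at hn
  have hp1 : |p * p * p| = 1 := by exact_mod_cast hn
  have : p = 1 ∨ p = -1 := by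
    have : IsUnit p := by
      rw [← Int.isUnit_iff_abs_eq] at hp1
      exact isUnit_of_mul_isUnit_right hp1
    exact Int.isUnit_iff.mp this
  rcases this with h1 | h1
  · left; intro i; rw [hp, h1]; simp
  · right; intro i; rw [hp, h1]; simp

theorem units (h : RT A B α) (μ : Fin 3 → ℝ) (hμ : μ ∈ h.ord) (hn : |μ 0 * μ 1 * μ 2| = 1) :
    ∃ a b : ℤ, (∀ i, μ i = α i ^ a * (α i - A) ^ b) ∨ (∀ i, μ i = -(α i ^ a * (α i - A) ^ b)) := by
  obtain ⟨p, p', s, s', hp, hp', hs, hs', ep, ep', es, es', v0, w0, w1⟩ := h.logs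
  have hne : μ 0 * μ 1 * μ 2 ≠ 0 := by intro h; rw [h] at hn; simp at hn
  have m0 : μ 0 ≠ 0 := by intro h; rw [h] at hne; simp at hne
  have m1 : μ 1 ≠ 0 := by intro h; rw [h] at hne; simp at hne
  have m2 : μ 2 ≠ 0 := by intro h; rw [h] at hne; simp at hne
  have su : Real.log (μ 0) + Real.log (μ 1) + Real.log (μ 2) = 0 := by
    rw [← Real.log_mul m0 m1, ← Real.log_mul (mul_ne_zero m0 m1) m2, ← Real.log_abs, hn, Real.log_one]
  have sv := h.sumV
  have sw := h.sumW
  obtain ⟨S, T, hST⟩ : ∃ S T : ℝ, ∀ i, Real.log (μ i) = S * Real.log (α i) + T * Real.log (α i - A) := by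
    have hdet : (p + p') * (s + s') - s * p ≠ 0 := by nlinarith [mul_pos hp hs', mul_pos hp' hs, mul_pos hp' hs']
    set d := (p + p') * (s + s') - s * p
    refine ⟨(-(s + s') * Real.log (μ 0) - p * Real.log (μ 1)) / d,
      (-(p + p') * Real.log (μ 1) - s * Real.log (μ 0)) / d, ?_⟩
    have c0 : Real.log (μ 0) = (-(s + s') * Real.log (μ 0) - p * Real.log (μ 1)) / d * Real.log (α 0) +
      (-(p + p') * Real.log (μ 1) - s * Real.log (μ 0)) / d * Real.log (α 0 - A) := by
      rw [v0, w0]; field_simp; simp only [d]; ring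
    have c1 : Real.log (μ 1) = (-(s + s') * Real.log (μ 0) - p * Real.log (μ 1)) / d * Real.log (α 1) +
      (-(p + p') * Real.log (μ 1) - s * Real.log (μ 0)) / d * Real.log (α 1 - A) := by
      rw [← es, w1]; field_simp; simp only [d]; ring
    intro i
    fin_cases i
    · exact c0
    · exact c1
    · change Real.log (μ 2) = _ * Real.log (α 2) + _ * Real.log (α 2 - A)
      linear_combination su - c0 - c1 - (-(s + s') * Real.log (μ 0) - p * Real.log (μ 1)) / d * sv -
        (-(p + p') * Real.log (μ 1) - s * Real.log (μ 0)) / d * sw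
  have mne : ∀ i, μ i ≠ 0 := by
    intro i; fin_cases i
    · exact m0
    · exact m1
    · exact m2
  refine ⟨round S, round T, ?_⟩
  set a := round S
  set b := round T
  have ha := abs_sub_round S
  have hb := abs_sub_round T
  let ν : Fin 3 → ℝ := fun i => μ i * (α i ^ (-a) * (α i - A) ^ (-b))
  have hνm : ν ∈ h.ord := h.ord.mul_mem hμ (h.ord.mul_mem (h.mem1 (-a)) (h.mem2 (-b)))
  have nne : ∀ i, ν i ≠ 0 := fun i =>
    mul_ne_zero (mne i) (mul_ne_zero (zpow_ne_zero _ (h.vne i)) (zpow_ne_zero _ (h.ne1 i)))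
  have hlog : ∀ i, Real.log (ν i) = (S - a) * Real.log (α i) + (T - b) * Real.log (α i - A) := by
    intro i
    simp only [ν]
    rw [Real.log_mul (mne i) (mul_ne_zero (zpow_ne_zero _ (h.vne i)) (zpow_ne_zero _ (h.ne1 i))),
      Real.log_mul (zpow_ne_zero _ (h.vne i)) (zpow_ne_zero _ (h.ne1 i)), Real.log_zpow, Real.log_zpow, hST]
    push_cast; ring
  have hνn : |ν 0 * ν 1 * ν 2| = 1 := by
    have : ν 0 * ν 1 * ν 2 = (μ 0 * μ 1 * μ 2) * ((α 0 * α 1 * α 2) ^ (-a) *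
        ((α 0 - A) * (α 1 - A) * (α 2 - A)) ^ (-b)) := by
      simp only [ν, mul_zpow]; ring
    rw [this, h.s3, h.prodA]; simpa using hn
  have hr : ∀ i j, 4 * ν i ^ 2 < h.D * ν j ^ 2 := by
    intro i j
    have pj : 0 < ν j ^ 2 := by have := nne j; positivity
    have pi : 0 < ν i ^ 2 := by have := nne i; positivity
    have : ν i ^ 2 ≤ Real.exp (|Real.log (α i) - Real.log (α j)| +
        |Real.log (α i - A) - Real.log (α j - A)|) * ν j ^ 2 := by
      rw [← Real.log_le_log_iff pi (by positivity), Real.log_mul (by positivity) pj.ne', Real.log_exp,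
        Real.log_pow, Real.log_pow, hlog, hlog]
      have k1 : (S - a) * (Real.log (α i) - Real.log (α j)) ≤ 1 / 2 * |Real.log (α i) - Real.log (α j)| := by
        refine (le_abs_self _).trans ?_
        rw [abs_mul]; gcongr
      have k2 : (T - b) * (Real.log (α i - A) - Real.log (α j - A)) ≤ 1 / 2 * |Real.log (α i - A) - Real.log (α j - A)| := by
        refine (le_abs_self _).trans ?_
        rw [abs_mul]; gcongr
      push_cast
      linarith
    have r := h.ratio_log i j
    nlinarith
  rcases h.small_unit ν hνm hνn hr with h1 | h1
  · left
    intro i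
    have := h1 i
    simp only [ν] at this
    rw [zpow_neg, zpow_neg, ← mul_inv, ← div_eq_mul_inv, div_eq_one_iff_eq] at this
    · exact this
    · exact mul_ne_zero (zpow_ne_zero _ (h.vne i)) (zpow_ne_zero _ (h.ne1 i))
  · right
    intro i
    have := h1 i
    simp only [ν] at this
    rw [zpow_neg, zpow_neg, ← mul_inv, ← div_eq_mul_inv, div_eq_iff] at this
    · rw [this]; ring
    · exact mul_ne_zero (zpow_ne_zero _ (h.vne i)) (zpow_ne_zero _ (h.ne1 i))

end RT

namespace RT
variable {A B : ℤ} {α : Fin 3 → ℝ}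

lemma lc2 (c e U V M : ℝ) (hc : 0 ≤ c) (he : 0 ≤ e) (hU : |U| ≤ M) (hV : |V| ≤ M) :
    |c * U + e * V| ≤ (c + e) * M := by
  calc |c * U + e * V| ≤ |c * U| + |e * V| := abs_add_le _ _
    _ = c * |U| + e * |V| := by rw [abs_mul, abs_mul, abs_of_nonneg hc, abs_of_nonneg he]
    _ ≤ c * M + e * M := by gcongr
    _ = _ := by ring

lemma expo (h : RT A B α) (a b : ℤ) (X : ℕ) (hX : X = max a.natAbs b.natAbs) (M : ℝ)
    (h0 : |a * Real.log (α 0) + b * Real.log (α 0 - A)| ≤ M)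
    (h1 : |a * Real.log (α 1) + b * Real.log (α 1 - A)| ≤ M) : X * Real.log (B - A) ≤ M := by
  have hA := h.hAR; have hAB := h.hABR; have r0 := h.r0; have r1 := h.r1; have r2 := h.r2
  obtain ⟨p, p', s, s', hp, hp', hs, hs', ep, ep', es, es', v0, w0, w1⟩ := h.logs
  rw [v0, w0] at h0
  rw [← es, w1] at h1
  have hps : s' ≤ p' := by
    rw [ep', es']; exact Real.log_le_log (by linarith) (by linarith)
  have hlog : Real.log (B - A) ≤ s' := by
    rw [es']; exact Real.log_le_log (by linarith) (by linarith)
  have M0 : 0 ≤ M := (abs_nonneg _).trans h0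
  set U0 := (a:ℝ) * -(p + p') + b * p with hU0
  set U1 := (a:ℝ) * s + b * -(s + s') with hU1
  have dpos : 0 < p * s' + p' * s + p' * s' := by positivity
  set d := p * s' + p' * s + p' * s' with hd
  have ea : d * a = -((s + s') * U0 + p * U1) := by rw [hd, hU0, hU1]; ring
  have eb : d * b = -(s * U0 + (p + p') * U1) := by rw [hd, hU0, hU1]; ring
  have Ba : |(a:ℝ)| * s' ≤ M := by
    have : d * |(a:ℝ)| ≤ (s + s' + p) * M := by
      rw [← abs_of_pos dpos, ← abs_mul, ea, abs_neg]
      exact lc2 _ _ _ _ _ (by positivity) (by positivity) h0 h1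
    have h2 : (s + s' + p) * s' ≤ d := by rw [hd]; nlinarith
    have h3 : d * (|(a:ℝ)| * s') ≤ d * M := by
      calc d * (|(a:ℝ)| * s') = d * |(a:ℝ)| * s' := by ring
        _ ≤ (s + s' + p) * M * s' := by gcongr
        _ = (s + s' + p) * s' * M := by ring
        _ ≤ _ := by gcongr
    exact le_of_mul_le_mul_left h3 dpos
  have Bb : |(b:ℝ)| * s' ≤ M := by
    have : d * |(b:ℝ)| ≤ (s + (p + p')) * M := by
      rw [← abs_of_pos dpos, ← abs_mul, eb, abs_neg]
      exact lc2 _ _ _ _ _ (by positivity) (by positivity) h0 h1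
    have h2 : (s + (p + p')) * s' ≤ d := by rw [hd]; nlinarith
    have h3 : d * (|(b:ℝ)| * s') ≤ d * M := by
      calc d * (|(b:ℝ)| * s') = d * |(b:ℝ)| * s' := by ring
        _ ≤ (s + (p + p')) * M * s' := by gcongr
        _ = (s + (p + p')) * s' * M := by ring
        _ ≤ _ := by gcongr
    exact le_of_mul_le_mul_left h3 dpos
  have : (X:ℝ) * s' ≤ M := by
    rcases max_choice a.natAbs b.natAbs with h | h
    · rw [hX, h, Nat.cast_natAbs]; push_cast; exact Ba
    · rw [hX, h, Nat.cast_natAbs]; push_cast; exact Bb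
  exact (mul_le_mul_of_nonneg_left hlog (by positivity)).trans this

lemma gap (h : RT A B α) (i j : Fin 3) (hij : i ≠ j) : 1.6 < |α i - α j| ∧ |α i - α j| ≤ B + 1 := by
  have hA := h.hAR; have hAB := h.hABR; have r0 := h.r0; have r1 := h.r1; have r2 := h.r2
  have b0 := h.b0; have b1 := h.b1
  have c01 : 1.6 < |α 0 - α 1| ∧ |α 0 - α 1| ≤ B + 1 := by
    rw [abs_of_neg (by linarith)]; constructor <;> linarith
  have c02 : 1.6 < |α 0 - α 2| ∧ |α 0 - α 2| ≤ B + 1 := by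
    rw [abs_of_neg (by linarith)]; constructor <;> linarith
  have c12 : 1.6 < |α 1 - α 2| ∧ |α 1 - α 2| ≤ B + 1 := by
    rw [abs_of_neg (by linarith)]; constructor <;> linarith
  fin_cases i <;> fin_cases j
  · exact absurd rfl hij
  · exact c01
  · exact c02
  · rw [abs_sub_comm]; exact c01
  · exact absurd rfl hij
  · exact c12
  · rw [abs_sub_comm]; exact c02
  · rw [abs_sub_comm]; exact c12
  · exact absurd rfl hij

lemma tri : ∀ i j : Fin 3, j = i ∨ j = i + 1 ∨ j = i + 2 := by decide

lemma sum3 (f : Fin 3 → ℝ) (i : Fin 3) : f i + f (i + 1) + f (i + 2) = f 0 + f 1 + f 2 := by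
  fin_cases i
  · rfl
  · change f 1 + f 2 + f 0 = _; ring
  · change f 2 + f 0 + f 1 = _; ring

/-- the linear form -/
noncomputable def lam (_ : RT A B α) (i : Fin 3) (a b : ℤ) : ℝ :=
  Real.log (α (i + 2) - α i) - Real.log (α (i + 1) - α i) +
    a * (Real.log (α (i + 1)) - Real.log (α (i + 2))) + b * (Real.log (α (i + 1) - A) - Real.log (α (i + 2) - A))

lemma base3 (h : RT A B α) : 2 * ((B:ℝ) + 1) ^ 2 ≤ (B - A) ^ 3 ∧ 4 * ((B:ℝ) + 1) ≤ (B - A) ^ 3 := by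
  have hA := h.hAR; have hAB := h.hABR
  have hB : (8:ℝ) ≤ B := by linarith
  have : (3 / 4 * (B:ℝ)) ^ 3 ≤ (B - A) ^ 3 := by gcongr; linarith
  have h2 : 8 * (B:ℝ) ^ 2 ≤ B ^ 3 := by nlinarith [sq_nonneg (B:ℝ)]
  constructor <;> nlinarith

lemma log_near (ρ : ℝ) (hd4 : |ρ - 1| ≤ 1 / 4) : |Real.log ρ| ≤ 2 * |ρ - 1| := by
  have h5 := abs_le.mp hd4
  have ρpos : 0 < ρ := by linarith
  have up := Real.log_le_sub_one_of_pos ρpos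
  have lo := Real.one_sub_inv_le_log_of_pos ρpos
  have e : 1 - ρ⁻¹ = (ρ - 1) / ρ := by field_simp
  rw [abs_le]
  constructor
  · refine le_trans ?_ lo
    rw [e, neg_le, ← neg_div, div_le_iff₀ ρpos]
    have := neg_abs_le (ρ - 1)
    nlinarith [abs_nonneg (ρ - 1)]
  · have := le_abs_self (ρ - 1)
    linarith [abs_nonneg (ρ - 1)]

theorem lam_bound (h : RT A B α) (x y : ℤ) (a b : ℤ) (X : ℕ) (hX : X = max a.natAbs b.natAbs) (hX3 : 3 ≤ X)
    (hn : |x * (x - A * y) * (x - B * y) - y ^ 3| = 1)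
    (hu : ∀ i, |(x:ℝ) - y * α i| = |α i ^ a * (α i - A) ^ b|) :
    ∃ i, |h.lam i a b| ≤ 2 * (B + 1) * ((B:ℝ) - A)⁻¹ ^ X := by
  have hA := h.hAR; have hAB := h.hABR; have r0 := h.r0; have r1 := h.r1; have r2 := h.r2
  have hBA : (1:ℝ) < B - A := by linarith
  have b3 := h.base3
  set u : Fin 3 → ℝ := fun i => (x:ℝ) - y * α i with hud
  have hnu : |u 0 * u 1 * u 2| = 1 := by
    have : u 0 * u 1 * u 2 = ((x * (x - A * y) * (x - B * y) - y ^ 3 : ℤ) : ℝ) := by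
      simp only [hud]; push_cast
      linear_combination (-(x:ℝ) ^ 2 * y) * h.s1 + x * y ^ 2 * h.s2 - y ^ 3 * h.s3
    rw [this, ← Int.cast_abs, hn]; simp
  have une : ∀ i, u i ≠ 0 := by
    intro i hi
    have := hu i
    change |u i| = _ at this
    rw [hi, abs_zero, eq_comm, abs_eq_zero] at this
    exact mul_ne_zero (zpow_ne_zero _ (h.vne i)) (zpow_ne_zero _ (h.ne1 i)) this
  have hL : ∀ i, Real.log (u i) = a * Real.log (α i) + b * Real.log (α i - A) := by
    intro i
    rw [← Real.log_abs]
    change Real.log |(x:ℝ) - y * α i| = _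
    rw [hu i, Real.log_abs, Real.log_mul (zpow_ne_zero _ (h.vne i)) (zpow_ne_zero _ (h.ne1 i)),
      Real.log_zpow, Real.log_zpow]
  have sL : Real.log (u 0) + Real.log (u 1) + Real.log (u 2) = 0 := by
    rw [← Real.log_mul (une 0) (une 1), ← Real.log_mul (mul_ne_zero (une 0) (une 1)) (une 2),
      ← Real.log_abs, hnu, Real.log_one]
  have hexp : ∀ M : ℝ, (∀ i, |Real.log (u i)| ≤ M) → X * Real.log (B - A) ≤ M := by
    intro M hM
    exact h.expo a b X hX M (by rw [← hL]; exact hM 0) (by rw [← hL]; exact hM 1)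
  have lpos : 0 < Real.log ((B:ℝ) - A) := Real.log_pos hBA
  have X3R : (3:ℝ) ≤ X := by exact_mod_cast hX3
  have y2 : 2 ≤ |y| := by
    by_contra hy
    have hy' : |y| ≤ 1 := by omega
    have hxb : ∀ i, |u i| ≤ B + 1 := by
      have hAZ := h.hA; have hABZ := h.hAB
      have hn' := abs_le.mp hn.le
      have key : ∀ z : ℤ, -2 ≤ z * (z - A) * (z - B) → z * (z - A) * (z - B) ≤ 2 → 0 ≤ z ∧ z ≤ B := by
        intro z h1 h2
        constructor
        · by_contra hc
          have c1 : 1 ≤ -z := by omega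
          have c2 : 1 ≤ A - z := by omega
          have c3 : 9 ≤ B - z := by omega
          have : 1 * 1 * 9 ≤ (-z) * (A - z) * (B - z) := by gcongr
          linarith
        · by_contra hc
          have c1 : 9 ≤ z := by omega
          have c2 : 1 ≤ z - A := by omega
          have c3 : 1 ≤ z - B := by omega
          have : 9 * 1 * 1 ≤ z * (z - A) * (z - B) := by gcongr
          linarith
      have fin : ∀ z : ℤ, 0 ≤ z ∧ z ≤ B → ∀ i, |(z:ℝ) - α i| ≤ B + 1 := by
        rintro z ⟨z1, z2⟩ i
        have z1' : (0:ℝ) ≤ z := by exact_mod_cast z1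
        have z2' : (z:ℝ) ≤ B := by exact_mod_cast z2
        have a1 := h.αpos i
        have a2 : α i ≤ B + 1 := by
          fin_cases i
          · change α 0 ≤ _; linarith
          · change α 1 ≤ _; linarith
          · change α 2 ≤ _; linarith
        rw [abs_le]; constructor <;> linarith
      obtain ⟨y1, y2⟩ := abs_le.mp hy'
      have hycases : y = -1 ∨ y = 0 ∨ y = 1 := by omega
      intro i
      simp only [hud]
      rcases hycases with h0 | h0 | h0
      · have := fin (-x) (key (-x) (by rw [h0] at hn'; ring_nf at hn' ⊢; linarith)
          (by rw [h0] at hn'; ring_nf at hn' ⊢; linarith)) i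
        rw [← abs_neg] at this
        rw [h0]; push_cast at this ⊢
        convert this using 2; ring
      · have h3 : |x| ^ 3 = 1 := by
          rw [← abs_pow, ← hn, h0]; congr 1; ring
        have h1 : |x| ≤ 1 := by
          have h0 := abs_nonneg x
          by_contra hc
          have : 2 ≤ |x| := by omega
          nlinarith [sq_nonneg |x|]
        have h1R : |(x:ℝ)| ≤ 1 := by rw [← Int.cast_abs]; exact_mod_cast h1
        rw [h0]; push_cast
        rw [zero_mul, sub_zero]
        linarith
      · have := fin x (key x (by rw [h0] at hn'; ring_nf at hn' ⊢; linarith)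
          (by rw [h0] at hn'; ring_nf at hn' ⊢; linarith)) i
        rw [h0]; push_cast
        rw [one_mul]; exact this
    have hub : ∀ i, Real.log (u i) ≤ Real.log (B + 1) := by
      intro i
      rw [← Real.log_abs]
      exact Real.log_le_log (abs_pos.mpr (une i)) (hxb i)
    have hM : ∀ i, |Real.log (u i)| ≤ 2 * Real.log (B + 1) := by
      intro i
      have l0 : 0 ≤ Real.log ((B:ℝ) + 1) := Real.log_nonneg (by linarith)
      have h1 := hub i; have h2 := hub (i + 1); have h3 := hub (i + 2)
      have h4 := sum3 (fun i => Real.log (u i)) i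
      rw [abs_le]; constructor <;> linarith
    have h3 := hexp _ hM
    have h4 : 2 * Real.log ((B:ℝ) + 1) < 3 * Real.log (B - A) := by
      have e1 : 2 * Real.log ((B:ℝ) + 1) = Real.log ((B + 1) ^ 2) := by rw [Real.log_pow]; norm_num
      have e2 : 3 * Real.log ((B:ℝ) - A) = Real.log ((B - A) ^ 3) := by rw [Real.log_pow]; norm_num
      rw [e1, e2]
      have hB1 : (0:ℝ) < B + 1 := by linarith
      exact Real.log_lt_log (by positivity) (by nlinarith [b3.1, sq_nonneg ((B:ℝ) + 1), pow_pos hB1 2])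
    nlinarith
  have y2R : (2:ℝ) ≤ |(y:ℝ)| := by rw [← Int.cast_abs]; exact_mod_cast y2
  obtain ⟨i, hi⟩ : ∃ i, ∀ j, |u i| ≤ |u j| := by
    obtain ⟨i, _, hi⟩ := Finset.exists_min_image Finset.univ (fun i => |u i|) ⟨0, Finset.mem_univ _⟩
    exact ⟨i, fun j => hi j (Finset.mem_univ _)⟩
  have ui1 : |u i| ≤ 1 := by
    by_contra hc
    push Not at hc
    have := hnu
    rw [abs_mul, abs_mul] at this
    have c0 := hc.trans_le (hi 0); have c1 := hc.trans_le (hi 1); have c2 := hc.trans_le (hi 2)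
    have : 1 < |u 0| * |u 1| := by nlinarith
    nlinarith
  have uj : ∀ j, j ≠ i → 1 ≤ |u j| := by
    intro j hj
    have g := (h.gap i j hj.symm).1
    have e : u j - u i = y * (α i - α j) := by simp only [hud]; ring
    have : 2 * 1.6 ≤ |u j - u i| := by rw [e, abs_mul]; gcongr
    have := abs_sub (u j) (u i)
    linarith
  have n1 : i + 1 ≠ i := by fin_cases i <;> decide
  have n2 : i + 2 ≠ i := by fin_cases i <;> decide
  have n12 : i + 2 ≠ i + 1 := by fin_cases i <;> decide
  have hli : |u i| ≤ ((B:ℝ) - A)⁻¹ ^ X := by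
    have l1 : Real.log (u i) ≤ 0 := by rw [← Real.log_abs]; exact Real.log_nonpos (abs_nonneg _) ui1
    have lj : ∀ j, j ≠ i → 0 ≤ Real.log (u j) := fun j hj => by
      rw [← Real.log_abs]; exact Real.log_nonneg (uj j hj)
    have l2 := lj _ n1
    have l3 := lj _ n2
    have h4 := sum3 (fun i => Real.log (u i)) i
    have hM : ∀ j, |Real.log (u j)| ≤ - Real.log (u i) := by
      intro j
      have : j = i ∨ j = i + 1 ∨ j = i + 2 := tri i j
      rcases this with rfl | rfl | rfl
      · rw [abs_of_nonpos l1]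
      · rw [abs_of_nonneg l2]; linarith
      · rw [abs_of_nonneg l3]; linarith
    have h5 := hexp _ hM
    rw [← Real.log_le_log_iff (abs_pos.mpr (une i)) (by positivity), Real.log_abs, Real.log_pow, Real.log_inv]
    linarith
  refine ⟨i, ?_⟩
  have hB1 : (0:ℝ) < B + 1 := by linarith
  have hP0 : 0 < ((B:ℝ) - A) := by linarith
  have g1 := h.gap (i + 1) i n1
  have g2 := h.gap (i + 2) i n2
  have g12 := h.gap (i + 2) (i + 1) n12
  have d1 : α (i + 1) - α i ≠ 0 := by intro hc; rw [hc] at g1; norm_num at g1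
  have d2 : α (i + 2) - α i ≠ 0 := by intro hc; rw [hc] at g2; norm_num at g2
  set ρ := ((α (i + 2) - α i) * u (i + 1)) / ((α (i + 1) - α i) * u (i + 2)) with hρ
  have elam : h.lam i a b = Real.log ρ := by
    rw [hρ, Real.log_div (mul_ne_zero d2 (une _)) (mul_ne_zero d1 (une _)), Real.log_mul d2 (une _),
      Real.log_mul d1 (une _), hL, hL, lam]
    ring
  have ρ1 : ρ - 1 = (α (i + 2) - α (i + 1)) * u i / ((α (i + 1) - α i) * u (i + 2)) := by
    have := une (i + 2)
    rw [hρ, eq_div_iff (mul_ne_zero d1 this), sub_mul, div_mul_cancel₀ _ (mul_ne_zero d1 this)]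
    simp only [hud]; ring
  have hδ : |ρ - 1| ≤ (B + 1) * ((B:ℝ) - A)⁻¹ ^ X := by
    rw [ρ1, abs_div]
    refine div_le_of_le_mul₀ (abs_nonneg _) (by positivity) ?_
    rw [abs_mul, abs_mul]
    have h1 : 1 * 1 ≤ |α (i + 1) - α i| * |u (i + 2)| := by
      gcongr
      · linarith [g1.1]
      · exact uj _ n2
    have h2 : |α (i + 2) - α (i + 1)| * |u i| ≤ (B + 1) * ((B:ℝ) - A)⁻¹ ^ X := by
      exact mul_le_mul g12.2 hli (abs_nonneg _) hB1.le
    have h3 : 0 ≤ (B + 1) * ((B:ℝ) - A)⁻¹ ^ X := by positivity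
    nlinarith
  have hq : (B + 1) * ((B:ℝ) - A)⁻¹ ^ X ≤ 1 / 4 := by
    have h1 : ((B:ℝ) - A)⁻¹ ^ X ≤ ((B:ℝ) - A)⁻¹ ^ 3 :=
      pow_le_pow_of_le_one (by positivity) (inv_le_one_of_one_le₀ hBA.le) hX3
    have h2 : (B + 1) * ((B:ℝ) - A)⁻¹ ^ 3 ≤ 1 / 4 := by
      rw [inv_pow, ← div_eq_mul_inv, div_le_iff₀ (by positivity)]
      linarith [b3.2]
    have : (B + 1) * ((B:ℝ) - A)⁻¹ ^ X ≤ (B + 1) * ((B:ℝ) - A)⁻¹ ^ 3 := by gcongr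
    linarith
  have hd4 : |ρ - 1| ≤ 1 / 4 := hδ.trans hq
  rw [elam]
  have := log_near ρ hd4
  linarith

end RT

namespace RT
variable {A B : ℤ} {α : Fin 3 → ℝ}

lemma expo0 (h : RT A B α) (p q : ℤ) (h0 : ∀ i, p * Real.log (α i) + q * Real.log (α i - A) = 0) :
    p = 0 ∧ q = 0 := by
  have hA := h.hAR; have hAB := h.hABR
  have := h.expo p q _ rfl 0 (by rw [h0]; simp) (by rw [h0]; simp)
  have lp : 0 < Real.log ((B:ℝ) - A) := Real.log_pos (by linarith)
  have : ((max p.natAbs q.natAbs : ℕ) : ℝ) ≤ 0 := by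
    by_contra hc
    push Not at hc
    nlinarith
  have : max p.natAbs q.natAbs ≤ 0 := by exact_mod_cast this
  omega

lemma indep (h : RT A B α) (i : Fin 3) (p q : ℤ)
    (h0 : p * (Real.log (α (i + 1)) - Real.log (α (i + 2))) +
      q * (Real.log (α (i + 1) - A) - Real.log (α (i + 2) - A)) = 0) : p = 0 ∧ q = 0 := by
  let ε : Fin 3 → ℝ := fun i => α i ^ p * (α i - A) ^ q
  have εne : ∀ i, ε i ≠ 0 := fun i => mul_ne_zero (zpow_ne_zero _ (h.vne i)) (zpow_ne_zero _ (h.ne1 i))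
  have hm : ε ∈ h.ord := h.ord.mul_mem (h.mem1 p) (h.mem2 q)
  have hlog : ∀ i, Real.log (ε i) = p * Real.log (α i) + q * Real.log (α i - A) := by
    intro i
    simp only [ε]
    rw [Real.log_mul (zpow_ne_zero _ (h.vne i)) (zpow_ne_zero _ (h.ne1 i)), Real.log_zpow, Real.log_zpow]
  have hjk : ε (i + 1) ^ 2 = ε (i + 2) ^ 2 := by
    have e : Real.log (ε (i + 1)) = Real.log (ε (i + 2)) := by rw [hlog, hlog]; linarith
    have p1 := εne (i + 1)
    have p2 := εne (i + 2)
    refine Real.log_injOn_pos (Set.mem_Ioi.mpr (by positivity)) (Set.mem_Ioi.mpr (by positivity)) ?_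
    rw [Real.log_pow, Real.log_pow, e]
  obtain ⟨P, Q, S, hP⟩ : ε * ε ∈ h.ord := h.ord.mul_mem hm hm
  have hP' : ∀ i, ε i ^ 2 = P + Q * α i + S * α i ^ 2 := by intro i; rw [← hP, Pi.mul_apply, sq]
  rw [hP', hP'] at hjk
  have n12 : i + 2 ≠ i + 1 := by fin_cases i <;> decide
  have g := (h.gap _ _ n12).1
  have d : α (i + 2) - α (i + 1) ≠ 0 := by intro hc; rw [hc] at g; norm_num at g
  have s1 : α i + α (i + 1) + α (i + 2) = A + B := by rw [sum3 α i]; exact h.s1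
  have e1 : ((Q + S * (A + B) : ℤ) : ℝ) = S * α i := by
    have : (α (i + 2) - α (i + 1)) * (((Q + S * (A + B) : ℤ) : ℝ) - S * α i) = 0 := by
      push_cast
      linear_combination -hjk - (α (i + 2) - α (i + 1)) * S * s1
    rcases mul_eq_zero.mp this with h1 | h1
    · exact absurd h1 d
    · linarith
  have S0 := h.no_rat i _ S e1
  have Q0 : Q = 0 := by
    rw [S0] at e1; simpa using e1
  have hc : ∀ i, ε i ^ 2 = P := by intro i; rw [hP', S0, Q0]; simp
  have hlc : ∀ i, 2 * Real.log (ε i) = Real.log P := by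
    intro i; rw [← hc i, Real.log_pow]; norm_num
  have hs : Real.log (ε 0) + Real.log (ε 1) + Real.log (ε 2) = 0 := by
    rw [hlog, hlog, hlog]
    linear_combination (p:ℝ) * h.sumV + q * h.sumW
  have hz : ∀ i, Real.log (ε i) = 0 := by
    intro i
    have := hlc 0; have := hlc 1; have := hlc 2; have := hlc i
    linarith
  exact h.expo0 p q fun i => by rw [← hlog]; exact hz i

lemma abs_prod_le (x y M : ℝ) (hx : |x| ≤ M) (hy : |y| ≤ M) : |(x ^ 2 * y) ^ 2| ≤ M ^ 6 := by
  have hM : 0 ≤ M := (abs_nonneg x).trans hx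
  rw [abs_pow, abs_mul, abs_pow]
  calc (|x| ^ 2 * |y|) ^ 2 ≤ (M ^ 2 * M) ^ 2 := by gcongr
    _ = M ^ 6 := by ring

lemma sigma_prod (f : Fin 3 → ℝ) (σ : Equiv.Perm (Fin 3)) (i : Fin 3) :
    f (σ i) * f (σ (i + 1)) * f (σ (i + 2)) = f 0 * f 1 * f 2 := by
  have h1 : f (σ i) * f (σ (i + 1)) * f (σ (i + 2)) = ∏ l, f (σ l) := by
    rw [Fin.prod_univ_three]
    fin_cases i
    · rfl
    · change f (σ 1) * f (σ 2) * f (σ 0) = _; ring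
    · change f (σ 2) * f (σ 0) * f (σ 1) = _; ring
  rw [h1, Equiv.prod_comp σ f, Fin.prod_univ_three]

lemma tdata (α : Fin 3 → ℝ) (C : ℤ) (hp : (α 0 - C) * (α 1 - C) * (α 2 - C) = 1) (i : Fin 3)
    (hb : ∀ l, |α l - C| ≤ Real.exp 20) :
    TData 1 (evHom α).range (fun σ => ((α (σ (i + 1)) - C) ^ 2 * (α (σ i) - C)) ^ 2)
      (fun σ => ((α (σ (i + 2)) - C) ^ 2 * (α (σ i) - C)) ^ 2) where
  mg := ⟨((MvPolynomial.X (i + 1) - MvPolynomial.C C) ^ 2 * (MvPolynomial.X i - MvPolynomial.C C)) ^ 2, by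
    ext σ; rw [evHom_apply]; simp⟩
  mg' := ⟨((MvPolynomial.X (i + 2) - MvPolynomial.C C) ^ 2 * (MvPolynomial.X i - MvPolynomial.C C)) ^ 2, by
    ext σ; rw [evHom_apply]; simp⟩
  h := by
    intro σ
    have := sigma_prod (fun l => α l - C) σ i
    rw [hp] at this
    calc _ = ((α (σ i) - C) * (α (σ (i + 1)) - C) * (α (σ (i + 2)) - C)) ^ 4 := by ring
      _ = 1 := by rw [this]; norm_num
  b := by
    intro σ
    refine (abs_prod_le _ _ _ (hb _) (hb _)).trans ?_
    rw [← Real.exp_nat_mul]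
    exact Real.exp_le_exp.mpr (by norm_num)
  b' := by
    intro σ
    refine (abs_prod_le _ _ _ (hb _) (hb _)).trans ?_
    rw [← Real.exp_nat_mul]
    exact Real.exp_le_exp.mpr (by norm_num)
  p := by
    have hne : ∀ l, α l - C ≠ 0 := by
      intro l hl
      have : (α 0 - C) * (α 1 - C) * (α 2 - C) = 0 := by
        fin_cases l
        · change α 0 - C = 0 at hl; rw [hl]; ring
        · change α 1 - C = 0 at hl; rw [hl]; ring
        · change α 2 - C = 0 at hl; rw [hl]; ring
      rw [this] at hp; norm_num at hp
    have h1 := hne (i + 1)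
    have h2 := hne i
    simp only [Equiv.Perm.coe_one, id]
    positivity

lemma e20 : (2:ℝ) ^ 28 + 1 ≤ Real.exp 20 := by
  have h := Real.exp_one_gt_d9
  have : Real.exp 20 = Real.exp 1 ^ 20 := by rw [← Real.exp_nat_mul]; norm_num
  rw [this]
  calc (2:ℝ) ^ 28 + 1 ≤ 2.7 ^ 20 := by norm_num
    _ ≤ _ := by gcongr; linarith

lemma exp9 (X : ℕ) (hX : 9 ≤ X) : Real.exp X ≤ 6 ^ (X - 3) := by
  have he := Real.exp_one_lt_d9
  induction X, hX using Nat.le_induction with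
  | base =>
    have : Real.exp ((9:ℕ):ℝ) = Real.exp 1 ^ 9 := by rw [← Real.exp_nat_mul]; norm_num
    rw [this]
    calc Real.exp 1 ^ 9 ≤ 2.8 ^ 9 := by gcongr; linarith
      _ ≤ _ := by norm_num
  | succ n hn ih =>
    have : n + 1 - 3 = (n - 3) + 1 := by omega
    rw [this, pow_succ]
    push_cast
    rw [Real.exp_add]
    gcongr
    linarith

theorem bound170 (h : RT A B α) (i : Fin 3) (a b : ℤ) (X : ℕ) (hX : X = max a.natAbs b.natAbs)
    (hl : |h.lam i a b| ≤ 2 * (B + 1) * ((B:ℝ) - A)⁻¹ ^ X) : X < 2 ^ 170 := by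
  by_cases hX9 : X < 9
  · exact hX9.trans (by norm_num)
  push Not at hX9
  have hA := h.hAR; have hAB := h.hABR; have r0 := h.r0; have r1 := h.r1; have r2 := h.r2
  have hBB : (B:ℝ) + 1 ≤ Real.exp 20 := by
    have : (B:ℝ) ≤ 2 ^ 28 := by exact_mod_cast h.hB28
    linarith [e20]
  have n1 : i + 1 ≠ i := by fin_cases i <;> decide
  have n2 : i + 2 ≠ i := by fin_cases i <;> decide
  have hα : ∀ l, α l ≤ B + 1 := by
    intro l
    fin_cases l
    · change α 0 ≤ _; linarith
    · change α 1 ≤ _; linarith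
    · change α 2 ≤ _; linarith
  have hgl : ∀ l m : Fin 3, |(α l - α m) ^ 2| ≤ Real.exp 40 := by
    intro l m
    have : |α l - α m| ≤ Real.exp 20 := by
      have := hα l; have := hα m; have := h.αpos l; have := h.αpos m
      rw [abs_le]; constructor <;> linarith
    rw [abs_pow]
    calc |α l - α m| ^ 2 ≤ Real.exp 20 ^ 2 := by gcongr
      _ = Real.exp 40 := by rw [← Real.exp_nat_mul]; norm_num
  have hgl2 : ∀ l m : Fin 3, |(α l - α m) ^ 2| ≤ Real.exp 160 := fun l m =>
    (hgl l m).trans (Real.exp_le_exp.mpr (by norm_num))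
  have hne : ∀ l m : Fin 3, l ≠ m → 0 < (α l - α m) ^ 2 ∧ |Real.log ((α l - α m) ^ 2)| ≤ 160 := by
    intro l m hlm
    have g := (h.gap l m hlm).1
    have c : 1 ≤ (α l - α m) ^ 2 := by rw [← sq_abs]; nlinarith
    refine ⟨by linarith, ?_⟩
    rw [abs_of_nonneg (Real.log_nonneg c), Real.log_le_iff_le_exp (by linarith)]
    exact (le_abs_self _).trans (hgl2 l m)
  have T1 := tdata α 0 (by simpa using h.s3) i (by
    intro l
    have := hα l; have := h.αpos l
    rw [abs_le]; push_cast; constructor <;> linarith)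
  have T2 := tdata α A h.prodA i (by
    intro l
    have := hα l; have := h.αpos l
    rw [abs_le]; constructor <;> linarith)
  have lg1 : Real.log (((α (i + 1) - (0:ℤ)) ^ 2 * (α i - (0:ℤ))) ^ 2) =
      2 * (Real.log (α (i + 1)) - Real.log (α (i + 2))) := by
    have s := sum3 (fun l => Real.log (α l)) i
    rw [h.sumV] at s
    simp only [Int.cast_zero, sub_zero]
    rw [Real.log_pow, Real.log_mul (pow_ne_zero 2 (h.vne _)) (h.vne _), Real.log_pow]
    push_cast
    linarith
  have lg2 : Real.log (((α (i + 1) - A) ^ 2 * (α i - A)) ^ 2) =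
      2 * (Real.log (α (i + 1) - A) - Real.log (α (i + 2) - A)) := by
    have s := sum3 (fun l => Real.log (α l - A)) i
    rw [h.sumW] at s
    rw [Real.log_pow, Real.log_mul (pow_ne_zero 2 (h.ne1 _)) (h.ne1 _), Real.log_pow]
    push_cast
    linarith
  refine transc (1 : Equiv.Perm (Fin 3)) (evHom α).range (evHom_liou α (A + B) (A * B) 1 (by push_cast; exact h.s1)
    (by push_cast; exact h.s2) (by push_cast; exact h.s3)) _ _ _ _
    (fun σ => (α (σ (i + 2)) - α (σ i)) ^ 2) (fun σ => (α (σ (i + 1)) - α (σ i)) ^ 2) T1 T2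
    ⟨(MvPolynomial.X (i + 2) - MvPolynomial.X i) ^ 2, by ext σ; rw [evHom_apply]; simp⟩
    ⟨(MvPolynomial.X (i + 1) - MvPolynomial.X i) ^ 2, by ext σ; rw [evHom_apply]; simp⟩
    (fun σ => hgl2 _ _) (fun σ => hgl2 _ _) ?_ ?_ ?_ ?_ ?_ a b X hX ?_
  · exact (hne _ _ n2).1
  · exact (hne _ _ n1).1
  · exact (hne _ _ n2).2
  · exact (hne _ _ n1).2
  · intro p q hpq
    simp only [Equiv.Perm.coe_one, id] at hpq
    rw [lg1, lg2] at hpq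
    exact h.indep i p q (by linarith)
  · simp only [Equiv.Perm.coe_one, id]
    rw [lg1, lg2, Real.log_pow, Real.log_pow]
    have e : ((2:ℕ):ℝ) * Real.log (α (i + 2) - α i) - ((2:ℕ):ℝ) * Real.log (α (i + 1) - α i) +
        a * (2 * (Real.log (α (i + 1)) - Real.log (α (i + 2)))) +
        b * (2 * (Real.log (α (i + 1) - A) - Real.log (α (i + 2) - A))) = 2 * h.lam i a b := by
      rw [lam]; push_cast; ring
    rw [e, abs_mul, abs_two]
    have hB0 : 0 < (B:ℝ) - A := by linarith
    have key : 4 * (B + 1) * ((B:ℝ) - A)⁻¹ ^ X ≤ Real.exp (-(X:ℝ)) := by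
      rw [inv_pow, ← div_eq_mul_inv, div_le_iff₀ (by positivity), Real.exp_neg, ← div_eq_inv_mul,
        le_div_iff₀ (Real.exp_pos _)]
      have e3 : ((B:ℝ) - A) ^ X = (B - A) ^ 3 * (B - A) ^ (X - 3) := by
        rw [← pow_add]; congr 1; omega
      rw [e3]
      have h6 : (6:ℝ) ^ (X - 3) ≤ (B - A) ^ (X - 3) := by gcongr; linarith
      have := exp9 X hX9
      have b3 := h.base3.2
      have hB1 : (0:ℝ) < B + 1 := by linarith
      exact mul_le_mul b3 (this.trans h6) (Real.exp_pos _).le (by positivity)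
    linarith
end RT

/-- Integer Horner scheme for the series of the inverse hyperbolic tangent. -/
def hor (P W N : ℕ) : ℕ → ℕ
  | 0 => 0
  | n + 1 => P / (2 * (N - (n + 1)) + 1) + W * hor P W N n / P

/-- tail sums -/
noncomputable def hser (w : ℝ) (k : ℕ) : ℝ := ∑' j : ℕ, w ^ j / (2 * (k + j) + 1)

lemma hser_summable (w : ℝ) (h0 : 0 ≤ w) (h1 : w ≤ 1 / 9) (k : ℕ) :
    Summable fun j : ℕ => w ^ j / (2 * ((k:ℝ) + j) + 1) := by
  refine Summable.of_nonneg_of_le (fun j => by positivity) (fun j => ?_)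
    (summable_geometric_of_lt_one h0 (by linarith : w < 1))
  refine div_le_self (by positivity) ?_
  have : (0:ℝ) ≤ k := by positivity
  have : (0:ℝ) ≤ j := by positivity
  linarith

lemma hser_rec (w : ℝ) (h0 : 0 ≤ w) (h1 : w ≤ 1 / 9) (k : ℕ) :
    hser w k = 1 / (2 * k + 1) + w * hser w (k + 1) := by
  unfold hser
  rw [(hser_summable w h0 h1 k).tsum_eq_zero_add, ← tsum_mul_left]
  congr 1
  · simp
  · refine tsum_congr fun j => ?_
    push_cast
    rw [pow_succ]
    have : (2 * ((k:ℝ) + (j + 1)) + 1) = 2 * ((k:ℝ) + 1 + j) + 1 := by ring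
    rw [this]; ring

lemma hser_nonneg (w : ℝ) (h0 : 0 ≤ w) (k : ℕ) : 0 ≤ hser w k :=
  tsum_nonneg fun j => by positivity

lemma hser_le (w : ℝ) (h0 : 0 ≤ w) (h1 : w ≤ 1 / 9) (k : ℕ) : hser w k ≤ 9 / 8 := by
  have : hser w k ≤ ∑' j : ℕ, w ^ j := by
    refine (hser_summable w h0 h1 k).tsum_le_tsum (fun j => ?_) (summable_geometric_of_lt_one h0 (by linarith))
    refine div_le_self (by positivity) ?_
    have : (0:ℝ) ≤ k := by positivity
    have : (0:ℝ) ≤ j := by positivity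
    linarith
  refine this.trans ?_
  rw [tsum_geometric_of_lt_one h0 (by linarith), inv_le_comm₀ (by linarith) (by norm_num)]
  norm_num; linarith

lemma nat_div_bd (a b : ℕ) (hb : 0 < b) : ((a / b : ℕ) : ℝ) ≤ (a:ℝ) / b ∧ (a:ℝ) / b ≤ ((a / b : ℕ) : ℝ) + 1 := by
  refine ⟨Nat.cast_div_le, ?_⟩
  have hb' : (0:ℝ) < b := by exact_mod_cast hb
  rw [div_le_iff₀ hb']
  have := (Nat.lt_div_mul_add hb (a := a)).le
  have h2 : a ≤ (a / b + 1) * b := by rw [add_mul, one_mul]; exact this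
  exact_mod_cast h2

lemma hor_bound (P W N : ℕ) (hP : 0 < P) (w : ℝ) (h0 : 0 ≤ w) (h1 : w ≤ 1 / 9)
    (hW : (W:ℝ) ≤ P * w) (hW' : P * w ≤ W + 1) (n : ℕ) (hn : n ≤ N) :
    (hor P W N n : ℝ) ≤ P * hser w (N - n) ∧ P * hser w (N - n) ≤ hor P W N n + 4 + 2 * P * w ^ n := by
  have hPR : (0:ℝ) < P := by exact_mod_cast hP
  induction n with
  | zero =>
    simp only [hor, Nat.cast_zero, pow_zero, tsub_zero]
    have := hser_le w h0 h1 N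
    have := hser_nonneg w h0 N
    constructor <;> nlinarith
  | succ n ih =>
    obtain ⟨l, u⟩ := ih (by omega)
    have e : N - n = (N - (n + 1)) + 1 := by omega
    rw [e] at l u
    set k := N - (n + 1) with hk
    rw [hser_rec w h0 h1 k]
    have hh := hser_le w h0 h1 (k + 1)
    have hh0 := hser_nonneg w h0 (k + 1)
    set t := hser w (k + 1)
    simp only [hor, ← hk]
    set H := hor P W N n
    obtain ⟨a1, a2⟩ := nat_div_bd P (2 * k + 1) (by omega)
    obtain ⟨b1, b2⟩ := nat_div_bd (W * H) P hP
    push_cast at a1 a2 b1 b2 ⊢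
    have hH0 : (0:ℝ) ≤ H := by positivity
    have e1 : (P:ℝ) * (1 / (2 * k + 1) + w * t) = P / (2 * k + 1) + P * w * t := by ring
    rw [e1]
    have c1 : (W:ℝ) * H / P ≤ P * w * t := by
      rw [div_le_iff₀ hPR]
      calc (W:ℝ) * H ≤ (P * w) * (P * t) := by gcongr
        _ = _ := by ring
    have c2 : P * w * t ≤ (W:ℝ) * H / P + 9 / 8 + w * 4 + 2 * P * w ^ (n + 1) := by
      have d1 : P * w * t ≤ w * H + w * 4 + 2 * P * w ^ (n + 1) := by
        calc P * w * t = w * (P * t) := by ring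
          _ ≤ w * (H + 4 + 2 * P * w ^ n) := by gcongr
          _ = _ := by ring
      have d2 : w * H ≤ (W:ℝ) * H / P + 9 / 8 := by
        have : w * H = P * w * H / P := by field_simp
        rw [this]
        calc P * w * H / P ≤ (W + 1) * H / P := by gcongr
          _ = W * H / P + H / P := by ring
          _ ≤ W * H / P + 9 / 8 := by
            have : (H:ℝ) / P ≤ 9 / 8 := by rw [div_le_iff₀ hPR]; nlinarith
            linarith
      linarith
    constructor
    · linarith
    · linarith

/-- fixed point value of `log ((den + num) / (den - num))`. -/
def lnZ (P N num den : ℕ) : ℕ := 2 * num * hor P (P * (num * num) / (den * den)) N N / den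

lemma lnZ_bound (P N num den : ℕ) (hP : 0 < P) (hN : P ≤ 9 ^ N) (hd : 0 < den) (h3 : 3 * num ≤ den) :
    (lnZ P N num den : ℝ) ≤ P * Real.log ((den + num) / (den - num)) ∧
    P * Real.log ((den + num) / (den - num)) ≤ lnZ P N num den + 5 := by
  have hPR : (0:ℝ) < P := by exact_mod_cast hP
  have hdR : (0:ℝ) < den := by exact_mod_cast hd
  have h3R : 3 * (num:ℝ) ≤ den := by exact_mod_cast h3
  have hnR : (0:ℝ) ≤ num := by positivity
  set z : ℝ := num / den with hz
  have z0 : 0 ≤ z := by positivity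
  have z1 : z ≤ 1 / 3 := by rw [hz, div_le_iff₀ hdR]; linarith
  have hw : z ^ 2 ≤ 1 / 9 := by nlinarith
  set W := P * (num * num) / (den * den) with hWd
  have hWb := nat_div_bd (P * (num * num)) (den * den) (by positivity)
  have ew : (P:ℝ) * z ^ 2 = ((P * (num * num) : ℕ) : ℝ) / ((den * den : ℕ) : ℝ) := by
    rw [hz]; push_cast; field_simp
  rw [← ew, ← hWd] at hWb
  obtain ⟨l, u⟩ := hor_bound P W N hP (z ^ 2) (by positivity) hw hWb.1 hWb.2 N le_rfl
  rw [Nat.sub_self] at l u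
  have htail : 2 * (P:ℝ) * (z ^ 2) ^ N ≤ 2 := by
    have h9 : (P:ℝ) ≤ 9 ^ N := by exact_mod_cast hN
    calc 2 * (P:ℝ) * (z ^ 2) ^ N ≤ 2 * 9 ^ N * (1 / 9) ^ N := by gcongr
      _ = 2 := by rw [one_div, inv_pow]; field_simp
  have hlog : Real.log ((den + num) / (den - num)) = 2 * z * hser (z ^ 2) 0 := by
    have hz1 : |z| < 1 := by rw [abs_of_nonneg z0]; linarith
    have hs := Real.hasSum_log_sub_log_of_abs_lt_one hz1
    have e : Real.log (1 + z) - Real.log (1 - z) = Real.log ((den + num) / (den - num)) := by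
      rw [← Real.log_div (by linarith) (by linarith), hz]
      congr 1
      have : (den:ℝ) - num ≠ 0 := by linarith
      field_simp
    rw [← e, ← hs.tsum_eq, hser, ← tsum_mul_left]
    refine tsum_congr fun j => ?_
    push_cast
    rw [pow_succ, pow_mul]
    ring
  obtain ⟨f1, f2⟩ := nat_div_bd (2 * num * hor P W N N) den hd
  have ez : ((2 * num * hor P W N N : ℕ) : ℝ) / den = 2 * z * hor P W N N := by
    rw [hz]; push_cast; field_simp
  rw [ez] at f1 f2
  rw [hlog]
  have hL : lnZ P N num den = 2 * num * hor P W N N / den := rfl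
  rw [hL]
  set H := hor P W N N
  have hH : (0:ℝ) ≤ H := by positivity
  constructor
  · calc _ ≤ _ := f1
      _ ≤ 2 * z * (P * hser (z ^ 2) 0) := by gcongr
      _ = _ := by ring
  · have : 2 * z * (P * hser (z ^ 2) 0) ≤ 2 * z * (H + 6) := by gcongr; linarith
    nlinarith

/-- fixed point value of `log (m / P)`, where `L2` is the fixed point value of `log 2`. -/
def lnN (P N L2 e m : ℕ) : ℕ := e * L2 + lnZ P N (m - 2 ^ e * P) (m + 2 ^ e * P)

lemma lnN_bound (P N e m : ℕ) (hP : 0 < P) (hN : P ≤ 9 ^ N) (h1 : 2 ^ e * P ≤ m) (h2 : m ≤ 2 ^ (e + 1) * P) :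
    (lnN P N (lnZ P N 1 3) e m : ℝ) ≤ P * Real.log (m / P) ∧
    P * Real.log (m / P) ≤ lnN P N (lnZ P N 1 3) e m + 5 * (e + 1) := by
  have hPR : (0:ℝ) < P := by exact_mod_cast hP
  obtain ⟨a1, a2⟩ := lnZ_bound P N 1 3 hP hN (by norm_num) (by norm_num)
  have hM : 0 < 2 ^ e * P := by positivity
  have h2' : m ≤ 2 * (2 ^ e * P) := by rw [pow_succ] at h2; linarith
  obtain ⟨b1, b2⟩ := lnZ_bound P N (m - 2 ^ e * P) (m + 2 ^ e * P) hP hN (by omega) (by omega)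
  have e1 : (((m + 2 ^ e * P : ℕ) : ℝ) + ((m - 2 ^ e * P : ℕ) : ℝ)) /
      (((m + 2 ^ e * P : ℕ) : ℝ) - ((m - 2 ^ e * P : ℕ) : ℝ)) = m / (2 ^ e * P) := by
    rw [Nat.cast_sub h1]; push_cast
    have : (2:ℝ) ^ e * P ≠ 0 := by positivity
    rw [show ((m:ℝ) + 2 ^ e * P + (m - 2 ^ e * P)) = 2 * m by ring,
      show ((m:ℝ) + 2 ^ e * P - (m - 2 ^ e * P)) = 2 * (2 ^ e * P) by ring]
    rw [mul_div_mul_left _ _ (by norm_num)]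
  rw [e1] at b1 b2
  have hm : (m:ℝ) ≠ 0 := by
    have : 0 < m := by omega
    positivity
  have e2 : Real.log (m / P) = e * Real.log 2 + Real.log (m / (2 ^ e * P)) := by
    rw [← Real.log_pow, ← Real.log_mul (by positivity) (by positivity)]
    congr 1; field_simp
  have e3 : Real.log ((((3:ℕ):ℝ) + ((1:ℕ):ℝ)) / (((3:ℕ):ℝ) - ((1:ℕ):ℝ))) = Real.log 2 := by norm_num
  rw [e3] at a1 a2
  rw [e2]
  unfold lnN
  push_cast
  have he : (0:ℝ) ≤ e := by positivity
  constructor <;> nlinarith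

/-- enclosure of the logarithm of a real number in `[m, m + 3] / P` -/
lemma lnN_real (P N e m : ℕ) (hP : 0 < P) (hN : P ≤ 9 ^ N) (h1 : 2 ^ e * P ≤ m) (h2 : m ≤ 2 ^ (e + 1) * P)
    (he : e ≤ 28) (x : ℝ) (x1 : (m:ℝ) ≤ P * x) (x2 : P * x ≤ m + 3) :
    (lnN P N (lnZ P N 1 3) e m : ℝ) ≤ P * Real.log x ∧
    P * Real.log x ≤ lnN P N (lnZ P N 1 3) e m + 150 := by
  have hPR : (0:ℝ) < P := by exact_mod_cast hP
  obtain ⟨a, b⟩ := lnN_bound P N e m hP hN h1 h2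
  have hmP : P ≤ m := le_trans (Nat.le_mul_of_pos_left P (by positivity)) h1
  have hmPR : (P:ℝ) ≤ m := by exact_mod_cast hmP
  have hm : (0:ℝ) < m := by linarith
  have y1 : (m:ℝ) / P ≤ x := by rw [div_le_iff₀ hPR]; linarith
  have hx : 0 < x := lt_of_lt_of_le (by positivity) y1
  have heR : (e:ℝ) ≤ 28 := by exact_mod_cast he
  have c1 : Real.log (m / P) ≤ Real.log x := Real.log_le_log (by positivity) y1
  have c2 : P * Real.log x ≤ P * Real.log (m / P) + 3 := by
    have : Real.log x - Real.log (m / P) ≤ 3 / P := by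
      rw [← Real.log_div hx.ne' (by positivity)]
      refine (Real.log_le_sub_one_of_pos (by positivity)).trans ?_
      have : x / (m / P) = P * x / m := by field_simp
      rw [this]
      have : P * x / m ≤ (m + 3) / m := by gcongr
      have h3 : ((m:ℝ) + 3) / m = 1 + 3 / m := by field_simp
      have h4 : (3:ℝ) / m ≤ 3 / P := by gcongr
      linarith
    have h5 : P * (Real.log x - Real.log (m / P)) ≤ P * (3 / P) := by gcongr
    have h6 : (P:ℝ) * (3 / P) = 3 := by field_simp
    linarith
  constructor
  · nlinarith
  · linarith

/-- One Baker–Davenport step. -/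
lemma bd_step (P E X0 q : ℕ) (t0 t1 t2 : ℝ) (l0 l1 l2 p m : ℤ)
    (h0 : |P * t0 - l0| ≤ E) (h1 : |P * t1 - l1| ≤ E) (h2 : |P * t2 - l2| ≤ E)
    (a b : ℤ) (ha : a.natAbs ≤ X0) :
    ((min (q * l0 - m * l2 - (q + |m|) * E) (|l2| - E - (q * l0 - m * l2) - (q + |m|) * E) -
      X0 * (|q * l1 - p * l2| + (q + |p|) * E) : ℤ) : ℝ) ≤ P * q * |t0 + a * t1 + b * t2| := by
  have hq : (0:ℝ) ≤ q := by positivity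
  have hE : (0:ℝ) ≤ E := by positivity
  set d0 : ℤ := min (q * l0 - m * l2 - (q + |m|) * E) (|l2| - E - (q * l0 - m * l2) - (q + |m|) * E) with hd0
  have c1 : (d0:ℝ) ≤ q * l0 - m * l2 - (q + |(m:ℝ)|) * E := by
    have : d0 ≤ q * l0 - m * l2 - (q + |m|) * E := min_le_left _ _
    exact_mod_cast this
  have c2 : (d0:ℝ) ≤ |(l2:ℝ)| - E - (q * l0 - m * l2) - (q + |(m:ℝ)|) * E := by
    have : d0 ≤ |l2| - E - (q * l0 - m * l2) - (q + |m|) * E := min_le_right _ _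
    exact_mod_cast this
  clear_value d0
  obtain ⟨T0, hT0⟩ : ∃ T, T = (P:ℝ) * t0 := ⟨_, rfl⟩
  obtain ⟨T1, hT1⟩ : ∃ T, T = (P:ℝ) * t1 := ⟨_, rfl⟩
  obtain ⟨T2, hT2d⟩ : ∃ T, T = (P:ℝ) * t2 := ⟨_, rfl⟩
  rw [← hT0] at h0
  rw [← hT1] at h1
  rw [← hT2d] at h2
  -- theta
  have th : |(q * T0 - m * T2) - (q * l0 - m * l2)| ≤ (q + |(m:ℝ)|) * E := by
    calc _ = |q * (T0 - l0) - m * (T2 - l2)| := by congr 1; ring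
      _ ≤ |q * (T0 - l0)| + |m * (T2 - l2)| := abs_sub _ _
      _ = q * |T0 - l0| + |(m:ℝ)| * |T2 - l2| := by rw [abs_mul, abs_mul, abs_of_nonneg hq]
      _ ≤ q * E + |(m:ℝ)| * E := by gcongr
      _ = _ := by ring
  have et : |q * T1 - p * T2| ≤ |(q:ℝ) * l1 - p * l2| + (q + |(p:ℝ)|) * E := by
    calc _ = |(q * l1 - p * l2) + (q * (T1 - l1) - p * (T2 - l2))| := by congr 1; ring
      _ ≤ |(q:ℝ) * l1 - p * l2| + |q * (T1 - l1) - p * (T2 - l2)| := abs_add_le _ _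
      _ ≤ |(q:ℝ) * l1 - p * l2| + (|q * (T1 - l1)| + |p * (T2 - l2)|) := by gcongr; exact abs_sub _ _
      _ = |(q:ℝ) * l1 - p * l2| + (q * |T1 - l1| + |(p:ℝ)| * |T2 - l2|) := by rw [abs_mul, abs_mul, abs_of_nonneg hq]
      _ ≤ |(q:ℝ) * l1 - p * l2| + (q * E + |(p:ℝ)| * E) := by gcongr
      _ = _ := by ring
  have hT2 : |(l2:ℝ)| - E ≤ |T2| := by
    have := abs_sub_abs_le_abs_sub (l2:ℝ) T2
    rw [abs_sub_comm] at this
    linarith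
  obtain ⟨th1, th2⟩ := abs_le.mp th
  set θ := q * T0 - m * T2
  have θ1 : (d0:ℝ) ≤ θ := by linarith
  have θ2 : (d0:ℝ) ≤ |T2| - θ := by linarith
  have key : ∀ s : ℤ, (d0:ℝ) ≤ |θ + s * T2| := by
    intro s
    by_cases hs : s = 0
    · rw [hs]; simp only [Int.cast_zero, zero_mul, add_zero]
      exact θ1.trans (le_abs_self _)
    · have h1 : (1:ℝ) ≤ |(s:ℝ)| := by
        have : 1 ≤ |s| := Int.one_le_abs hs
        rw [← Int.cast_abs]; exact_mod_cast this
      by_cases hd : (d0:ℝ) ≤ 0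
      · exact hd.trans (abs_nonneg _)
      push Not at hd
      have h3 : |s * T2| - |θ| ≤ |θ + s * T2| := by
        have := abs_sub_abs_le_abs_sub (s * T2) (-θ)
        rw [abs_neg, sub_neg_eq_add, add_comm] at this
        exact this
      have h4 : |T2| ≤ |s * T2| := by rw [abs_mul]; exact le_mul_of_one_le_left (abs_nonneg _) h1
      rw [abs_of_pos (by linarith : 0 < θ)] at h3
      linarith
  have main := key (m + a * p + b * q)
  have e : P * q * |t0 + a * t1 + b * t2| = |q * T0 + a * (q * T1) + b * (q * T2)| := by
    have hPq : (0:ℝ) ≤ P * q := by positivity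
    rw [← abs_of_nonneg hPq, ← abs_mul]
    congr 1
    rw [hT0, hT1, hT2d]; ring
  rw [e]
  have e2 : q * T0 + a * (q * T1) + b * (q * T2) =
      (θ + ((m + a * p + b * q : ℤ) : ℝ) * T2) + a * (q * T1 - p * T2) := by
    simp only [θ]; push_cast; ring
  rw [e2]
  have haR : |(a:ℝ)| ≤ X0 := by
    rw [← Int.cast_abs, Int.abs_eq_natAbs]; exact_mod_cast ha
  have l : |a * (q * T1 - p * T2)| ≤ X0 * (|(q:ℝ) * l1 - p * l2| + (q + |(p:ℝ)|) * E) := by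
    rw [abs_mul]; gcongr
  have tri : |θ + ((m + a * p + b * q : ℤ) : ℝ) * T2| - |a * (q * T1 - p * T2)| ≤
      |(θ + ((m + a * p + b * q : ℤ) : ℝ) * T2) + a * (q * T1 - p * T2)| := by
    have := abs_sub_abs_le_abs_sub (θ + ((m + a * p + b * q : ℤ) : ℝ) * T2) (-(a * (q * T1 - p * T2)))
    rwa [abs_neg, sub_neg_eq_add] at this
  rw [Int.cast_sub]
  push_cast
  push_cast at main l tri
  linarith

/-- integer check for one step -/
def bdOK (P E A B : ℕ) (l0 l1 l2 : ℤ) (X0 q : ℕ) (p m : ℤ) (N : ℕ) : Bool :=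
  decide (2 * ((B:ℤ) + 1) * (P * q) <
    (min (q * l0 - m * l2 - (q + |m|) * E) (|l2| - E - (q * l0 - m * l2) - (q + |m|) * E) -
      X0 * (|q * l1 - p * l2| + (q + |p|) * E)) * ((B:ℤ) - A) ^ (N + 1))

lemma bdOK_spec (P E A B X0 q N : ℕ) (t0 t1 t2 : ℝ) (l0 l1 l2 p m : ℤ) (hAB : A < B)
    (h0 : |P * t0 - l0| ≤ E) (h1 : |P * t1 - l1| ≤ E) (h2 : |P * t2 - l2| ≤ E)
    (hok : bdOK P E A B l0 l1 l2 X0 q p m N = true)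
    (a b : ℤ) (X : ℕ) (hX : X = max a.natAbs b.natAbs) (hX0 : X ≤ X0)
    (hl : |t0 + a * t1 + b * t2| ≤ 2 * ((B:ℝ) + 1) * ((B:ℝ) - A)⁻¹ ^ X) : X ≤ N := by
  by_contra hc
  push Not at hc
  have s := bd_step P E X0 q t0 t1 t2 l0 l1 l2 p m h0 h1 h2 a b (by omega)
  simp only [bdOK, decide_eq_true_eq] at hok
  set d : ℤ := min (q * l0 - m * l2 - (q + |m|) * E) (|l2| - E - (q * l0 - m * l2) - (q + |m|) * E) -
      X0 * (|q * l1 - p * l2| + (q + |p|) * E)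
  have hBA : (1:ℝ) ≤ (B:ℝ) - A := by
    have : A + 1 ≤ B := hAB
    have : (A:ℝ) + 1 ≤ B := by exact_mod_cast this
    linarith
  have okR : 2 * ((B:ℝ) + 1) * (P * q) < d * ((B:ℝ) - A) ^ (N + 1) := by exact_mod_cast hok
  have h3 : ((B:ℝ) - A)⁻¹ ^ X ≤ ((B:ℝ) - A)⁻¹ ^ (N + 1) :=
    pow_le_pow_of_le_one (by positivity) (inv_le_one_of_one_le₀ hBA) hc
  have hpow : 0 < ((B:ℝ) - A) ^ (N + 1) := by positivity
  have h4 : (d:ℝ) ≤ P * q * (2 * ((B:ℝ) + 1) * ((B:ℝ) - A)⁻¹ ^ (N + 1)) := by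
    refine s.trans ?_
    gcongr
    exact hl.trans (by gcongr)
  have h5 : d * ((B:ℝ) - A) ^ (N + 1) ≤ 2 * ((B:ℝ) + 1) * (P * q) := by
    calc d * ((B:ℝ) - A) ^ (N + 1) ≤ (P * q * (2 * ((B:ℝ) + 1) * ((B:ℝ) - A)⁻¹ ^ (N + 1))) * ((B:ℝ) - A) ^ (N + 1) := by gcongr
      _ = _ := by rw [inv_pow]; field_simp
  linarith

/-- certificate data for one linear form -/
structure BD where
  q : ℕ
  p : ℤ
  m : ℤ
  q' : ℕ
  p' : ℤ
  m' : ℤ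

def bd2 (P A B : ℕ) (N1 N2 : ℕ) (l0 l1 l2 : ℤ) (c : BD) : Bool :=
  bdOK P 1000 A B l0 l1 l2 (2 ^ 170) c.q c.p c.m N1 && bdOK P 1000 A B l0 l1 l2 N1 c.q' c.p' c.m' N2

def tailChk (P A B N1 N2 : ℕ) (c0 c1 c2 : BD) (p p' s s' d01 d02 d12 : ℕ) : Bool :=
  bd2 P A B N1 N2 ((d02:ℤ) - d01) (2 * (s:ℤ) - p - p') (p - 2 * (s:ℤ) - 2 * s') c0 &&
  bd2 P A B N1 N2 ((d01:ℤ) - d12) (2 * (p:ℤ) + 2 * p' - s) ((s:ℤ) + s' - 2 * p) c1 &&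
  bd2 P A B N1 N2 ((d12:ℤ) - d02) (-(p:ℤ) - p' - s) ((p:ℤ) + s + s') c2

/-- evaluation of the first argument before the call -/
def force (n : ℕ) (f : ℕ → Bool) : Bool := Nat.rec (f 0) (fun k _ => f (Nat.succ k)) n

lemma force_eq (n : ℕ) (f : ℕ → Bool) : force n f = f n := by cases n <;> rfl

def okC (P m : ℕ) : Bool :=
  decide (2 ^ (Nat.log2 (m / P)) * P ≤ m) && decide (m ≤ 2 ^ (Nat.log2 (m / P) + 1) * P) &&
    decide (Nat.log2 (m / P) ≤ 28)

def lnC (P N L2 m : ℕ) (f : ℕ → Bool) : Bool :=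
  force m fun m => okC P m && force (lnN P N L2 (Nat.log2 (m / P)) m) f

def rootChk (P A B a0 a1 : ℕ) : Bool :=
  decide (2 ≤ A) && decide (4 * A ≤ B) && decide (B ≤ 2 ^ 28) &&
  decide (a0 + 1 ≤ P) && decide (a0 * (A * P - a0) * (B * P - a0) ≤ P ^ 3) &&
  decide (P ^ 3 ≤ (a0 + 1) * (A * P - (a0 + 1)) * (B * P - (a0 + 1))) &&
  decide (A * P ≤ a1 + P) && decide (a1 + 1 ≤ A * P) &&
  decide (P ^ 3 ≤ a1 * (A * P - a1) * (B * P - a1)) &&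
  decide ((a1 + 1) * (A * P - (a1 + 1)) * (B * P - (a1 + 1)) ≤ P ^ 3)

def chk (P N A B a0 a1 N1 N2 : ℕ) (c0 c1 c2 : BD) : Bool :=
  rootChk P A B a0 a1 && decide (0 < P) && decide (P ≤ 9 ^ N) &&
  force (lnZ P N 1 3) fun L2 =>
  lnC P N L2 (A * P - a0 - 1) fun p =>
  lnC P N L2 (B * P - a0 - 1) fun p' =>
  lnC P N L2 a1 fun s =>
  lnC P N L2 (B * P - a1 - 1) fun s' =>
  lnC P N L2 (a1 - a0 - 1) fun d01 =>
  lnC P N L2 ((A + B) * P - 2 * a0 - a1 - 3) fun d02 =>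
  lnC P N L2 ((A + B) * P - a0 - 2 * a1 - 3) fun d12 =>
  tailChk P A B N1 N2 c0 c1 c2 p p' s s' d01 d02 d12

lemma lnC_spec (P N m : ℕ) (f : ℕ → Bool) (h : lnC P N (lnZ P N 1 3) m f = true) (hP : 0 < P) (hN : P ≤ 9 ^ N) :
    ∃ l : ℕ, f l = true ∧ ∀ x : ℝ, (m:ℝ) ≤ P * x → P * x ≤ m + 3 →
      (l:ℝ) ≤ P * Real.log x ∧ P * Real.log x ≤ l + 150 := by
  unfold lnC at h
  rw [force_eq] at h
  simp only [force_eq, Bool.and_eq_true, okC, decide_eq_true_eq] at h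
  obtain ⟨⟨⟨h1, h2⟩, h3⟩, h4⟩ := h
  exact ⟨_, h4, fun x x1 x2 => lnN_real P N _ m hP hN h1 h2 h3 x x1 x2⟩

lemma rootChk_spec {P A B a0 a1 : ℕ} (hP : 0 < P) (hr : rootChk P A B a0 a1 = true) {α : Fin 3 → ℝ}
    (h : RT (A:ℤ) (B:ℤ) α) :
    ((a0:ℝ) ≤ P * α 0 ∧ P * α 0 ≤ a0 + 1) ∧ ((a1:ℝ) ≤ P * α 1 ∧ P * α 1 ≤ a1 + 1) ∧
    a0 + 1 ≤ P ∧ A * P ≤ a1 + P ∧ a1 + 1 ≤ A * P ∧ 2 ≤ A ∧ 4 * A ≤ B := by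
  simp only [rootChk, Bool.and_eq_true, decide_eq_true_eq] at hr
  obtain ⟨⟨⟨⟨⟨⟨⟨⟨⟨hA, hAB⟩, -⟩, k1⟩, k2⟩, k3⟩, k4⟩, k5⟩, k6⟩, k7⟩ := hr
  have hPR : (0:ℝ) < P := by exact_mod_cast hP
  have hAP : 2 * P ≤ A * P := Nat.mul_le_mul_right _ hA
  have hBP : 4 * (A * P) ≤ B * P := by rw [← mul_assoc]; exact Nat.mul_le_mul_right _ hAB
  have f := h.fact
  have r0 := h.r0
  have r1 := h.r1
  have r2 := h.r2
  simp only [Int.cast_natCast] at f r1 r2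
  have F : ∀ x : ℝ, x * (A * P - x) * (B * P - x) - (P:ℝ) ^ 3 = (x - P * α 0) * (x - P * α 1) * (x - P * α 2) := by
    intro x
    have := f (x / P)
    have e : x = P * (x / P) := by field_simp
    set y := x / P
    rw [e]
    linear_combination (P:ℝ) ^ 3 * this
  have G : ∀ x : ℕ, x ≤ A * P → ((x * (A * P - x) * (B * P - x) : ℕ) : ℝ) = (x:ℝ) * (A * P - x) * (B * P - x) := by
    intro x hx
    have : x ≤ B * P := by omega
    push_cast [Nat.cast_sub hx, Nat.cast_sub this]
    ring
  have c2 : (a0:ℝ) * (A * P - a0) * (B * P - a0) ≤ (P:ℝ) ^ 3 := by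
    rw [← G a0 (by omega)]; exact_mod_cast k2
  have c3 : (P:ℝ) ^ 3 ≤ ((a0 + 1 : ℕ):ℝ) * (A * P - (a0 + 1 : ℕ)) * (B * P - (a0 + 1 : ℕ)) := by
    rw [← G (a0 + 1) (by omega)]; exact_mod_cast k3
  have c6 : (P:ℝ) ^ 3 ≤ (a1:ℝ) * (A * P - a1) * (B * P - a1) := by
    rw [← G a1 (by omega)]; exact_mod_cast k6
  have c7 : ((a1 + 1 : ℕ):ℝ) * (A * P - (a1 + 1 : ℕ)) * (B * P - (a1 + 1 : ℕ)) ≤ (P:ℝ) ^ 3 := by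
    rw [← G (a1 + 1) (by omega)]; exact_mod_cast k7
  have F0 := F a0
  have F0' := F (a0 + 1 : ℕ)
  have F1 := F a1
  have F1' := F (a1 + 1 : ℕ)
  push_cast at c3 c7 F0' F1'
  have d1 : (a0:ℝ) + 1 ≤ P := by exact_mod_cast k1
  have d4 : (A:ℝ) * P ≤ a1 + P := by exact_mod_cast k4
  have d5 : (a1:ℝ) + 1 ≤ A * P := by exact_mod_cast k5
  have dA : 2 * (P:ℝ) ≤ A * P := by exact_mod_cast hAP
  have dB : 4 * ((A:ℝ) * P) ≤ B * P := by exact_mod_cast hBP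
  have u2 : P * α 0 < P := by nlinarith only [r0.2, hPR]
  have v1 : A * P - P < P * α 1 := by nlinarith only [r1.1, hPR]
  have w1 : B * P < P * α 2 := by nlinarith only [r2.1, hPR]
  have g0 : (a0 - P * α 0) * (a0 - P * α 1) * (a0 - P * α 2) ≤ 0 := by rw [← F0]; linarith only [c2]
  have g0' : 0 ≤ (a0 + 1 - P * α 0) * (a0 + 1 - P * α 1) * (a0 + 1 - P * α 2) := by rw [← F0']; linarith only [c3]
  have g1 : 0 ≤ (a1 - P * α 0) * (a1 - P * α 1) * (a1 - P * α 2) := by rw [← F1]; linarith only [c6]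
  have g1' : (a1 + 1 - P * α 0) * (a1 + 1 - P * α 1) * (a1 + 1 - P * α 2) ≤ 0 := by rw [← F1']; linarith only [c7]
  clear F0 F0' F1 F1' F G c2 c3 c6 c7 f
  generalize P * α 0 = u at *
  generalize P * α 1 = v at *
  generalize P * α 2 = w at *
  generalize (A:ℝ) * P = AP at *
  generalize (B:ℝ) * P = BP at *
  have e1 : (a0:ℝ) + 1 < v := by linarith only [v1, d1, dA]
  have e2 : (a0:ℝ) + 1 < w := by linarith only [w1, d1, dA, dB, hPR]
  have e3 : u < a1 := by linarith only [u2, d4, dA]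
  have e4 : (a1:ℝ) + 1 < w := by linarith only [w1, d5, dA, dB, hPR]
  refine ⟨⟨?_, ?_⟩, ⟨?_, ?_⟩, k1, k4, k5, hA, hAB⟩
  · by_contra hc
    push Not at hc
    have : 0 < (a0 - u) * ((v - a0) * (w - a0)) :=
      mul_pos (by linarith only [hc]) (mul_pos (by linarith only [e1]) (by linarith only [e2]))
    linarith only [this, g0]
  · by_contra hc
    push Not at hc
    have : 0 < (u - (a0 + 1)) * ((v - (a0 + 1)) * (w - (a0 + 1))) :=
      mul_pos (by linarith only [hc]) (mul_pos (by linarith only [e1]) (by linarith only [e2]))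
    linarith only [this, g0']
  · by_contra hc
    push Not at hc
    have : 0 < (a1 - v) * ((a1 - u) * (w - a1)) :=
      mul_pos (by linarith only [hc]) (mul_pos (by linarith only [e3]) (by linarith only [e4]))
    linarith only [this, g1]
  · by_contra hc
    push Not at hc
    have : 0 < (v - (a1 + 1)) * ((a1 + 1 - u) * (w - (a1 + 1))) :=
      mul_pos (by linarith only [hc]) (mul_pos (by linarith only [e3]) (by linarith only [e4]))
    linarith only [this, g1']

lemma bd2_spec {P A B N1 N2 : ℕ} (t0 t1 t2 : ℝ) {l0 l1 l2 : ℤ} {c : BD} (hAB : A < B)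
    (h0 : |P * t0 - l0| ≤ (1000:ℕ)) (h1 : |P * t1 - l1| ≤ (1000:ℕ)) (h2 : |P * t2 - l2| ≤ (1000:ℕ))
    (hok : bd2 P A B N1 N2 l0 l1 l2 c = true)
    (a b : ℤ) (X : ℕ) (hX : X = max a.natAbs b.natAbs) (hX0 : X < 2 ^ 170)
    (hl : |t0 + a * t1 + b * t2| ≤ 2 * ((B:ℝ) + 1) * ((B:ℝ) - A)⁻¹ ^ X) : X ≤ N2 := by
  simp only [bd2, Bool.and_eq_true] at hok
  exact bdOK_spec P 1000 A B N1 c.q' N2 t0 t1 t2 l0 l1 l2 c.p' c.m' hAB h0 h1 h2 hok.2 a b X hX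
    (bdOK_spec P 1000 A B (2 ^ 170) c.q N1 t0 t1 t2 l0 l1 l2 c.p c.m hAB h0 h1 h2 hok.1 a b X hX hX0.le hl) hl

theorem reduce {P N A B a0 a1 N1 N2 : ℕ} {c0 c1 c2 : BD} {α : Fin 3 → ℝ} (h : RT (A:ℤ) (B:ℤ) α)
    (hc : chk P N A B a0 a1 N1 N2 c0 c1 c2 = true) (i : Fin 3) (a b : ℤ) (X : ℕ)
    (hX : X = max a.natAbs b.natAbs)
    (hl : |h.lam i a b| ≤ 2 * (((B:ℤ):ℝ) + 1) * (((B:ℤ):ℝ) - ((A:ℤ):ℝ))⁻¹ ^ X) : X ≤ N2 := by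
  have hX0 := h.bound170 i a b X hX hl
  simp only [chk, Bool.and_eq_true, decide_eq_true_eq, force_eq] at hc
  obtain ⟨⟨⟨hr, hP⟩, hN⟩, hc⟩ := hc
  obtain ⟨⟨u1, u2⟩, ⟨v1, v2⟩, k1, k4, k5, hA, hAB⟩ := rootChk_spec hP hr h
  have hAP : 2 * P ≤ A * P := Nat.mul_le_mul_right _ hA
  have hBP : 4 * (A * P) ≤ B * P := by rw [← mul_assoc]; exact Nat.mul_le_mul_right _ hAB
  obtain ⟨p, hc, Hp⟩ := lnC_spec _ _ _ _ hc hP hN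
  obtain ⟨p', hc, Hp'⟩ := lnC_spec _ _ _ _ hc hP hN
  obtain ⟨s, hc, Hs⟩ := lnC_spec _ _ _ _ hc hP hN
  obtain ⟨s', hc, Hs'⟩ := lnC_spec _ _ _ _ hc hP hN
  obtain ⟨d01, hc, H01⟩ := lnC_spec _ _ _ _ hc hP hN
  obtain ⟨d02, hc, H02⟩ := lnC_spec _ _ _ _ hc hP hN
  obtain ⟨d12, hc, H12⟩ := lnC_spec _ _ _ _ hc hP hN
  simp only [tailChk, Bool.and_eq_true] at hc
  obtain ⟨⟨q0, q1⟩, q2⟩ := hc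
  have s1 := h.s1
  simp only [Int.cast_natCast] at hl s1
  have e3 : P * α 2 = A * P + B * P - P * α 0 - P * α 1 := by linear_combination (P:ℝ) * s1
  have n1 : ((A * P - a0 - 1 : ℕ) : ℝ) = A * P - a0 - 1 := by
    rw [Nat.cast_sub (by omega), Nat.cast_sub (by omega)]; push_cast; ring
  have n2 : ((B * P - a0 - 1 : ℕ) : ℝ) = B * P - a0 - 1 := by
    rw [Nat.cast_sub (by omega), Nat.cast_sub (by omega)]; push_cast; ring
  have n3 : ((B * P - a1 - 1 : ℕ) : ℝ) = B * P - a1 - 1 := by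
    rw [Nat.cast_sub (by omega), Nat.cast_sub (by omega)]; push_cast; ring
  have n4 : ((a1 - a0 - 1 : ℕ) : ℝ) = a1 - a0 - 1 := by
    rw [Nat.cast_sub (by omega), Nat.cast_sub (by omega)]; push_cast; ring
  have hsum : (A + B) * P = A * P + B * P := by ring
  have n5 : (((A + B) * P - 2 * a0 - a1 - 3 : ℕ) : ℝ) = A * P + B * P - 2 * a0 - a1 - 3 := by
    rw [Nat.cast_sub (by omega), Nat.cast_sub (by omega), Nat.cast_sub (by omega)]; push_cast; ring
  have n6 : (((A + B) * P - a0 - 2 * a1 - 3 : ℕ) : ℝ) = A * P + B * P - a0 - 2 * a1 - 3 := by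
    rw [Nat.cast_sub (by omega), Nat.cast_sub (by omega), Nat.cast_sub (by omega)]; push_cast; ring
  rw [n1] at Hp
  rw [n2] at Hp'
  rw [n3] at Hs'
  rw [n4] at H01
  rw [n5] at H02
  rw [n6] at H12
  obtain ⟨Lp1, Lp2⟩ := Hp (A - α 0) (by rw [mul_sub]; linarith only [u2, mul_comm (A:ℝ) P]) (by rw [mul_sub]; linarith only [u1, mul_comm (A:ℝ) P])
  obtain ⟨Lq1, Lq2⟩ := Hp' (B - α 0) (by rw [mul_sub]; linarith only [u2, mul_comm (B:ℝ) P]) (by rw [mul_sub]; linarith only [u1, mul_comm (B:ℝ) P])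
  obtain ⟨Ls1, Ls2⟩ := Hs (α 1) v1 (by linarith only [v2])
  obtain ⟨Lr1, Lr2⟩ := Hs' (B - α 1) (by rw [mul_sub]; linarith only [v2, mul_comm (B:ℝ) P]) (by rw [mul_sub]; linarith only [v1, mul_comm (B:ℝ) P])
  obtain ⟨L011, L012⟩ := H01 (α 1 - α 0) (by rw [mul_sub]; linarith only [u2, v1]) (by rw [mul_sub]; linarith only [u1, v2])
  obtain ⟨L021, L022⟩ := H02 (α 2 - α 0) (by rw [mul_sub, e3]; linarith only [u2, v2]) (by rw [mul_sub, e3]; linarith only [u1, v1])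
  obtain ⟨L121, L122⟩ := H12 (α 2 - α 1) (by rw [mul_sub, e3]; linarith only [u2, v2]) (by rw [mul_sub, e3]; linarith only [u1, v1])
  obtain ⟨tp, tp', ts, ts', -, -, -, -, ep, ep', es, es', y0, w0, w1⟩ := h.logs
  have sv := h.sumV
  have sw := h.sumW
  simp only [Int.cast_natCast] at ep ep' es es' w0 w1 sw
  rw [← ep] at Lp1 Lp2
  rw [← ep'] at Lq1 Lq2
  rw [← es] at Ls1 Ls2
  rw [← es'] at Lr1 Lr2
  have x10 : Real.log (α 0 - α 1) = Real.log (α 1 - α 0) := by rw [← Real.log_neg_eq_log]; congr 1; ring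
  have x20 : Real.log (α 0 - α 2) = Real.log (α 2 - α 0) := by rw [← Real.log_neg_eq_log]; congr 1; ring
  have x21 : Real.log (α 1 - α 2) = Real.log (α 2 - α 1) := by rw [← Real.log_neg_eq_log]; congr 1; ring
  have y1 : Real.log (α 1) = ts := es.symm
  have y2 : Real.log (α 2) = tp + tp' - ts := by linarith only [sv, y0, y1]
  have w2 : Real.log (α 2 - A) = ts + ts' - tp := by linarith only [sw, w0, w1]
  have hAB' : A < B := by omega
  fin_cases i
  · have el : h.lam 0 a b = (Real.log (α 2 - α 0) - Real.log (α 1 - α 0)) + a * (2 * ts - tp - tp') + b * (tp - 2 * ts - 2 * ts') := by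
      change Real.log (α 2 - α 0) - Real.log (α 1 - α 0) + a * (Real.log (α 1) - Real.log (α 2)) + b * (Real.log (α 1 - ((A:ℤ):ℝ)) - Real.log (α 2 - ((A:ℤ):ℝ))) = _
      simp only [Int.cast_natCast]
      rw [y1, y2, w1, w2]; ring
    change |h.lam 0 a b| ≤ _ at hl
    rw [el] at hl
    refine bd2_spec _ _ _ hAB' ?_ ?_ ?_ q0 a b X hX hX0 hl
    all_goals
      push_cast
      rw [abs_le]
      constructor <;> linarith
  · have el : h.lam 1 a b = (Real.log (α 1 - α 0) - Real.log (α 2 - α 1)) + a * (2 * tp + 2 * tp' - ts) + b * (ts + ts' - 2 * tp) := by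
      change Real.log (α 0 - α 1) - Real.log (α 2 - α 1) + a * (Real.log (α 2) - Real.log (α 0)) + b * (Real.log (α 2 - ((A:ℤ):ℝ)) - Real.log (α 0 - ((A:ℤ):ℝ))) = _
      simp only [Int.cast_natCast]
      rw [x10, y0, y2, w0, w2]; ring
    change |h.lam 1 a b| ≤ _ at hl
    rw [el] at hl
    refine bd2_spec _ _ _ hAB' ?_ ?_ ?_ q1 a b X hX hX0 hl
    all_goals
      push_cast
      rw [abs_le]
      constructor <;> linarith
  · have el : h.lam 2 a b = (Real.log (α 2 - α 1) - Real.log (α 2 - α 0)) + a * (-tp - tp' - ts) + b * (tp + ts + ts') := by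
      change Real.log (α 1 - α 2) - Real.log (α 0 - α 2) + a * (Real.log (α 0) - Real.log (α 1)) + b * (Real.log (α 0 - ((A:ℤ):ℝ)) - Real.log (α 1 - ((A:ℤ):ℝ))) = _
      simp only [Int.cast_natCast]
      rw [x20, x21, y0, y1, w0, w1]; ring
    change |h.lam 2 a b| ≤ _ at hl
    rw [el] at hl
    refine bd2_spec _ _ _ hAB' ?_ ?_ ?_ q2 a b X hX hX0 hl
    all_goals
      push_cast
      rw [abs_le]
      constructor <;> linarith

/-- multiplication by `α - c` on coordinate triples -/
def mulT (A B c : ℤ) (v : ℤ × ℤ × ℤ) : ℤ × ℤ × ℤ :=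
  (v.2.2 - c * v.1, v.1 - A * B * v.2.2 - c * v.2.1, v.2.1 + (A + B) * v.2.2 - c * v.2.2)

def powT (A B c : ℤ) : ℕ → ℤ × ℤ × ℤ → ℤ × ℤ × ℤ
  | 0, v => v
  | n + 1, v => mulT A B c (powT A B c n v)

def coefT (A B : ℤ) (k l : ℕ) : ℤ × ℤ × ℤ :=
  powT A B 0 k (powT A B A l (powT A B B 5 (1, 0, 0)))

def boxOK (A B : ℤ) : Bool :=
  (List.range 11).all fun k => (List.range 11).all fun l =>
    decide ((coefT A B k l).2.2 ≠ 0) || (k == 5 && l == 5) || (k == 6 && l == 5) || (k == 5 && l == 6) || (k == 4 && l == 4)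

lemma RT.mulT_eval {A B : ℤ} {α : Fin 3 → ℝ} (h : RT A B α) (c : ℤ) (v : ℤ × ℤ × ℤ) (i : Fin 3) :
    ((mulT A B c v).1 : ℝ) + (mulT A B c v).2.1 * α i + (mulT A B c v).2.2 * α i ^ 2 =
      (α i - c) * (v.1 + v.2.1 * α i + v.2.2 * α i ^ 2) := by
  have := h.root i
  simp only [mulT]
  push_cast
  linear_combination -(v.2.2:ℝ) * this

lemma RT.powT_eval {A B : ℤ} {α : Fin 3 → ℝ} (h : RT A B α) (c : ℤ) (n : ℕ) (v : ℤ × ℤ × ℤ) (i : Fin 3) :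
    ((powT A B c n v).1 : ℝ) + (powT A B c n v).2.1 * α i + (powT A B c n v).2.2 * α i ^ 2 =
      (α i - c) ^ n * (v.1 + v.2.1 * α i + v.2.2 * α i ^ 2) := by
  induction n with
  | zero => simp [powT]
  | succ n ih =>
    simp only [powT]
    rw [h.mulT_eval, ih, pow_succ]; ring

lemma RT.coefT_eval {A B : ℤ} {α : Fin 3 → ℝ} (h : RT A B α) (a b : ℤ) (k l : ℕ) (hk : (k:ℤ) = a + 5) (hl : (l:ℤ) = b + 5)
    (i : Fin 3) : α i ^ a * (α i - A) ^ b =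
      (coefT A B k l).1 + (coefT A B k l).2.1 * α i + (coefT A B k l).2.2 * α i ^ 2 := by
  unfold coefT
  rw [h.powT_eval, h.powT_eval, h.powT_eval]
  have hr := h.root i
  have e1 : α i ^ k = α i ^ a * α i ^ 5 := by
    rw [← zpow_natCast, hk, zpow_add₀ (h.vne i)]; rfl
  have e2 : (α i - A) ^ l = (α i - A) ^ b * (α i - A) ^ 5 := by
    rw [← zpow_natCast, hl, zpow_add₀ (h.ne1 i)]; rfl
  have e3 : α i ^ 5 * (α i - A) ^ 5 * (α i - B) ^ 5 = 1 := by
    rw [← mul_pow, ← mul_pow, hr, one_pow]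
  simp only [Int.cast_zero, sub_zero, Int.cast_one, zero_mul, add_zero, mul_one]
  rw [e1, e2]
  linear_combination -(α i ^ a * (α i - A) ^ b) * e3

lemma RT.quad_zero {A B : ℤ} {α : Fin 3 → ℝ} (h : RT A B α) (p q s : ℝ) (hq : ∀ i, p + q * α i + s * α i ^ 2 = 0) : s = 0 := by
  have g : ∀ i j : Fin 3, i ≠ j → α i - α j ≠ 0 := by
    intro i j hij hz
    have := (h.gap i j hij).1
    rw [hz] at this; norm_num at this
  have e1 : q + s * (α 0 + α 1) = 0 := by
    refine (mul_eq_zero.mp ?_).resolve_left (g 0 1 (by decide))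
    linear_combination hq 0 - hq 1
  have e2 : q + s * (α 0 + α 2) = 0 := by
    refine (mul_eq_zero.mp ?_).resolve_left (g 0 2 (by decide))
    linear_combination hq 0 - hq 2
  refine (mul_eq_zero.mp ?_).resolve_left (g 1 2 (by decide))
  linear_combination e1 - e2

lemma RT.quad_zero' {A B : ℤ} {α : Fin 3 → ℝ} (h : RT A B α) (p q : ℤ) (hq : (p:ℝ) + q * α 0 = 0) : p = 0 ∧ q = 0 := by
  have hq0 : -q = 0 := h.no_rat 0 p (-q) (by push_cast; linarith)
  have hq1 : q = 0 := by omega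
  subst hq1
  refine ⟨?_, rfl⟩
  simpa using hq

/-- trivial solutions up to sign -/
lemma RT.box {A B : ℤ} {α : Fin 3 → ℝ} (h : RT A B α) (hb : boxOK A B = true) (x y a b : ℤ)
    (ha : a.natAbs ≤ 5) (hb' : b.natAbs ≤ 5) (hu : ∀ i, (x:ℝ) - y * α i = α i ^ a * (α i - A) ^ b) :
    (x = 1 ∧ y = 0) ∨ (x = 0 ∧ y = -1) ∨ (x = -A ∧ y = -1) ∨ (x = -B ∧ y = -1) := by
  obtain ⟨k, hk⟩ : ∃ k : ℕ, (k:ℤ) = a + 5 := ⟨(a + 5).toNat, by omega⟩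
  obtain ⟨l, hl⟩ : ∃ l : ℕ, (l:ℤ) = b + 5 := ⟨(b + 5).toNat, by omega⟩
  have hs : (coefT A B k l).2.2 = 0 := by
    have := h.quad_zero ((coefT A B k l).1 - x) ((coefT A B k l).2.1 + y) ((coefT A B k l).2.2) (fun i => by
      have e1 := h.coefT_eval a b k l hk hl i
      have e2 := hu i
      linarith)
    exact_mod_cast this
  simp only [boxOK, List.all_eq_true, List.mem_range] at hb
  have hkl := hb k (by omega) l (by omega)
  rw [hs] at hkl
  simp only [ne_eq, not_true_eq_false, decide_false, Bool.false_or, Bool.or_eq_true, Bool.and_eq_true, beq_iff_eq] at hkl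
  have h0 := hu 0
  rcases hkl with ((⟨rfl, rfl⟩ | ⟨rfl, rfl⟩) | ⟨rfl, rfl⟩) | ⟨rfl, rfl⟩
  · obtain rfl : a = 0 := by omega
    obtain rfl : b = 0 := by omega
    left
    simp only [zpow_zero, mul_one] at h0
    have := h.quad_zero' (x - 1) (-y) (by push_cast; linarith)
    omega
  · obtain rfl : a = 1 := by omega
    obtain rfl : b = 0 := by omega
    right; left
    simp only [zpow_zero, mul_one, zpow_one] at h0
    have := h.quad_zero' x (-y - 1) (by push_cast; linarith)
    omega
  · obtain rfl : a = 0 := by omega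
    obtain rfl : b = 1 := by omega
    right; right; left
    simp only [zpow_zero, one_mul, zpow_one] at h0
    have := h.quad_zero' (x + A) (-y - 1) (by push_cast; linarith)
    omega
  · obtain rfl : a = -1 := by omega
    obtain rfl : b = -1 := by omega
    right; right; right
    have hv := h.vne 0
    have hw := h.ne1 0
    have hr := h.root 0
    have e : α 0 ^ (-1:ℤ) * (α 0 - A) ^ (-1:ℤ) = α 0 - B := by
      rw [zpow_neg_one, zpow_neg_one, ← mul_inv]
      exact inv_eq_of_mul_eq_one_right hr
    rw [e] at h0
    have := h.quad_zero' (x + B) (-y - 1) (by push_cast; linarith)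
    omega

/-- all solutions for given parameters -/
theorem solve {P N A B a0 a1 N1 : ℕ} {c0 c1 c2 : BD}
    (hc : chk P N A B a0 a1 N1 5 c0 c1 c2 = true) (hbox : boxOK A B = true) (x y : ℤ)
    (hn : |x * (x - A * y) * (x - B * y) - y ^ 3| = 1) :
    (x = 1 ∧ y = 0) ∨ (x = -1 ∧ y = 0) ∨ (x = 0 ∧ y = 1) ∨ (x = 0 ∧ y = -1) ∨ (x = A ∧ y = 1) ∨ (x = -A ∧ y = -1) ∨
    (x = B ∧ y = 1) ∨ (x = -B ∧ y = -1) := by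
  have hr : rootChk P A B a0 a1 = true := by
    simp only [chk, Bool.and_eq_true] at hc; exact hc.1.1.1
  simp only [rootChk, Bool.and_eq_true, decide_eq_true_eq] at hr
  obtain ⟨⟨⟨⟨⟨⟨⟨⟨⟨hA, hAB⟩, hB⟩, -⟩, -⟩, -⟩, -⟩, -⟩, -⟩, -⟩ := hr
  obtain ⟨α, h⟩ := RT.exists (A:ℤ) (B:ℤ) (by exact_mod_cast hA) (by exact_mod_cast hAB) (by exact_mod_cast hB)
  have hnR : |((x:ℝ) - y * α 0) * (x - y * α 1) * (x - y * α 2)| = 1 := by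
    have e : ((x:ℝ) - y * α 0) * (x - y * α 1) * (x - y * α 2) =
        ((x * (x - A * y) * (x - B * y) - y ^ 3 : ℤ) : ℝ) := by
      have h1 := h.s1
      have h2 := h.s2
      have h3 := h.s3
      push_cast at h1 h2 ⊢
      linear_combination -(x:ℝ) ^ 2 * y * h1 + x * y ^ 2 * h2 - (y:ℝ) ^ 3 * h3
    rw [e, ← Int.cast_abs, hn, Int.cast_one]
  obtain ⟨a, b, hu⟩ := h.units (fun i => (x:ℝ) - y * α i) ⟨x, -y, 0, fun i => by push_cast; ring⟩ hnR
  have hu' : ∀ i, |(x:ℝ) - y * α i| = |α i ^ a * (α i - ((A:ℤ):ℝ)) ^ b| := by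
    intro i
    rcases hu with hu | hu
    · rw [← hu i]
    · rw [hu i, abs_neg]
  have hX : max a.natAbs b.natAbs ≤ 5 := by
    by_cases hX3 : 3 ≤ max a.natAbs b.natAbs
    · obtain ⟨i, hi⟩ := h.lam_bound x y a b _ rfl hX3 hn hu'
      exact reduce h hc i a b _ rfl hi
    · omega
  have ha : a.natAbs ≤ 5 := by omega
  have hb : b.natAbs ≤ 5 := by omega
  rcases hu with hu | hu
  · rcases h.box hbox x y a b ha hb hu with k | k | k | k
    · exact Or.inl k
    · exact Or.inr (Or.inr (Or.inr (Or.inl k)))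
    · exact Or.inr (Or.inr (Or.inr (Or.inr (Or.inr (Or.inl k)))))
    · exact Or.inr (Or.inr (Or.inr (Or.inr (Or.inr (Or.inr (Or.inr k))))))
  · have hu2 : ∀ i, ((-x : ℤ):ℝ) - (-y : ℤ) * α i = α i ^ a * (α i - ((A:ℤ):ℝ)) ^ b := by
      intro i
      have := hu i
      rw [Int.cast_neg, Int.cast_neg]
      linarith only [this]
    rcases h.box hbox (-x) (-y) a b ha hb hu2 with ⟨k, k'⟩ | ⟨k, k'⟩ | ⟨k, k'⟩ | ⟨k, k'⟩
    · exact Or.inr (Or.inl ⟨by linarith only [k], by linarith only [k']⟩)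
    · exact Or.inr (Or.inr (Or.inl ⟨by linarith only [k], by linarith only [k']⟩))
    · exact Or.inr (Or.inr (Or.inr (Or.inr (Or.inl ⟨by linarith only [k], by linarith only [k']⟩))))
    · exact Or.inr (Or.inr (Or.inr (Or.inr (Or.inr (Or.inr (Or.inl ⟨by linarith only [k], by linarith only [k']⟩))))))

lemma chk_3 : chk (2 ^ 400) 130 2 8
    168192974967202618709063483371563902965597362600699227785835150948155511723292103897336906242792240610658967058316052173
    4942833358195153578800118941495065388785049583507168166294357348490634824515537356199282209816661347036942911049801945628
    68 5
    ⟨15493897788167144059389576070181955848340809761994357,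
     5222712765586487881511908162307523320516560366712048,
     (-5319188192690574843958446187213162494236580760541681),
     89, 30, (-30)⟩
    ⟨166883150657884204445973716084995225090866293837739,
     707617377257825141903438461052565954291497430505283,
     (-175635876905589308298321211869685986493551083279663),
     179, 759, (-189)⟩
    ⟨3406590290892081815903888675911303699466735129989249,
     (-3696699869051934260017145474366211989590084273147683),
     (-289245126013847113601190877517331312741352832497459),
     775, (-841), (-66)⟩ := by
  decide +kernel

lemma chk_4 : chk (2 ^ 400) 130 3 16
    54247474013448371340291059118072538978786027851060099326325228960445112066436451337313915139112685970310326694250800377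
    7680095809198433751860554356053837403787279696630493995426367409814159220389191401779135157883269751039896998572867693857
    47 5
    ⟨493841839133447766300093148025872088998433430490293,
     133568878876696157602941957982156389938062289615531,
     (-134027225097792568974820191631396390491458849033336),
     281, 76, (-76)⟩
    ⟨1715702235828600541675699403380417907540585112872155,
     7725254738757772468066811288307127691439789201394796,
     (-1728142039572841533195781544946194169573384544666365),
     187, 842, (-189)⟩
    ⟨8941987339124299227691530104179792065198214826779131,
     (-9326788245580656589922925031888064394238975248774106),
     (-384672580426647391369173431653221740229415211916751),
     488, (-509), (-21)⟩ := by
  decide +kernel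

lemma chk_5 : chk (2 ^ 400) 130 5 32
    16162451428170706429452301757072048332716275485473270156700632220475654902550193880711716086006262047860067141440214597
    12892098460052855818897267713605729442853099962155350805671938803272117979543024254246488160888796653002687595517960700510
    37 5
    ⟨2948425179498333684313872541748575454167814611235059,
     668009247490066089231626913153306519170852363085981,
     (-668389974445161830979960189799982804090487290044414),
     128, 29, (-29)⟩
    ⟨3883560020473732957722185212029543181066087777670385,
     19650270524824228310867158815147400998782706468035479,
     (-3887611962354594459040782302858003125108847429432671),
     167, 845, (-168)⟩
    ⟨673445058123777738095641362949815495523651495857204,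
     (-690966032869601569970426516022183418271215496184935),
     (-17520284127116570023111497566909873765543341407947),
     4843, (-4969), (-126)⟩ := by
  decide +kernel

lemma chk_6 : chk (2 ^ 400) 130 8 64
    5044842743741178156720669760111496011784198418221226532818529571194959647235614557999586163520033768121969211886040301
    20652233694854762952367556674810508696677371667614123928060811945175429638415010392577134065226262895835384663723951602160
    31 5
    ⟨1622202232507305062498493337169524301722850974333202,
     333046824868568803424093150343463293813405860661405,
     (-333081059471776621815196668376060621180379517821060),
     867, 178, (-178)⟩
    ⟨1099703044467977552875826847177092274795541610021615,
     5874926683050488084332074881399529367160255123719704,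
     (-1099883333534029283542409323515881679138486821658667),
     149, 796, (-150)⟩
    ⟨1573938103169462285787996413632367906862586444027091,
     (-1599605959197066931246528875755838704737297198908697),
     (-25667736311728869602421690961988008147051845972115),
     38202, (-38825), (-623)⟩ := by
  decide +kernel

lemma chk_7 : chk (2 ^ 400) 130 13 128
    1551911890849092654239865654774491177731900415662159623769510486442866501248598993631947960270826816274403042576249352
    33567521078851587785854825576716337633802968565777985707257194379974871196784901893576144192069635523316452833184137532304
    26 5
    ⟨1152578893802900618095739160742082764123420192791831,
     218677039493326734982494560089843556318147041539923,
     (-218681011052685997224270216673363917045323458653175),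
     2356, 447, (-447)⟩
    ⟨21011442800132837528995157692747389625609400978215339,
     118250018887192965441083591565296156803493245052603275,
     (-21011994837932265703524394916623911680454018250648918),
     1126, 6337, (-1127)⟩
    ⟨434514960879113965578940108047986774156452371715218,
     (-439227103113361308905927227299245084757340734680717),
     (-4712139594494914872997732095647934080108307622600),
     512513, (-518071), (-5558)⟩ := by
  decide +kernel

lemma chk_8 : chk (2 ^ 400) 130 21 256
    480333822107633758691392019710577097732719877895931243630234279653871954640269244315961014819167264668925509132694109
    54226724182972258525927184926815574402244008362576705885428491306435905773717795322230018786858423327279496206125176553020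
    23 5
    ⟨5091860133689731486704426315198152460602305619409839,
     911867836407287835109763914442212122660102906484928,
     (-911870801488437565775188198218471849710712887708858),
     4255, 762, (-762)⟩
    ⟨5056259308165402990877315630645532331760406622060955,
     29593137087444239212712000594397130779218886017716407,
     (-5056281315840161185335131522911250829480003761488010),
     5067, 29656, (-5068)⟩
    ⟨2362714064981387503353307230304237738404135179163946,
     (-2380224869786671809260264624151288930138539696092857),
     (-17510803618213012470104898617389317676052540797230),
     218315, (-219933), (-1618)⟩ := by
  decide +kernel

lemma chk_9 : chk (2 ^ 400) 130 34 512
    148337231771353153519447067454006906422521172334619019906900125971043561213152996765361942348187473509521288296765367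
    87796336966558455890626171790640305052709279821296860993116849138057148572041630570971372396335567228031549164170802552894
    20 5
    ⟨2583907961303051584320048865671585883356510180319273,
     441677530011126110780226674767543647491013203417879,
     (-441677786904696357761050808827274124776335153748074),
     35581, 6082, (-6082)⟩
    ⟨6361399709835521981404482051862187169418525311767638,
     38513745169694362748901251365415319375363781817418897,
     (-6361404375056762035118971288122422211222412588409858),
     9247, 55984, (-9248)⟩
    ⟨3753368832700895478111563166218122442006358351544797,
     (-3772874298786020475622711847857006540418446559901734),
     (-19505465923988111066181285922862168077813101823522),
     1055267, (-1060751), (-5484)⟩ := by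
  decide +kernel

lemma chk_10 : chk (2 ^ 400) 130 55 1024
    45849622807026292557655776593572795295280241867187523868217611340244589738820016145766481621613861753802918943466421
    142023694842754284636270388509534728602386928040874102454488507451819536611386762467750356090521641816983196841893115926491
    18 5
    ⟨2395438186449995580097926291245867473511670923574819,
     394405885499598518598692507059384382335697887996924,
     (-394405926704059994766409331690154658804661401657123),
     28825, 4746, (-4746)⟩
    ⟨2784793911120214827235158409291428626589137837164047,
     17346190636634710396193854187131458274472896671440080,
     (-2784794261065550796292944151337791637102376146805994),
     13836, 86183, (-13837)⟩
    ⟨4029767657674258461111893720515687778561811438431592,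
     (-4044707759516563547321556034705433529162103556593091),
     (-14940101827187825372184861668451809239772929342092),
     1491867, (-1497398), (-5531)⟩ := by
  decide +kernel

lemma chk_11 : chk (2 ^ 400) 130 89 2048
    14167014375133553887547651819688343549601732243288793389094247973923527286327083025414129449687847461227356839118247
    229820224339094048319408024115510923143190890276442824850383303795633215091255718063873817560865838358965904020202510064054
    16 5
    ⟨8423340274574119308742689903829142325012719648011549,
     1344365049509028456108702403838674786497607334461977,
     (-1344365074786762895755691352930023977982776991258830),
     57099, 9113, (-9113)⟩
    ⟨5896800782028907131636167481324210033902244036814695,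
     37647845059285918737015344554761009356264576082223133,
     (-5896800910534158897414165632432390541650712673481785),
     7088, 45253, (-7089)⟩
    ⟨4264557426308286808798193053531210846422456937826765,
     (-4276000751425174233022347393864336649347277945160676),
     (-11443325115463321313427474488375988057382630680800),
     5637344, (-5652471), (-15127)⟩ := by
  decide +kernel

lemma chk_12 : chk (2 ^ 400) 130 144 4096
    4378000741845940021918581883043374178962712550170452952447380214468795099706108622386823511858217824467700010916292
    371843977906991802776316824401631889670656003273888169573302471700707684527284110485822212253668138557588889042659993871656
    15 5
    ⟨1743109050419703382568633209231158745846267024307689,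
     271009101866862931136061359686379561667875595244472,
     (-271009102786415600119951719940629315445302759064983),
     129764, 20175, (-20175)⟩
    ⟨2901701334496434260364430419008333723605913746606825,
     18927886588105022176578444364127088783357481878562279,
     (-2901701345576491692620484043130390277946623387244617),
     39187, 255618, (-39188)⟩
    ⟨2620500362172570168730837266770797460898430037696153,
     (-2625647294885976299949715384297931072822198282311351),
     (-5146932713327098605590531802336624244326497670575),
     5188628, (-5198819), (-10191)⟩ := by
  decide +kernel

lemma chk_13 : chk (2 ^ 400) 130 233 8192
    1352858584978914053435760967397049852790677277183334396393814419921708846586302071686150362522128959428509722909716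
    601664220201786134683316390647613383416389771385302512807185444629119688263423586273298466675702079062680565224794281306118
    14 5
    ⟨1713325009570856920982352086696655227514365703085129,
     260481833169746132070900086551373406436118499803443,
     (-260481833329594969354232895196112557791929094415201),
     745424, 113329, (-113329)⟩
    ⟨420707060874270201576719697240792523083591421647467,
     2796698849129094920193178472490718400022973354403519,
     (-420707061158088697743394492369592786757394835129748),
     366245, 2434656, (-366246)⟩
    ⟨1673149491366979217000390469585744189027177531454692,
     (-1675577468876113742575150934934412372097779046830933),
     (-2427977509129913598606329884441746137017652011744),
     74424832, (-74532833), (-108001)⟩ := by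
  decide +kernel

lemma chk_14 : chk (2 ^ 400) 130 377 16384
    418058421365564180279599864046634556798545007353788917718275840819173902321988299062803356116947558093462608695068
    973508203610859923095428055812212875848170007333671215373053702983833080481201926145071358055313572613216811699409139589551
    13 5
    ⟨1877391925418997848286877804811613415917921676655297,
     279956883739137583238475693765231258086871392857488,
     (-279956883770278263435551768896861207845349895298666),
     363794, 54249, (-54249)⟩
    ⟨1685158613491729522861382451524237030682653103601125,
     11391789742307554375577211141232419538934299336491044,
     (-1685158613693983198355692063778994523183275056146987),
     1606646, 10861039, (-1606647)⟩
    ⟨6059985290594398236179860611999191078251033781204604,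
     (-6066532951723545899518277830349085517796815864174375),
     (-6547661129146121633794702292404873111968982632035),
     220853841, (-221092468), (-238627)⟩ := by
  decide +kernel

lemma chk_15 : chk (2 ^ 400) 130 610 32768
    129186905572741542807231527179274122106821578678368943965139711512805874483338350099719348797369090242923005492752
    1575172425501376808201802750265203153430552435434487214934259351462019802690612783114617480203000586691042691560118376541193
    12 5
    ⟨117053104903559811213003258788483273309699794435117997,
     17162500871349642020067946907912367096089628293433193,
     (-17162500871696393340035068995323664098252138856830186),
     1692685, 248184, (-248184)⟩
    ⟨11788488297066076124859820997892058368441574914985972,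
     80893604170994214120105036418685572955368459453923695,
     (-11788488297319257512142750173640196537152204190640309),
     372395, 2555406, (-372396)⟩
    ⟨2575566710642462020977302226040009972348717161264518,
     (-2577652348654155601859903150166207433522654285131029),
     (-2085638011693519909697707952346825848993415648263),
     1566165718, (-1567433965), (-1268247)⟩ := by
  decide +kernel

lemma chk_16 : chk (2 ^ 400) 130 987 65536
    39920978923020205707169987566205737376032854126707542124582846995951256027770116996742399779474515809514494751749
    2548680629631247378980362238553705177486000398163168682460842618517179955940448394462819803418900780041838272302023690108673
    11 5
    ⟨2996954139046848122107822515720684320048900563385987,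
     432923468895598472525201139565054259328755071566986,
     (-432923468897190327950926104773829578389724157125998),
     421593, 60901, (-60901)⟩
    ⟨1919857648549402775930973017343135108575337788726858,
     13352579501334164373807489834413241974779672063546071,
     (-1919857648556817694125173814685804573229417489915259),
     1684051, 11712548, (-1684052)⟩
    ⟨643354452691046902127437948814752647742714616159901,
     (-643747096263655299842738642955145824109034661174649),
     (-392643572608396288220147743330887042495933479029),
     2951042186, (-2952843227), (-1801041)⟩ := by
  decide +kernel

lemma chk_17 : chk (2 ^ 400) 130 1597 131072
    12336257419071316237984673042078365721811029038870653816307343088378333322516113967019321599428747458089771632223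
    4123853055292304599588728784522591570707815976578542537235135561067337585734191096434417818777107703552609964202155834288902
    11 5
    ⟨190927562584739257455527601550564287434678300472008,
     27217999325562441705124461656272438862020781319591,
     (-27217999325580689412022929069476985083628536539341),
     5530979, 788478, (-788478)⟩
    ⟨7297094235135262618448392656777034214082411083355901,
     51370788444717159104438928963410671295376256324089198,
     (-7297094235140352218599808472691966758933488723647270),
     3809328, 26817275, (-3809329)⟩
    ⟨3153560201659609003403772112941241428884500423100295,
     (-3155017782441616463200306828126046375396322738681262),
     (-1457580782007459137221798661624670849993480664234),
     5814152549, (-5816839860), (-2687311)⟩ := by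
  decide +kernel

lemma chk_18 : chk (2 ^ 400) 130 2584 262144
    3812113602594544507958572915142710847429547618700952705660933241254223071209698844736304017817742310382873511860
    6672533684972721731299503020748667618071911617138228858632335584832477453029898280736627230816289771343943833585962284692677
    10 5
    ⟨3673732080881370710635081249742335108544202400620928,
     517557442204261338546039747211697469557322764964685,
     (-517557442204324715488368188450925372419150009494895),
     21069145, 2968233, (-2968233)⟩
    ⟨1094818263228176219974735658449686616655808591744959,
     7792657188710485595551905582626333642528314703126239,
     (-1094818263228314625529278961340060254615129573771662),
     5842791, 41587603, (-5842792)⟩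
    ⟨727138715423459899772643164576502384328037214151125,
     (-727394317173778828453420902883469464403488737051724),
     (-255601750318928666376525498899645630552459920576),
     19390799080, (-19397615279), (-6816199)⟩ := by
  decide +kernel

lemma chk_19 : chk (2 ^ 400) 130 4181 524288
    1178007838926058738971163156439566721905538184859482655426879502034558086446548955215473846465270122507804744187
    10796386740280177335824937416502810413969917235224571109603859312606691973594571778320478285074856270679273571126475633002590
    10 5
    ⟨398738568375237462492241501422394139062166038316000,
     55579829597852845386517340648612501331380675546411,
     (-55579829597854090556353924452585246793575508976904),
     89974859, 12541519, (-12541519)⟩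
    ⟨5135224849841129573532716348649405411782658447651323,
     36919123735677651939912613195473353115638771666875719,
     (-5135224849841247611792214641512807166443788360044925),
     3208414, 23066533, (-3208415)⟩
    ⟨16626358318578463101679456491529978385568367289470117,
     (-16630819699282486245710880810837417941918209200151120),
     (-4461380704023144000093156030594203916469503194462),
     51258802904, (-51272557271), (-13754367)⟩ := by
  decide +kernel

lemma chk_20 : chk (2 ^ 400) 130 6765 1048576
    364024447490717900817762606885831134312982835201259534050103876085824874496756166561732877367264076675399650234
    17468920425257570220781957833585113149037017826442788577566223276281212947845428542028974312453885478933801777429248320317962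
    9 5
    ⟨1857882067179405098116512773961682338073979053648361,
     256486722184948224621465911933943323480464144332614,
     (-256486722184949277535073873980766740303436479649806),
     284099629, 39220887, (-39220887)⟩
    ⟨574699811719572374059139562997521489241954247009835,
     4169710317321573518494302211358939664921871801832903,
     (-574699811719574782630633468503042254611660344762956),
     45525250, 330306537, (-45525251)⟩
    ⟨3709150055296178483997517003067882378285011948611852,
     (-3709912307041759910744437757630982490018315086861173),
     (-762251745581426746253155209044374869747337421845),
     432119673016, (-432208476103), (-88803087)⟩ := by
  decide +kernel

lemma chk_21 : chk (2 ^ 400) 130 10946 2097152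
    112489739963213265239915729639312928568684202746465673765215776056060600167976357444888182364354121616681709877
    28265307165539188342417472488022848387910545349851122339380328485505667222164386961823280695978069844650913441048646358799211
    9 5
    ⟨7827123053954323790518261825451641771622712274992601,
     1071139112392806417202928867563584500140711157144582,
     (-1071139112392807224121617063504530340959849042265900),
     122275629, 16733378, (-16733378)⟩
    ⟨92567238111381472419078138300006287398951315920885,
     677274321212387649786956941275413275077113707361957,
     (-92567238111381543326554892381134485801468003747206),
     56510375, 413461897, (-56510376)⟩
    ⟨314207077612120455492411417660837813567741652538371,
     (-314256675534372915224734282296170762939178798226198),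
     (-49597922252459732317444834461396237826211194668),
     692605938847, (-692715267433), (-109328586)⟩ := by
  decide +kernel

lemma chk_22 : chk (2 ^ 400) 130 17711 4194304
    34761241421639896539443936596709762169182583336082052334940473636063431540779100620671357783126324411658137070
    45734227590797203122748208684542647175499048507959927002602766676807113699227733895497904348250923816838982093228596197865432
    8 5
    ⟨3265471166789949459476411099819627383090820026693849,
     443318444158779476421898615730627881460297418708050,
     (-443318444158779537792352077548146979111472475701586),
     1048969654, 142407503, (-142407503)⟩
    ⟨4393887553026814409348111889083631895451851577023805,
     32397128137208806636356722097686897037560377718905243,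
     (-4393887553026815025860744894494473099833448894315144),
     240052441, 1769961019, (-240052442)⟩
    ⟨873057328680046784203193705287249650477385348928610,
     (-873163462630953324149887753338323950138449061511477),
     (-106133950906539946692600507772267142435126121867),
     679489965038, (-679572567809), (-82602771)⟩ := by
  decide +kernel

lemma chk_23 : chk (2 ^ 400) 130 28657 8388608
    10741814335392117586735952474352629793377751699067451070294473553104228087299160457521542247402679563583022007
    73999534756336528675133572655385710957174723103594742468564462898859802951674685820292680550488477320708428898265123586457172
    8 5
    ⟨4125149810044648616384125213285576846168046617420094,
     555934583533476845709679171622250498486691261865565,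
     (-555934583533476859870765002830652847900487574070299),
     1266773725, 170719454, (-170719454)⟩
    ⟨18167478894553065671884304310349188776914945331995011,
     134909641712317567053749834408497114697276366303658257,
     (-18167478894553066139714012117461960308245050966405080),
     767946776, 5702685827, (-767946777)⟩
    ⟨2531019329999271655174390168071693080291274427818656,
     (-2531256849752870922120014784303307488709354986128175),
     (-237519753599266945624211786589360619542631525300),
     7953418892456, (-7954165269251), (-746376795)⟩ := by
  decide +kernel

lemma chk_24 : chk (2 ^ 400) 130 46368 16777216
    3319403181173782321897625066758952455503379889304479808025394411900396553637384189091734242162117803137046689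
    119733762347133774156563059651330341386675889408904852061245685098467927375971211363636522271735854227855426685891975349443448
    8 5
    ⟨7597733481757438146633361985870465392944453581804708,
     1017033126760000139971256539052712613621505298468701,
     (-1017033126760000144744077717262172727247601562159074),
     4835105515, 647227557, (-647227557)⟩
    ⟨1331614126042248597600859936514179059193344388068445,
     9953734216179633420257366549935168754116625323349129,
     (-1331614126042248603905036338139264079178876184258394),
     1244629708, 9303531007, (-1244629709)⟩
    ⟨1470679691699501380403256543711209540773409481587643,
     (-1470786461265685286656979965394147463766922944079533),
     (-106769566183906253723398979540980077196019296658),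
     56359159175949, (-56363250782714), (-4091606765)⟩ := by
  decide +kernel

lemma chk_25 : chk (2 ^ 400) 130 75025 33554432
    1025751994033095203197000360682963382319222109627627619835424909000222591158862518707668923687810994038605623
    193733297103470315910884703661102899274511901960186382887677126047512308718945534276865916520447501866364851359217227322225218
    7 5
    ⟨829062159631098424141742363610187337741965164657763,
     110288177731715041730778638862807170445610532771920,
     (-110288177731715041826243652360243514976124677313125),
     14834681984, 1973422649, (-1973422649)⟩
    ⟨265149250914084135759142874387088097266023944291638,
     1994115127056806525883220227544076415590166358228919,
     (-265149250914084135990286222690003223973490149212399),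
     2738055667, 20592169148, (-2738055668)⟩
    ⟨2849995415478904503441414928349225431741431676154727,
     (-2850155794565272744907607901815267846870121008433670),
     (-160379086368241466192969206564676070896500630221),
     22875994342683, (-22877281653902), (-1287311219)⟩ := by
  decide +kernel

lemma chk_26 : chk (2 ^ 400) 130 121393 67108864
    316974798185780758731728634868887056042962341069654365287267488730509931523547728108021220965701752469927887
    313467059450604094106551784152143145054778093703641442763285259873216575740184047378303005604488685487521407979811069047058966
    7 5
    ⟨6379646777905665313179244322690522574564178950352063,
     843777918872987240034043770999735228090639786723976,
     (-843777918872987240168908595921073362372720501564967),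
     16922525650, 2238188723, (-2238188723)⟩
    ⟨17878983336760763302745068414400925423164683669585067,
     135228665927687556628215890490678232136567571109505499,
     (-17878983336760763305619134852386288175945602545040193),
     6804657330, 51467396971, (-6804657331)⟩
    ⟨2493735117186542400701458075741340313280925885333713,
     (-2493844086590209167327634263364633462601084513322262),
     (-108969403666766626176187261763075707455638049720),
     222684416417664, (-222694147117567), (-9730699903)⟩ := by
  decide +kernel

lemma chk_27 : chk (2 ^ 400) 130 196418 134217728
    97950599426138346824586091791882247798260919189095054961187516190835302610473000831255906855492907287605060
    507200356554074411264942178756261204240555822567879704529526592354550893225062057253085237303569649886199081035718472087767575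
    7 5
    ⟨1521336988637654738854707988102756891329050986668543,
     200135492813559834315480596660662611894818788997615,
     (-200135492813559834321393540927437859247949946133512),
     40455454471, 5322011085, (-5322011085)⟩
    ⟨7363733072245233497589952750430005475812583088545803,
     55991543666641620872746962741943500084149309026270532,
     (-7363733072245233497808519068962520703858831128214463),
     28579117883, 217306753409, (-28579117884)⟩
    ⟨33639323475033318047793692124479484349340153115510375,
     (-33640466787851059024305130730472547883767243248439516),
     (-1143312817740976511438605519160489822192634479115),
     416917974960169, (-416932144914124), (-14169953955)⟩ := by
  decide +kernel

lemma chk_28 : chk (2 ^ 400) 130 317811 268435456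
    30268399832106569318842111100288824487888166301892795212386732024003497485258371963229288187595151603972376
    820667416004678505756833049747665706509732983707318914844518752170665763492513587455407992353282691034752543949504672463429262
    7 5
    ⟨693213984375935808082401239196308407096283894100599,
     90738655192203491866306480640600089184171690071792,
     (-90738655192203491866802513608106533495337522745262),
     137694034758, 18023542259, (-18023542259)⟩
    ⟨3755080623537845078769665492061286814691778486207949,
     28693966079587417705410376392354052751593723562982570,
     (-3755080623537845078790269763773237210603719807566596),
     28809217480, 220141933563, (-28809217481)⟩
    ⟨2800565677811513643539289029967406339665629259777899,
     (-2800639823177066415075103478977405674916244113322997),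
     (-74145365552771535814449006159291928190051705652),
     2576458069634425, (-2576526281719904), (-68212085479)⟩ := by
  decide +kernel

lemma wrap (n A B : ℕ) (hA : Nat.fib n = A) (hB : 2 ^ n = B)
    (H : ∀ x y : ℤ, |x * (x - A * y) * (x - B * y) - y ^ 3| = 1 →
      (x = 1 ∧ y = 0) ∨ (x = -1 ∧ y = 0) ∨ (x = 0 ∧ y = 1) ∨ (x = 0 ∧ y = -1) ∨ (x = A ∧ y = 1) ∨
      (x = -A ∧ y = -1) ∨ (x = B ∧ y = 1) ∨ (x = -B ∧ y = -1)) :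
    {p : ℤ × ℤ |
        p.1 * (p.1 - (Nat.fib n : ℤ) * p.2) * (p.1 - 2 ^ n * p.2) - p.2 ^ 3 = 1 ∨
        p.1 * (p.1 - (Nat.fib n : ℤ) * p.2) * (p.1 - 2 ^ n * p.2) - p.2 ^ 3 = -1} =
      {(1, 0), (-1, 0), (0, 1), (0, -1), ((Nat.fib n : ℤ), 1), (-(Nat.fib n : ℤ), -1),
        ((2 : ℤ) ^ n, 1), (-((2 : ℤ) ^ n), -1)} := by
  have hB' : (2:ℤ) ^ n = B := by rw [← hB]; push_cast; rfl
  rw [hA, hB']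
  ext ⟨x, y⟩
  simp only [Set.mem_setOf_eq, Set.mem_insert_iff, Set.mem_singleton_iff, Prod.mk.injEq]
  constructor
  · intro h
    apply H
    rcases h with h | h <;> rw [h] <;> rfl
  · rintro (⟨rfl, rfl⟩ | ⟨rfl, rfl⟩ | ⟨rfl, rfl⟩ | ⟨rfl, rfl⟩ | ⟨rfl, rfl⟩ | ⟨rfl, rfl⟩ | ⟨rfl, rfl⟩ | ⟨rfl, rfl⟩)
    · left; ring
    · right; ring
    · right; ring
    · left; ring
    · right; ring
    · left; ring
    · right; ring
    · left; ring

/-- For `3 ≤ n ≤ 28`, the Thue equation `x(x - Fₙ y)(x - 2ⁿ y) - y³ = ±1`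
has exactly the trivial solutions. -/
theorem thue_fib_pow2_solutions_n_le_28 (n : ℕ) (hn : 3 ≤ n) (hn' : n ≤ 28) :
    {p : ℤ × ℤ |
        p.1 * (p.1 - (Nat.fib n : ℤ) * p.2) * (p.1 - 2 ^ n * p.2) - p.2 ^ 3 = 1 ∨
        p.1 * (p.1 - (Nat.fib n : ℤ) * p.2) * (p.1 - 2 ^ n * p.2) - p.2 ^ 3 = -1} =
      {(1, 0), (-1, 0), (0, 1), (0, -1), ((Nat.fib n : ℤ), 1), (-(Nat.fib n : ℤ), -1),
        ((2 : ℤ) ^ n, 1), (-((2 : ℤ) ^ n), -1)} := by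
  interval_cases n
  · exact wrap 3 2 8 (by norm_num) (by norm_num) (solve chk_3 (by decide +kernel))
  · exact wrap 4 3 16 (by norm_num) (by norm_num) (solve chk_4 (by decide +kernel))
  · exact wrap 5 5 32 (by norm_num) (by norm_num) (solve chk_5 (by decide +kernel))
  · exact wrap 6 8 64 (by norm_num) (by norm_num) (solve chk_6 (by decide +kernel))
  · exact wrap 7 13 128 (by norm_num) (by norm_num) (solve chk_7 (by decide +kernel))
  · exact wrap 8 21 256 (by norm_num) (by norm_num) (solve chk_8 (by decide +kernel))
  · exact wrap 9 34 512 (by norm_num) (by norm_num) (solve chk_9 (by decide +kernel))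
  · exact wrap 10 55 1024 (by norm_num) (by norm_num) (solve chk_10 (by decide +kernel))
  · exact wrap 11 89 2048 (by norm_num) (by norm_num) (solve chk_11 (by decide +kernel))
  · exact wrap 12 144 4096 (by norm_num) (by norm_num) (solve chk_12 (by decide +kernel))
  · exact wrap 13 233 8192 (by norm_num) (by norm_num) (solve chk_13 (by decide +kernel))
  · exact wrap 14 377 16384 (by norm_num) (by norm_num) (solve chk_14 (by decide +kernel))
  · exact wrap 15 610 32768 (by norm_num) (by norm_num) (solve chk_15 (by decide +kernel))
  · exact wrap 16 987 65536 (by norm_num) (by norm_num) (solve chk_16 (by decide +kernel))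
  · exact wrap 17 1597 131072 (by norm_num) (by norm_num) (solve chk_17 (by decide +kernel))
  · exact wrap 18 2584 262144 (by norm_num) (by norm_num) (solve chk_18 (by decide +kernel))
  · exact wrap 19 4181 524288 (by norm_num) (by norm_num) (solve chk_19 (by decide +kernel))
  · exact wrap 20 6765 1048576 (by norm_num) (by norm_num) (solve chk_20 (by decide +kernel))
  · exact wrap 21 10946 2097152 (by norm_num) (by norm_num) (solve chk_21 (by decide +kernel))
  · exact wrap 22 17711 4194304 (by norm_num) (by norm_num) (solve chk_22 (by decide +kernel))
  · exact wrap 23 28657 8388608 (by norm_num) (by norm_num) (solve chk_23 (by decide +kernel))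
  · exact wrap 24 46368 16777216 (by norm_num) (by norm_num) (solve chk_24 (by decide +kernel))
  · exact wrap 25 75025 33554432 (by norm_num) (by norm_num) (solve chk_25 (by decide +kernel))
  · exact wrap 26 121393 67108864 (by norm_num) (by norm_num) (solve chk_26 (by decide +kernel))
  · exact wrap 27 196418 134217728 (by norm_num) (by norm_num) (solve chk_27 (by decide +kernel))
  · exact wrap 28 317811 268435456 (by norm_num) (by norm_num) (solve chk_28 (by decide +kernel))
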